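/- Let T and U be computable consistent extensions of PA and n ≥ 1. The following are equivalent: (1) T + Th_{Π_n}(U) is consistent; (2) there is a Σ_n sentence in HCons(Π_n,T) ∩ HCons(Π_n,U) \ Th(T); (3) HCons(Π_n,U) \ Th(T) ≠ ∅; (4) there is a Π_n sentence in HCons(Σ_n,T) ∩ HCons(Σ_n,U) \ Th(U); (5) HCons(Σ_n,T) \ Th(U) ≠ ∅; (6) there is a sentence φ ∈ HCons(Δ_n,T) such that PA + φ is not Π_n-conservative over U (i.e., some Π_n sentence is provable in PA + φ but not in U). -/

import Mathlib

open FirstOrder Language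
open scoped FirstOrder

namespace Guaspari

/-- The first-order language of arithmetic: a constant `0`, a unary function `S`,
binary functions `+` (coded `false`) and `·` (coded `true`), and a binary relation `≤`. -/
def LA : FirstOrder.Language :=
  ⟨fun n => match n with | 0 => Unit | 1 => Unit | 2 => Bool | _ => Empty,
   fun n => match n with | 2 => Unit | _ => Empty⟩

/-- Sentences of the language of arithmetic. -/
abbrev Snt : Type := LA.Sentence

/-- Theories (sets of sentences) in the language of arithmetic. -/
abbrev Thy : Type := LA.Theory

/-- The term `0`. -/
def zeroT {α : Type} {n : ℕ} : LA.Term (α ⊕ Fin n) :=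
  Constants.term (show LA.Constants from Unit.unit)

/-- The term `S t`. -/
def succT {α : Type} {n : ℕ} (t : LA.Term (α ⊕ Fin n)) : LA.Term (α ⊕ Fin n) :=
  Functions.apply₁ (show LA.Functions 1 from Unit.unit) t

/-- The term `t + u`. -/
def addT {α : Type} {n : ℕ} (t u : LA.Term (α ⊕ Fin n)) : LA.Term (α ⊕ Fin n) :=
  Functions.apply₂ (show LA.Functions 2 from false) t u

/-- The term `t * u`. -/
def mulT {α : Type} {n : ℕ} (t u : LA.Term (α ⊕ Fin n)) : LA.Term (α ⊕ Fin n) :=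
  Functions.apply₂ (show LA.Functions 2 from true) t u

/-- The atomic formula `t ≤ u`. -/
def leF {α : Type} {n : ℕ} (t u : LA.Term (α ⊕ Fin n)) : LA.BoundedFormula α n :=
  Relations.boundedFormula₂ (show LA.Relations 2 from Unit.unit) t u

/-- The `i`-th (de Bruijn-indexed) bound variable as a term. -/
def vT {m : ℕ} (i : Fin m) : LA.Term (Empty ⊕ Fin m) := Term.var (Sum.inr i)

/-- The induction axiom for the formula `φ(x₀,…,x_{k-1}, x_k)` with induction on `x_k`,
universally closed over the parameters `x₀,…,x_{k-1}`. -/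
def indAxiom {k : ℕ} (φ : LA.BoundedFormula Empty (k + 1)) : Snt :=
  let base := ∀' ((vT (Fin.last k) =' zeroT) ⟹ φ)
  let step := ∀' (φ ⟹
    ∀' ((vT (Fin.last (k + 1)) =' succT (vT (Fin.castSucc (Fin.last k)))) ⟹ φ.liftAt 1 k))
  ((base ⊓ step) ⟹ ∀' φ).alls

/-- The axioms of Peano arithmetic `PA`: the basic axioms for `0`, `S`, `+`, `·`, `≤`,
together with the full induction scheme. -/
def PAAx : Thy :=
  {∀' ∼(succT (vT 0) =' zeroT),
   ∀' ∀' ((succT (vT 0) =' succT (vT 1)) ⟹ (vT 0 =' vT 1)),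
   ∀' (addT (vT 0) zeroT =' vT 0),
   ∀' ∀' (addT (vT 0) (succT (vT 1)) =' succT (addT (vT 0) (vT 1))),
   ∀' (mulT (vT 0) zeroT =' zeroT),
   ∀' ∀' (mulT (vT 0) (succT (vT 1)) =' addT (mulT (vT 0) (vT 1)) (vT 0)),
   ∀' ∀' (leF (vT 0) (vT 1) ⇔ ∃' (addT (vT 2) (vT 0) =' vT 1))} ∪
  {φ | ∃ (k : ℕ) (ψ : LA.BoundedFormula Empty (k + 1)), φ = indAxiom ψ}

/-- `Prv T φ`: the sentence `φ` is provable from the theory `T` (equivalently, by the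
Gödel completeness theorem, `φ` holds in every model of `T`). -/
def Prv (T : Thy) (φ : Snt) : Prop := T ⊨ᵇ φ

/-- `Th T`: the set of sentences provable from `T`. -/
def Th (T : Thy) : Set Snt := {φ | Prv T φ}

/-- `Con T`: the theory `T` is consistent. -/
def Con (T : Thy) : Prop := ¬ Prv T ⊥

/-- The theory `T + φ`. -/
def add (T : Thy) (φ : Snt) : Thy := insert φ T

/-- `T` is an extension of `PA`. -/
def ExtPA (T : Thy) : Prop := ∀ φ ∈ PAAx, Prv T φ

/-- `V` is a subtheory of `T` (containing `PA`, as assumed throughout the paper). -/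
def SubThy (V T : Thy) : Prop := ExtPA V ∧ ∀ φ, Prv V φ → Prv T φ

/-- Δ₀ (bounded) formulas. -/
inductive IsDelta0 : ∀ {m : ℕ}, LA.BoundedFormula Empty m → Prop
  | falsum {m : ℕ} : IsDelta0 (⊥ : LA.BoundedFormula Empty m)
  | equal {m : ℕ} (t u : LA.Term (Empty ⊕ Fin m)) : IsDelta0 (t =' u)
  | le {m : ℕ} (t u : LA.Term (Empty ⊕ Fin m)) : IsDelta0 (leF t u)
  | imp {m : ℕ} {φ ψ : LA.BoundedFormula Empty m} :
      IsDelta0 φ → IsDelta0 ψ → IsDelta0 (φ ⟹ ψ)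
  | ball {m : ℕ} (t : LA.Term (Empty ⊕ Fin m)) {φ : LA.BoundedFormula Empty (m + 1)} :
      IsDelta0 φ →
      IsDelta0 (∀' (leF (vT (Fin.last m)) (t.relabel (Sum.map id Fin.castSucc)) ⟹ φ))
  | bex {m : ℕ} (t : LA.Term (Empty ⊕ Fin m)) {φ : LA.BoundedFormula Empty (m + 1)} :
      IsDelta0 φ →
      IsDelta0 (∃' (leF (vT (Fin.last m)) (t.relabel (Sum.map id Fin.castSucc)) ⊓ φ))

mutual
  /-- `Σ_k` formulas (cumulatively: every `Π_k` formula is `Σ_{k+1}`). -/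
  inductive IsSigmaFml : ℕ → ∀ {m : ℕ}, LA.BoundedFormula Empty m → Prop
    | ofDelta0 {m : ℕ} {φ : LA.BoundedFormula Empty m} : IsDelta0 φ → IsSigmaFml 0 φ
    | ofPi {k : ℕ} {m : ℕ} {φ : LA.BoundedFormula Empty m} :
        IsPiFml k φ → IsSigmaFml (k + 1) φ
    | ex {k : ℕ} {m : ℕ} {φ : LA.BoundedFormula Empty (m + 1)} :
        IsSigmaFml (k + 1) φ → IsSigmaFml (k + 1) (∃' φ)
  /-- `Π_k` formulas (cumulatively: every `Σ_k` formula is `Π_{k+1}`). -/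
  inductive IsPiFml : ℕ → ∀ {m : ℕ}, LA.BoundedFormula Empty m → Prop
    | ofDelta0 {m : ℕ} {φ : LA.BoundedFormula Empty m} : IsDelta0 φ → IsPiFml 0 φ
    | ofSigma {k : ℕ} {m : ℕ} {φ : LA.BoundedFormula Empty m} :
        IsSigmaFml k φ → IsPiFml (k + 1) φ
    | all {k : ℕ} {m : ℕ} {φ : LA.BoundedFormula Empty (m + 1)} :
        IsPiFml (k + 1) φ → IsPiFml (k + 1) (∀' φ)
end

/-- The set of `Σ_k` sentences. -/
def SigmaS (k : ℕ) : Set Snt := {φ | IsSigmaFml k φ}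

/-- The set of `Π_k` sentences. -/
def PiS (k : ℕ) : Set Snt := {φ | IsPiFml k φ}

/-- The set of `Σ_k ∧ Π_k` sentences, i.e. sentences of the form `σ ∧ π` with
`σ` a `Σ_k` sentence and `π` a `Π_k` sentence. -/
def SigAndPiS (k : ℕ) : Set Snt :=
  {φ | ∃ σ ∈ SigmaS k, ∃ π ∈ PiS k, φ = σ ⊓ π}

/-- `B(Σ_k)` sentences: Boolean combinations of `Σ_k` sentences. -/
inductive IsBoolSigma (k : ℕ) : Snt → Prop
  | base {φ : Snt} : φ ∈ SigmaS k → IsBoolSigma k φ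
  | not {φ : Snt} : IsBoolSigma k φ → IsBoolSigma k (∼φ)
  | imp {φ ψ : Snt} : IsBoolSigma k φ → IsBoolSigma k ψ → IsBoolSigma k (φ ⟹ ψ)
  | inf {φ ψ : Snt} : IsBoolSigma k φ → IsBoolSigma k ψ → IsBoolSigma k (φ ⊓ ψ)
  | sup {φ ψ : Snt} : IsBoolSigma k φ → IsBoolSigma k ψ → IsBoolSigma k (φ ⊔ ψ)

/-- The set of `B(Σ_k)` sentences. -/
def BSigmaS (k : ℕ) : Set Snt := {φ | IsBoolSigma k φ}

/-- The set of `Γ` sentences provable in `T`, `Th_Γ(T)`. -/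
def ThIn (Γ : Set Snt) (T : Thy) : Set Snt := Γ ∩ Th T

instance (i : ℕ) : Encodable (LA.Functions i) :=
  match i with
  | 0 => inferInstanceAs (Encodable Unit)
  | 1 => inferInstanceAs (Encodable Unit)
  | 2 => inferInstanceAs (Encodable Bool)
  | (_ + 3) => inferInstanceAs (Encodable Empty)

instance (i : ℕ) : Encodable (LA.Relations i) :=
  match i with
  | 0 => inferInstanceAs (Encodable Empty)
  | 1 => inferInstanceAs (Encodable Empty)
  | 2 => inferInstanceAs (Encodable Unit)
  | (_ + 3) => inferInstanceAs (Encodable Empty)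

/-- A Gödel numbering of sentences, via Mathlib's encoding of bounded formulas. -/
def gnum (φ : Snt) : ℕ :=
  Encodable.encode
    (show List ((Σ k, LA.Term (Empty ⊕ Fin k)) ⊕ ((Σ n, LA.Relations n) ⊕ ℕ)) from
      BoundedFormula.encoding.encode (⟨0, φ⟩ : Σ n, LA.BoundedFormula Empty n))

/-- The (axiom set of the) theory `T` is computable. -/
def CompThy (T : Thy) : Prop :=
  ComputablePred (fun m : ℕ => ∃ φ ∈ T, gnum φ = m)

/-- `T` is a computable consistent extension of `PA`. -/
def GoodThy (T : Thy) : Prop := CompThy T ∧ Con T ∧ ExtPA T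

/-- `φ` is `Γ`-conservative over `T` for a class of sentences `Γ`:
every `Γ` sentence provable in `T + φ` is provable in `T`. -/
def ConsIn (Γ : Set Snt) (T : Thy) (φ : Snt) : Prop :=
  ∀ γ ∈ Γ, Prv (add T φ) γ → Prv T γ

/-- `φ` is hereditarily `Γ`-conservative over `T`: `Γ`-conservative over every
subtheory of `T` (containing `PA`). -/
def HConsIn (Γ : Set Snt) (T : Thy) (φ : Snt) : Prop :=
  ∀ V : Thy, SubThy V T → ConsIn Γ V φ

/-- `φ` is `Σ_k↓Π_k`-conservative over `V`. -/
def SPCons (k : ℕ) (V : Thy) (φ : Snt) : Prop :=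
  ∀ σ ∈ SigmaS k, ∀ π ∈ PiS k, Prv (add V φ) (σ ⊓ π) → Prv V (σ ⊔ π)

/-- `φ` is hereditarily `Σ_k↓Π_k`-conservative over `T`. -/
def HSPCons (k : ℕ) (T : Thy) (φ : Snt) : Prop :=
  ∀ V : Thy, SubThy V T → SPCons k V φ

/-- The theory `S` is `Σ_k↓Π_k`-conservative over `PA`. -/
def ThySPConsPA (k : ℕ) (S : Thy) : Prop :=
  ∀ σ ∈ SigmaS k, ∀ π ∈ PiS k, Prv S (σ ⊓ π) → Prv PAAx (σ ⊔ π)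

/-- `δ` is a `Δ_k(S)` sentence: `S`-provably equivalent to both a `Σ_k` sentence
and a `Π_k` sentence. -/
def IsDeltaIn (k : ℕ) (S : Thy) (δ : Snt) : Prop :=
  (∃ σ ∈ SigmaS k, Prv S (δ ⇔ σ)) ∧ ∃ π ∈ PiS k, Prv S (δ ⇔ π)

/-- `φ` is `Δ_k(S)`-conservative over `V`. -/
def DeltaConsRel (k : ℕ) (S V : Thy) (φ : Snt) : Prop :=
  ∀ δ : Snt, IsDeltaIn k S δ → Prv (add V φ) δ → Prv V δ

/-- `φ` is `Δ_k`-conservative over `T`, i.e. `Δ_k(Th(T))`-conservative over `T`. -/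
def DeltaCons (k : ℕ) (T : Thy) (φ : Snt) : Prop := DeltaConsRel k (Th T) T φ

/-- `φ` is hereditarily `Δ_k`-conservative over `T`. -/
def HDeltaCons (k : ℕ) (T : Thy) (φ : Snt) : Prop :=
  ∀ V : Thy, SubThy V T → DeltaConsRel k (Th V) V φ

/-- `φ` is doubly `Π_k`-conservative over `T`: `φ` is `Π_k`-conservative and `¬φ` is
`Σ_k`-conservative over `T`. -/
def DCons (k : ℕ) (T : Thy) (φ : Snt) : Prop :=
  ConsIn (PiS k) T φ ∧ ConsIn (SigmaS k) T (∼φ)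

/-- `φ` is hereditarily doubly `Π_k`-conservative over `T`. -/
def HDCons (k : ℕ) (T : Thy) (φ : Snt) : Prop :=
  ∀ V : Thy, SubThy V T → DCons k V φ

/-- `(T,U)` is a `B_n`-pair. -/
def Bpair (n : ℕ) (T U : Thy) : Prop :=
  (¬ ThIn (PiS n) T ⊆ Th U ∨ Con (T ∪ ThIn (PiS n) U)) ∧
  (¬ ThIn (PiS n) U ⊆ Th T ∨ Con (U ∪ ThIn (PiS n) T))

/-- `(T,U)` is a `C_n`-pair. -/
def Cpair (n : ℕ) (T U : Thy) : Prop :=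
  Con (T ∪ ThIn (PiS n) U) ∧ Con (U ∪ ThIn (PiS n) T)

/-- `(T,U)` is a `C⁻_n`-pair. -/
def Cmpair (n : ℕ) (T U : Thy) : Prop :=
  Con (T ∪ ThIn (PiS n) U) ∨ Con (U ∪ ThIn (PiS n) T)

/-- `(T,U)` is a `C^∧_n`-pair. -/
def Capair (n : ℕ) (T U : Thy) : Prop :=
  Con (T ∪ ThIn (SigAndPiS n) U) ∧ Con (U ∪ ThIn (SigAndPiS n) T)

/-- `(T,U)` is a `C^B_n`-pair. -/
def CBpair (n : ℕ) (T U : Thy) : Prop :=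
  Con (T ∪ ThIn (BSigmaS n) U)


section Work
open FirstOrder Language
open scoped FirstOrder
set_option linter.unusedVariables false
set_option linter.unusedSectionVars false
set_option linter.unusedSimpArgs false

section Raw
variable {M : Type} [LA.Structure M]

/-- The interpretation of `0`. -/
def rz (M : Type) [LA.Structure M] : M :=
  Structure.funMap (L := LA) (n := 0) (show LA.Functions 0 from Unit.unit) ![]
/-- The interpretation of `S`. -/
def rs (x : M) : M := Structure.funMap (L := LA) (n := 1) (show LA.Functions 1 from Unit.unit) ![x]
/-- The interpretation of `+`. -/
def ra (x y : M) : M := Structure.funMap (L := LA) (n := 2) (show LA.Functions 2 from false) ![x, y]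
/-- The interpretation of `*`. -/
def rm (x y : M) : M := Structure.funMap (L := LA) (n := 2) (show LA.Functions 2 from true) ![x, y]
/-- The interpretation of `≤`. -/
def rl (x y : M) : Prop :=
  Structure.RelMap (L := LA) (n := 2) (show LA.Relations 2 from Unit.unit) ![x, y]

theorem real_zeroT {α : Type} {n : ℕ} (v : α ⊕ Fin n → M) :
    (zeroT : LA.Term (α ⊕ Fin n)).realize v = rz M := by
  rw [zeroT, rz]
  simp only [Constants.term, Term.realize]
  congr 1
  exact Subsingleton.elim _ _

theorem real_succT {α : Type} {n : ℕ} (v : α ⊕ Fin n → M) (t : LA.Term (α ⊕ Fin n)) :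
    (succT t).realize v = rs (t.realize v) := by
  rw [succT, rs, Term.realize_functions_apply₁]

theorem real_addT {α : Type} {n : ℕ} (v : α ⊕ Fin n → M) (t u : LA.Term (α ⊕ Fin n)) :
    (addT t u).realize v = ra (t.realize v) (u.realize v) := by
  rw [addT, ra, Term.realize_functions_apply₂]

theorem real_mulT {α : Type} {n : ℕ} (v : α ⊕ Fin n → M) (t u : LA.Term (α ⊕ Fin n)) :
    (mulT t u).realize v = rm (t.realize v) (u.realize v) := by
  rw [mulT, rm, Term.realize_functions_apply₂]

theorem real_leF {α : Type} {n : ℕ} (v : α → M) (xs : Fin n → M) (t u : LA.Term (α ⊕ Fin n)) :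
    (leF t u).Realize v xs ↔ rl (t.realize (Sum.elim v xs)) (u.realize (Sum.elim v xs)) := by
  rw [leF, rl, BoundedFormula.realize_rel₂]

theorem real_vT {n : ℕ} (v : Empty → M) (xs : Fin n → M) (i : Fin n) :
    (vT i).realize (Sum.elim v xs) = xs i := rfl

theorem raw_ind (h : M ⊨ PAAx) {k : ℕ} (φ : LA.BoundedFormula Empty (k + 1)) (v : Fin k → M)
    (h0 : φ.Realize default (Fin.snoc v (rz M)))
    (hs : ∀ x, φ.Realize default (Fin.snoc v x) → φ.Realize default (Fin.snoc v (rs x))) :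
    ∀ x, φ.Realize default (Fin.snoc v x) := by
  have h1 : M ⊨ indAxiom φ := h.realize_of_mem _ (Or.inr ⟨k, φ, rfl⟩)
  rw [indAxiom, Sentence.Realize, BoundedFormula.realize_alls] at h1
  have h2 := h1 v
  rw [BoundedFormula.realize_imp, BoundedFormula.realize_inf] at h2
  refine h2 ⟨?_, ?_⟩
  · intro a ha
    rw [BoundedFormula.realize_bdEqual, real_zeroT, real_vT] at ha
    simp only [Fin.snoc_last] at ha
    subst ha
    exact h0
  · intro a ha b hb
    rw [BoundedFormula.realize_bdEqual, real_succT, real_vT, real_vT] at hb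
    simp only [Fin.snoc_last, Fin.snoc_castSucc] at hb
    subst hb
    rw [BoundedFormula.realize_liftAt_one (Nat.le_succ k)]
    convert hs a ha using 1
    funext i
    refine Fin.lastCases ?_ (fun j => ?_) i
    · simp [Fin.succ_last]
    · simp only [Function.comp, Fin.val_castSucc, Fin.is_lt, if_true, Fin.snoc_castSucc]

theorem raw_ax (h : M ⊨ PAAx) :
    (∀ x : M, rs x ≠ rz M) ∧ (∀ x y : M, rs x = rs y → x = y) ∧
    (∀ x : M, ra x (rz M) = x) ∧ (∀ x y : M, ra x (rs y) = rs (ra x y)) ∧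
    (∀ x : M, rm x (rz M) = rz M) ∧ (∀ x y : M, rm x (rs y) = ra (rm x y) x) ∧
    (∀ x y : M, rl x y ↔ ∃ z, ra z x = y) := by
  refine ⟨?_, ?_, ?_, ?_, ?_, ?_, ?_⟩
  · have := h.realize_of_mem _ (Or.inl (Or.inl rfl))
    intro x hx
    refine (BoundedFormula.realize_not.1 (this x)) ?_
    rw [BoundedFormula.realize_bdEqual, real_succT, real_zeroT, real_vT]
    exact hx
  · have := h.realize_of_mem _ (Or.inl (Or.inr (Or.inl rfl)))
    intro x y hx
    have := this x y
    rw [BoundedFormula.realize_imp, BoundedFormula.realize_bdEqual, real_succT, real_succT] at this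
    exact this hx
  · have := h.realize_of_mem _ (Or.inl (Or.inr (Or.inr (Or.inl rfl))))
    intro x
    have := this x
    rw [BoundedFormula.realize_bdEqual, real_addT, real_zeroT] at this
    exact this
  · have := h.realize_of_mem _ (Or.inl (Or.inr (Or.inr (Or.inr (Or.inl rfl)))))
    intro x y
    have := this x y
    rw [BoundedFormula.realize_bdEqual, real_addT, real_succT, real_succT, real_addT] at this
    exact this
  · have := h.realize_of_mem _ (Or.inl (Or.inr (Or.inr (Or.inr (Or.inr (Or.inl rfl))))))
    intro x
    have := this x
    rw [BoundedFormula.realize_bdEqual, real_mulT, real_zeroT] at this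
    exact this
  · have := h.realize_of_mem _ (Or.inl (Or.inr (Or.inr (Or.inr (Or.inr (Or.inr (Or.inl rfl)))))))
    intro x y
    have := this x y
    rw [BoundedFormula.realize_bdEqual, real_mulT, real_succT, real_addT, real_mulT] at this
    exact this
  · have := h.realize_of_mem _ (Or.inl (Or.inr (Or.inr (Or.inr (Or.inr (Or.inr (Or.inr rfl)))))))
    intro x y
    have := this x y
    rw [BoundedFormula.realize_iff, real_leF, BoundedFormula.realize_ex] at this
    refine this.trans (exists_congr fun z => ?_)
    rw [BoundedFormula.realize_bdEqual, real_addT]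
    exact Iff.rfl

end Raw

/-- Models of PA, presented as ordered semirings with definable induction. -/
class PAM (M : Type) extends LA.Structure M, CommSemiring M, LinearOrder M where
  r_zero : rz M = 0
  r_succ : ∀ x : M, rs x = x + 1
  r_add : ∀ x y : M, ra x y = x + y
  r_mul : ∀ x y : M, rm x y = x * y
  r_le : ∀ x y : M, rl x y ↔ x ≤ y
  le_iff : ∀ x y : M, x ≤ y ↔ ∃ z, z + x = y
  s_ne : ∀ x : M, x + 1 ≠ 0
  zs : ∀ x : M, x = 0 ∨ ∃ y, x = y + 1
  cancel : ∀ x y z : M, x + z = y + z → x = y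
  ind : ∀ {k : ℕ} (φ : LA.BoundedFormula Empty (k + 1)) (v : Fin k → M),
    φ.Realize default (Fin.snoc v 0) →
    (∀ x, φ.Realize default (Fin.snoc v x) → φ.Realize default (Fin.snoc v (x + 1))) →
    ∀ x, φ.Realize default (Fin.snoc v x)

section RawAlg
variable {M : Type} [LA.Structure M]

/-- Induction on an equation between terms with two parameters. -/
theorem raw_ind_eq (h : M ⊨ PAAx) (t u : LA.Term (Empty ⊕ Fin 3)) (a b : M)
    (P : M → Prop)
    (hP : ∀ x, P x ↔ t.realize (Sum.elim default ![a, b, x]) = u.realize (Sum.elim default ![a, b, x]))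
    (h0 : P (rz M)) (hs : ∀ x, P x → P (rs x)) (x : M) : P x := by
  have key : ∀ x, P x ↔ (t =' u).Realize (default : Empty → M) (Fin.snoc ![a, b] x) := by
    intro x
    rw [hP, BoundedFormula.realize_bdEqual]
    have : (Fin.snoc ![a, b] x : Fin 3 → M) = ![a, b, x] := by
      funext i; fin_cases i <;> rfl
    rw [this]
  rw [key]
  exact raw_ind h _ _ ((key _).1 h0) (fun x hx => (key _).1 (hs x ((key x).2 hx))) x

/-- A raw model of PA is a `PAM`. -/
@[reducible] noncomputable def PAM.ofModel (M : Type) [i : LA.Structure M] (h : M ⊨ PAAx) : PAM M := by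
  classical
  have a1 := (raw_ax h).1
  have a2 := (raw_ax h).2.1
  have a3 := (raw_ax h).2.2.1
  have a4 := (raw_ax h).2.2.2.1
  have a5 := (raw_ax h).2.2.2.2.1
  have a6 := (raw_ax h).2.2.2.2.2.1
  have a7 := (raw_ax h).2.2.2.2.2.2
  have zadd : ∀ x : M, ra (rz M) x = x := by
    intro x
    refine raw_ind_eq h (addT zeroT (vT 2)) (vT 2) x x (fun x => ra (rz M) x = x) ?_ ?_ ?_ x
    · intro x; simp only [real_addT, real_zeroT, real_vT]; rfl
    · exact a3 _
    · intro x hx; simp only [a4, hx]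
  have sadd : ∀ a x : M, ra (rs a) x = rs (ra a x) := by
    intro a x
    refine raw_ind_eq h (addT (succT (vT 0)) (vT 2)) (succT (addT (vT 0) (vT 2))) a a
      (fun x => ra (rs a) x = rs (ra a x)) ?_ ?_ ?_ x
    · intro x; simp only [real_addT, real_succT, real_vT]; rfl
    · simp only [a3]
    · intro x hx; simp only [a4, hx]
  have addc : ∀ a x : M, ra a x = ra x a := by
    intro a x
    refine raw_ind_eq h (addT (vT 0) (vT 2)) (addT (vT 2) (vT 0)) a a
      (fun x => ra a x = ra x a) ?_ ?_ ?_ x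
    · intro x; simp only [real_addT, real_vT]; rfl
    · simp only [a3, zadd]
    · intro x hx; simp only [a4, sadd, hx]
  have adda : ∀ a b x : M, ra (ra a b) x = ra a (ra b x) := by
    intro a b x
    refine raw_ind_eq h (addT (addT (vT 0) (vT 1)) (vT 2)) (addT (vT 0) (addT (vT 1) (vT 2))) a b
      (fun x => ra (ra a b) x = ra a (ra b x)) ?_ ?_ ?_ x
    · intro x; simp only [real_addT, real_vT]; rfl
    · simp only [a3]
    · intro x hx; simp only [a4, hx]
  have zmul : ∀ x : M, rm (rz M) x = rz M := by
    intro x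
    refine raw_ind_eq h (mulT zeroT (vT 2)) zeroT x x (fun x => rm (rz M) x = rz M) ?_ ?_ ?_ x
    · intro x; simp only [real_mulT, real_zeroT, real_vT]; rfl
    · exact a5 _
    · intro x hx; simp only [a6, hx, a3]
  have smul : ∀ a x : M, rm (rs a) x = ra (rm a x) x := by
    intro a x
    refine raw_ind_eq h (mulT (succT (vT 0)) (vT 2)) (addT (mulT (vT 0) (vT 2)) (vT 2)) a a
      (fun x => rm (rs a) x = ra (rm a x) x) ?_ ?_ ?_ x
    · intro x; simp only [real_addT, real_mulT, real_succT, real_vT]; rfl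
    · simp only [a5, a3]
    · intro x hx
      simp only [a6, hx, a4]
      rw [adda, adda, addc x a]
  have mulc : ∀ a x : M, rm a x = rm x a := by
    intro a x
    refine raw_ind_eq h (mulT (vT 0) (vT 2)) (mulT (vT 2) (vT 0)) a a
      (fun x => rm a x = rm x a) ?_ ?_ ?_ x
    · intro x; simp only [real_mulT, real_vT]; rfl
    · simp only [a5, zmul]
    · intro x hx; simp only [a6, smul, hx]
  have ldist : ∀ a b x : M, rm a (ra b x) = ra (rm a b) (rm a x) := by
    intro a b x
    refine raw_ind_eq h (mulT (vT 0) (addT (vT 1) (vT 2)))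
      (addT (mulT (vT 0) (vT 1)) (mulT (vT 0) (vT 2))) a b
      (fun x => rm a (ra b x) = ra (rm a b) (rm a x)) ?_ ?_ ?_ x
    · intro x; simp only [real_mulT, real_addT, real_vT]; rfl
    · simp only [a5, a3]
    · intro x hx; simp only [a6, a4, hx, adda]
  have rdist : ∀ a b x : M, rm (ra a b) x = ra (rm a x) (rm b x) := by
    intro a b x; rw [mulc, ldist, mulc x a, mulc x b]
  have mula : ∀ a b x : M, rm (rm a b) x = rm a (rm b x) := by
    intro a b x
    refine raw_ind_eq h (mulT (mulT (vT 0) (vT 1)) (vT 2)) (mulT (vT 0) (mulT (vT 1) (vT 2))) a b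
      (fun x => rm (rm a b) x = rm a (rm b x)) ?_ ?_ ?_ x
    · intro x; simp only [real_mulT, real_vT]; rfl
    · simp only [a5]
    · intro x hx; simp only [a6, hx, ldist]
  have mul1 : ∀ x : M, rm x (rs (rz M)) = x := by
    intro x; rw [a6, a5, zadd]
  have adds : ∀ x : M, ra x (rs (rz M)) = rs x := by
    intro x; rw [a4, a3]
  have canc : ∀ x y z : M, ra x z = ra y z → x = y := by
    intro x y z
    have := raw_ind h (k := 2) ((addT (vT 0) (vT 2) =' addT (vT 1) (vT 2)) ⟹ (vT 0 =' vT 1)) ![x, y]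
    have key : ∀ z, ((addT (vT 0) (vT 2) =' addT (vT 1) (vT 2)) ⟹ (vT 0 =' vT 1)).Realize
        (default : Empty → M) (Fin.snoc ![x, y] z : Fin 3 → M) ↔ (ra x z = ra y z → x = y) := by
      intro z
      simp only [BoundedFormula.realize_imp, BoundedFormula.realize_bdEqual, real_addT, real_vT]
      exact Iff.rfl
    simp only [key] at this
    refine this ?_ ?_ z
    · rw [a3, a3]; exact id
    · intro z hz h'
      rw [a4, a4] at h'
      exact hz (a2 _ _ h')
  have zs : ∀ x : M, x = rz M ∨ ∃ y, x = rs y := by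
    intro x
    have := raw_ind h (k := 0) ((vT 0 =' zeroT) ⊔ ∃' (vT 0 =' succT (vT 1))) ![]
    have key : ∀ x, ((vT 0 =' zeroT) ⊔ ∃' (vT 0 =' succT (vT 1))).Realize
        (default : Empty → M) (Fin.snoc ![] x : Fin 1 → M) ↔ (x = rz M ∨ ∃ y, x = rs y) := by
      intro x
      simp only [BoundedFormula.realize_sup, BoundedFormula.realize_ex,
        BoundedFormula.realize_bdEqual, real_zeroT, real_succT, real_vT]
      exact Iff.rfl
    simp only [key] at this
    exact this (by simp) (fun x _ => Or.inr ⟨x, rfl⟩) x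
  have posit : ∀ x y : M, ra x y = rz M → x = rz M := by
    intro x y hxy
    rcases zs x with h' | ⟨w, rfl⟩
    · exact h'
    · rw [sadd] at hxy; exact absurd hxy (a1 _)
  have tot : ∀ a b : M, rl a b ∨ rl b a := by
    intro a b
    have := raw_ind h (k := 1) (leF (vT 0) (vT 1) ⊔ leF (vT 1) (vT 0)) ![a]
    have key : ∀ x, (leF (vT 0) (vT 1) ⊔ leF (vT 1) (vT 0)).Realize
        (default : Empty → M) (Fin.snoc ![a] x : Fin 2 → M) ↔ (rl a x ∨ rl x a) := by
      intro x
      simp only [BoundedFormula.realize_sup, real_leF, real_vT]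
      exact Iff.rfl
    simp only [key] at this
    refine this (Or.inr ((a7 _ _).2 ⟨a, a3 a⟩)) ?_ b
    rintro x (hx | hx)
    · obtain ⟨z, hz⟩ := (a7 _ _).1 hx
      exact Or.inl ((a7 _ _).2 ⟨rs z, by rw [sadd, hz]⟩)
    · obtain ⟨z, hz⟩ := (a7 _ _).1 hx
      rcases zs z with h' | ⟨w, rfl⟩
      · subst h'
        rw [zadd] at hz
        subst hz
        exact Or.inl ((a7 _ _).2 ⟨rs (rz M), by rw [sadd, zadd]⟩)
      · exact Or.inr ((a7 _ _).2 ⟨w, by rw [a4, ← sadd, hz]⟩)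
  letI : Zero M := ⟨rz M⟩
  letI : One M := ⟨rs (rz M)⟩
  letI : Add M := ⟨ra⟩
  letI : Mul M := ⟨rm⟩
  letI cs : CommSemiring M :=
  { add_assoc := adda
    zero_add := zadd
    add_zero := a3
    add_comm := addc
    nsmul := nsmulRec
    left_distrib := ldist
    right_distrib := rdist
    zero_mul := zmul
    mul_zero := a5
    mul_assoc := mula
    one_mul := fun x => (mulc _ _).trans (mul1 x)
    mul_one := mul1
    mul_comm := mulc }
  letI lo : LinearOrder M :=
  { le := rl
    le_refl := fun x => (a7 _ _).2 ⟨rz M, zadd x⟩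
    le_trans := fun x y z hxy hyz => by
      obtain ⟨u, rfl⟩ := (a7 _ _).1 hxy
      obtain ⟨w, rfl⟩ := (a7 _ _).1 hyz
      exact (a7 _ _).2 ⟨ra w u, adda _ _ _⟩
    le_antisymm := fun x y hxy hyx => by
      obtain ⟨u, rfl⟩ := (a7 _ _).1 hxy
      obtain ⟨w, hw⟩ := (a7 _ _).1 hyx
      rw [← adda] at hw
      have h1 := canc _ _ x (hw.trans (zadd x).symm)
      rw [addc] at h1
      rw [posit _ _ h1, zadd]
    le_total := tot
    toDecidableLE := fun _ _ => Classical.dec _ }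
  exact
  { i, cs, lo with
    r_zero := rfl
    r_succ := fun x => (adds x).symm
    r_add := fun _ _ => rfl
    r_mul := fun _ _ => rfl
    r_le := fun _ _ => Iff.rfl
    le_iff := a7
    s_ne := fun x hx => a1 x ((adds x).symm.trans hx)
    zs := fun x => (zs x).imp id (fun ⟨y, hy⟩ => ⟨y, hy.trans (adds y).symm⟩)
    cancel := canc
    ind := fun φ v h0 hs => raw_ind h φ v h0 (fun x hx => by
      have := hs x hx
      rwa [show (x + 1 : M) = rs x from adds x] at this) }

end RawAlg

section Order
variable {M : Type} [PAM M]

theorem PAM.zl (x : M) : 0 ≤ x := (PAM.le_iff _ _).2 ⟨x, add_zero x⟩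

instance : IsCancelAdd M where
  add_left_cancel a b c h := PAM.cancel b c a (by rw [add_comm b, add_comm c]; exact h)
  add_right_cancel a b c h := PAM.cancel b c a h

instance : IsOrderedCancelAddMonoid M where
  add_le_add_left a b h c := by
    obtain ⟨z, rfl⟩ := (PAM.le_iff _ _).1 h
    exact (PAM.le_iff _ _).2 ⟨z, by ring⟩
  le_of_add_le_add_left a b c h := by
    obtain ⟨z, hz⟩ := (PAM.le_iff _ _).1 h
    exact (PAM.le_iff _ _).2 ⟨z, add_left_cancel (a := a) (by rw [← hz]; ring)⟩

instance : CanonicallyOrderedAdd M where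
  exists_add_of_le {a b} h := by
    obtain ⟨z, rfl⟩ := (PAM.le_iff _ _).1 h
    exact ⟨z, add_comm _ _⟩
  le_add_self a b := (PAM.le_iff _ _).2 ⟨b, rfl⟩
  le_self_add a b := (PAM.le_iff _ _).2 ⟨b, add_comm _ _⟩

theorem PAM.ne_zero_iff (x : M) : x ≠ 0 ↔ ∃ y, x = y + 1 := by
  constructor
  · intro h; exact (PAM.zs x).resolve_left h
  · rintro ⟨y, rfl⟩; exact PAM.s_ne y

instance : NoZeroDivisors M where
  eq_zero_or_eq_zero_of_mul_eq_zero {a b} h := by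
    by_contra hc
    push Not at hc
    obtain ⟨u, rfl⟩ := (PAM.ne_zero_iff a).1 hc.1
    obtain ⟨w, rfl⟩ := (PAM.ne_zero_iff b).1 hc.2
    refine PAM.s_ne (u * w + u + w) ?_
    rw [← h]; ring

instance : Nontrivial M := ⟨0, 1, fun h => PAM.s_ne (0 : M) (by rw [zero_add]; exact h.symm)⟩

instance : IsStrictOrderedRing M := by
  refine { (inferInstance : IsOrderedCancelAddMonoid M) with
    exists_pair_ne := exists_pair_ne M
    zero_le_one := PAM.zl _
    mul_lt_mul_of_pos_left := ?_
    mul_lt_mul_of_pos_right := ?_ }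
  · intro a ha b c h
    obtain ⟨z, rfl⟩ := exists_add_of_le h.le
    rw [mul_add]
    refine lt_add_of_pos_right _ (pos_iff_ne_zero.2 (mul_ne_zero ha.ne' ?_))
    rintro rfl; simp at h
  · intro a ha b c h
    obtain ⟨z, rfl⟩ := exists_add_of_le h.le
    rw [add_mul]
    refine lt_add_of_pos_right _ (pos_iff_ne_zero.2 (mul_ne_zero ?_ ha.ne'))
    rintro rfl; simp at h

theorem PAM.lt_iff (a b : M) : a < b ↔ a + 1 ≤ b := by
  constructor
  · intro h
    obtain ⟨z, rfl⟩ := exists_add_of_le h.le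
    have : z ≠ 0 := by rintro rfl; simp at h
    obtain ⟨w, rfl⟩ := (PAM.ne_zero_iff z).1 this
    rw [← add_assoc, add_right_comm]
    exact le_self_add
  · intro h
    exact lt_of_lt_of_le (lt_add_one a) h

theorem PAM.lt_succ (a b : M) : a < b + 1 ↔ a ≤ b := by
  rw [PAM.lt_iff]; exact add_le_add_iff_right 1

theorem PAM.le_succ (a b : M) : a ≤ b + 1 ↔ a ≤ b ∨ a = b + 1 := by
  rw [le_iff_lt_or_eq, PAM.lt_succ]

/-- A standard bound has only standard elements below. -/
theorem PAM.std (n : ℕ) (x : M) (h : x ≤ (n : M)) : ∃ k : ℕ, k ≤ n ∧ x = k := by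
  induction n with
  | zero => exact ⟨0, le_rfl, by simpa using h⟩
  | succ n ih =>
    rw [Nat.cast_succ, PAM.le_succ] at h
    rcases h with h | h
    · obtain ⟨k, hk, e⟩ := ih h
      exact ⟨k, by omega, e⟩
    · exact ⟨n + 1, le_rfl, by rw [h, Nat.cast_succ]⟩

end Order

/-- The standard structure on `ℕ`. -/
instance : LA.Structure ℕ where
  funMap := fun {n} f v => match n, f, v with
    | 0, _, _ => 0
    | 1, _, v => v 0 + 1
    | 2, b, v => if (show Bool from b) then v 0 * v 1 else v 0 + v 1
    | (_ + 3), f, _ => nomatch (show Empty from f)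
  RelMap := fun {n} r v => match n, r, v with
    | 0, r, _ => nomatch (show Empty from r)
    | 1, r, _ => nomatch (show Empty from r)
    | 2, _, v => v 0 ≤ v 1
    | (_ + 3), r, _ => nomatch (show Empty from r)

/-- The standard model. -/
instance : PAM ℕ where
  r_zero := rfl
  r_succ := fun _ => rfl
  r_add := fun _ _ => rfl
  r_mul := fun _ _ => rfl
  r_le := fun _ _ => Iff.rfl
  le_iff := fun x y => ⟨fun h => ⟨y - x, by omega⟩, fun ⟨z, h⟩ => by omega⟩
  s_ne := fun _ => by omega
  zs := fun x => by rcases x with _ | x; exact Or.inl rfl; exact Or.inr ⟨x, rfl⟩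
  cancel := fun _ _ _ h => by omega
  ind := fun φ v h0 hs x => Nat.rec h0 (fun x hx => hs x hx) x

set_option linter.unusedVariables false
set_option linter.unusedSectionVars false
section Defin
universe u
variable {ι : Type u} {M : ι → Type} [∀ i, PAM (M i)] {m : ℕ}

/-- Term-definable functions, uniformly over a family of models. -/
class Tm (f : ∀ i, (Fin m → M i) → M i) : Prop where
  ex : ∃ t : LA.Term (Empty ⊕ Fin m), ∀ i v, t.realize (Sum.elim default v) = f i v

/-- Relations defined by bounded formulas, uniformly over a family of models. -/
class D0 (R : ∀ i, (Fin m → M i) → Prop) : Prop where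
  ex : ∃ φ : LA.BoundedFormula Empty m, IsDelta0 φ ∧ ∀ i v, φ.Realize default v ↔ R i v

/-- Definable relations, uniformly over a family of models. -/
class Df (R : ∀ i, (Fin m → M i) → Prop) : Prop where
  ex : ∃ φ : LA.BoundedFormula Empty m, ∀ i v, φ.Realize default v ↔ R i v

instance Tm.var (j : Fin m) : Tm (fun i (v : Fin m → M i) => v j) := ⟨⟨vT j, fun _ _ => rfl⟩⟩
instance Tm.zero : Tm (fun i (_ : Fin m → M i) => (0 : M i)) :=
  ⟨⟨zeroT, fun i v => by rw [real_zeroT, PAM.r_zero]⟩⟩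
instance Tm.add (f g : ∀ i, (Fin m → M i) → M i) [hf : Tm f] [hg : Tm g] :
    Tm (fun i v => f i v + g i v) := by
  obtain ⟨t, ht⟩ := hf.ex
  obtain ⟨u, hu⟩ := hg.ex
  exact ⟨⟨addT t u, fun i v => by rw [real_addT, PAM.r_add, ht, hu]⟩⟩
instance Tm.mul (f g : ∀ i, (Fin m → M i) → M i) [hf : Tm f] [hg : Tm g] :
    Tm (fun i v => f i v * g i v) := by
  obtain ⟨t, ht⟩ := hf.ex
  obtain ⟨u, hu⟩ := hg.ex
  exact ⟨⟨mulT t u, fun i v => by rw [real_mulT, PAM.r_mul, ht, hu]⟩⟩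
instance Tm.one : Tm (fun i (_ : Fin m → M i) => (1 : M i)) :=
  ⟨⟨succT zeroT, fun i v => by rw [real_succT, real_zeroT, PAM.r_zero, PAM.r_succ, zero_add]⟩⟩
instance Tm.cast (n : ℕ) : Tm (fun i (_ : Fin m → M i) => (n : M i)) := by
  induction n with
  | zero => simpa using (Tm.zero : Tm (fun i (_ : Fin m → M i) => (0 : M i)))
  | succ n ih => simpa using Tm.add (fun i (_ : Fin m → M i) => (n : M i)) (fun i _ => 1)
instance Tm.ofNat (n : ℕ) [n.AtLeastTwo] :
    Tm (fun i (_ : Fin m → M i) => (OfNat.ofNat n : M i)) := by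
  have h : Tm (fun i (_ : Fin m → M i) => ((OfNat.ofNat n : ℕ) : M i)) := Tm.cast _
  simpa only [Nat.cast_ofNat] using h
instance Tm.nat (n : ℕ) : Tm (M := fun _ : Unit => ℕ) (fun _ (_ : Fin m → ℕ) => n) := by
  simpa using (Tm.cast n : Tm (M := fun _ : Unit => ℕ) (fun i (_ : Fin m → ℕ) => (n : ℕ)))

theorem real_term_sub {N : Type} [LA.Structure N] {a b : ℕ} (t : LA.Term (Empty ⊕ Fin a))
    (s : Fin a → LA.Term (Empty ⊕ Fin b)) (v : Fin b → N) :
    (t.subst (Sum.elim (fun e => e.elim) s)).realize (Sum.elim default v) =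
      t.realize (Sum.elim default (fun j => (s j).realize (Sum.elim default v))) := by
  rw [Term.realize_subst]
  congr 1
  funext x
  rcases x with x | x
  · exact x.elim
  · rfl

theorem Tm.sub {a : ℕ} (f : ∀ i, (Fin a → M i) → M i) (hf : Tm f)
    (g : Fin a → ∀ i, (Fin m → M i) → M i) (hg : ∀ j, Tm (g j)) :
    Tm (fun i v => f i (fun j => g j i v)) := by
  obtain ⟨t, ht⟩ := hf.ex
  choose s hs using fun j => (hg j).ex
  refine ⟨⟨t.subst (Sum.elim (fun e => e.elim) s), fun i v => ?_⟩⟩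
  rw [real_term_sub, ht]
  congr 1
  funext j
  exact hs j i v

/-- Existence of substitution instances of bounded formulas. -/
theorem D0_sub_fml {a : ℕ} (φ : LA.BoundedFormula Empty a) (h : IsDelta0 φ) :
    ∀ {b : ℕ} (s : Fin a → LA.Term (Empty ⊕ Fin b)), ∃ ψ : LA.BoundedFormula Empty b,
      IsDelta0 ψ ∧ ∀ (i : ι) (v : Fin b → M i), ψ.Realize default v ↔
        φ.Realize default (fun j => (s j).realize (Sum.elim default v)) := by
  induction h with
  | falsum => intro b s; exact ⟨⊥, IsDelta0.falsum, fun i v => Iff.rfl⟩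
  | equal t u =>
    intro b s
    refine ⟨_, IsDelta0.equal (t.subst (Sum.elim (fun e => e.elim) s))
      (u.subst (Sum.elim (fun e => e.elim) s)), fun i v => ?_⟩
    rw [BoundedFormula.realize_bdEqual, BoundedFormula.realize_bdEqual, real_term_sub,
      real_term_sub]
  | le t u =>
    intro b s
    refine ⟨_, IsDelta0.le (t.subst (Sum.elim (fun e => e.elim) s))
      (u.subst (Sum.elim (fun e => e.elim) s)), fun i v => ?_⟩
    rw [real_leF, real_leF, real_term_sub, real_term_sub]
  | imp _ _ h1 h2 =>
    intro b s
    obtain ⟨ψ1, d1, e1⟩ := h1 s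
    obtain ⟨ψ2, d2, e2⟩ := h2 s
    refine ⟨_, d1.imp d2, fun i v => ?_⟩
    rw [BoundedFormula.realize_imp, BoundedFormula.realize_imp, e1, e2]
  | @ball a t φ _ h1 =>
    intro b s
    obtain ⟨ψ, d, e⟩ := h1 (b := b + 1)
      (Fin.snoc (fun j => (s j).relabel (Sum.map id Fin.castSucc)) (vT (Fin.last b)))
    refine ⟨_, d.ball (t.subst (Sum.elim (fun e => e.elim) s)), fun i v => ?_⟩
    rw [BoundedFormula.realize_all, BoundedFormula.realize_all]
    refine forall_congr' fun x => ?_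
    rw [BoundedFormula.realize_imp, BoundedFormula.realize_imp, e, real_leF, real_leF,
      real_vT, real_vT, Term.realize_relabel, Term.realize_relabel, Sum.elim_comp_map,
      Sum.elim_comp_map, Function.comp_id, Fin.snoc_comp_castSucc, Fin.snoc_comp_castSucc,
      real_term_sub, Fin.snoc_last, Fin.snoc_last]
    have : (fun j => (Fin.snoc (α := fun _ => LA.Term (Empty ⊕ Fin (b + 1)))
        (fun j => (s j).relabel (Sum.map id Fin.castSucc)) (vT (Fin.last b)) j).realize
        (Sum.elim default (Fin.snoc v x : Fin (b + 1) → M i))) =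
        (Fin.snoc (fun j => (s j).realize (Sum.elim default v)) x : Fin (a + 1) → M i) := by
      funext j
      refine Fin.lastCases ?_ (fun j => ?_) j
      · simp [real_vT]
      · simp only [Fin.snoc_castSucc]
        rw [Term.realize_relabel, Sum.elim_comp_map, Function.comp_id, Fin.snoc_comp_castSucc]
    rw [this]
  | @bex a t φ _ h1 =>
    intro b s
    obtain ⟨ψ, d, e⟩ := h1 (b := b + 1)
      (Fin.snoc (fun j => (s j).relabel (Sum.map id Fin.castSucc)) (vT (Fin.last b)))
    refine ⟨_, d.bex (t.subst (Sum.elim (fun e => e.elim) s)), fun i v => ?_⟩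
    rw [BoundedFormula.realize_ex, BoundedFormula.realize_ex]
    refine exists_congr fun x => ?_
    rw [BoundedFormula.realize_inf, BoundedFormula.realize_inf, e, real_leF, real_leF,
      real_vT, real_vT, Term.realize_relabel, Term.realize_relabel, Sum.elim_comp_map,
      Sum.elim_comp_map, Function.comp_id, Fin.snoc_comp_castSucc, Fin.snoc_comp_castSucc,
      real_term_sub, Fin.snoc_last, Fin.snoc_last]
    have : (fun j => (Fin.snoc (α := fun _ => LA.Term (Empty ⊕ Fin (b + 1)))
        (fun j => (s j).relabel (Sum.map id Fin.castSucc)) (vT (Fin.last b)) j).realize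
        (Sum.elim default (Fin.snoc v x : Fin (b + 1) → M i))) =
        (Fin.snoc (fun j => (s j).realize (Sum.elim default v)) x : Fin (a + 1) → M i) := by
      funext j
      refine Fin.lastCases ?_ (fun j => ?_) j
      · simp [real_vT]
      · simp only [Fin.snoc_castSucc]
        rw [Term.realize_relabel, Sum.elim_comp_map, Function.comp_id, Fin.snoc_comp_castSucc]
    rw [this]

theorem D0.sub {a : ℕ} (R : ∀ i, (Fin a → M i) → Prop) (hR : D0 R)
    (g : Fin a → ∀ i, (Fin m → M i) → M i) (hg : ∀ j, Tm (g j)) :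
    D0 (fun i v => R i (fun j => g j i v)) := by
  obtain ⟨φ, d, e⟩ := hR.ex
  choose s hs using fun j => (hg j).ex
  obtain ⟨ψ, d', e'⟩ := D0_sub_fml (M := M) φ d s
  refine ⟨⟨ψ, d', fun i v => ?_⟩⟩
  rw [e', e]
  simp only [hs]

theorem D0.congr {R R' : ∀ i, (Fin m → M i) → Prop} (hR : D0 R) (h : ∀ i v, R' i v ↔ R i v) :
    D0 R' := by
  have : R' = R := by funext i v; exact propext (h i v)
  rwa [this]

instance D0.eq (f g : ∀ i, (Fin m → M i) → M i) [hf : Tm f] [hg : Tm g] :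
    D0 (fun i v => f i v = g i v) := by
  obtain ⟨t, ht⟩ := hf.ex
  obtain ⟨u, hu⟩ := hg.ex
  exact ⟨⟨_, IsDelta0.equal t u, fun i v => by rw [BoundedFormula.realize_bdEqual, ht, hu]⟩⟩
instance D0.le (f g : ∀ i, (Fin m → M i) → M i) [hf : Tm f] [hg : Tm g] :
    D0 (fun i v => f i v ≤ g i v) := by
  obtain ⟨t, ht⟩ := hf.ex
  obtain ⟨u, hu⟩ := hg.ex
  exact ⟨⟨_, IsDelta0.le t u, fun i v => by rw [real_leF, ht, hu, PAM.r_le]⟩⟩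
instance D0.lt (f g : ∀ i, (Fin m → M i) → M i) [hf : Tm f] [hg : Tm g] :
    D0 (fun i v => f i v < g i v) :=
  (D0.le (fun i v => f i v + 1) g).congr (fun i v => PAM.lt_iff _ _)
instance D0.imp (A B : ∀ i, (Fin m → M i) → Prop) [hA : D0 A] [hB : D0 B] :
    D0 (fun i v => A i v → B i v) := by
  obtain ⟨φ, d, e⟩ := hA.ex
  obtain ⟨ψ, d', e'⟩ := hB.ex
  exact ⟨⟨_, d.imp d', fun i v => by rw [BoundedFormula.realize_imp, e, e']⟩⟩
instance D0.fls : D0 (fun i (_ : Fin m → M i) => False) :=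
  ⟨⟨_, IsDelta0.falsum, fun _ _ => Iff.rfl⟩⟩
instance D0.tru : D0 (fun i (_ : Fin m → M i) => True) :=
  (D0.imp (fun i (_ : Fin m → M i) => False) (fun _ _ => False)).congr (fun i v => by simp)
instance D0.not (A : ∀ i, (Fin m → M i) → Prop) [hA : D0 A] : D0 (fun i v => ¬ A i v) :=
  D0.imp A (fun _ _ => False)
instance D0.ne (f g : ∀ i, (Fin m → M i) → M i) [hf : Tm f] [hg : Tm g] :
    D0 (fun i v => f i v ≠ g i v) := D0.not _
instance D0.or (A B : ∀ i, (Fin m → M i) → Prop) [hA : D0 A] [hB : D0 B] :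
    D0 (fun i v => A i v ∨ B i v) :=
  (D0.imp (fun i v => ¬ A i v) B).congr (fun i v => by tauto)
instance D0.and (A B : ∀ i, (Fin m → M i) → Prop) [hA : D0 A] [hB : D0 B] :
    D0 (fun i v => A i v ∧ B i v) :=
  (D0.not (fun i v => A i v → ¬ B i v)).congr (fun i v => by tauto)
instance D0.iff (A B : ∀ i, (Fin m → M i) → Prop) [hA : D0 A] [hB : D0 B] :
    D0 (fun i v => A i v ↔ B i v) :=
  (D0.and (fun i v => A i v → B i v) (fun i v => B i v → A i v)).congr (fun i v => by tauto)
instance D0.ball (f : ∀ i, (Fin m → M i) → M i) (R : ∀ i, (Fin m → M i) → M i → Prop) [hf : Tm f]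
    [hR : D0 (fun i (w : Fin (m + 1) → M i) => R i (fun j => w (Fin.castSucc j)) (w (Fin.last m)))] :
    D0 (fun i v => ∀ x, x ≤ f i v → R i v x) := by
  obtain ⟨t, ht⟩ := hf.ex
  obtain ⟨φ, d, e⟩ := hR.ex
  refine ⟨⟨_, d.ball t, fun i v => ?_⟩⟩
  rw [BoundedFormula.realize_all]
  refine forall_congr' fun x => ?_
  rw [BoundedFormula.realize_imp, real_leF, e, real_vT, Term.realize_relabel, Sum.elim_comp_map,
    Function.comp_id, Fin.snoc_comp_castSucc, Fin.snoc_last, ht, PAM.r_le]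
  simp only [Fin.snoc_castSucc]
instance D0.ballt (f : ∀ i, (Fin m → M i) → M i) (R : ∀ i, (Fin m → M i) → M i → Prop) [hf : Tm f]
    [hR : D0 (fun i (w : Fin (m + 1) → M i) => R i (fun j => w (Fin.castSucc j)) (w (Fin.last m)))] :
    D0 (fun i v => ∀ x, x < f i v → R i v x) := by
  have h1 : Tm (fun i (w : Fin (m + 1) → M i) => f i (fun j => w (Fin.castSucc j))) :=
    Tm.sub f hf (fun j i w => w (Fin.castSucc j)) (fun j => inferInstance)
  have h2 : D0 (fun i (w : Fin (m + 1) → M i) => w (Fin.last m) < f i (fun j => w (Fin.castSucc j)) →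
    R i (fun j => w (Fin.castSucc j)) (w (Fin.last m))) := inferInstance
  refine (D0.ball f (fun i v x => x < f i v → R i v x)).congr (fun i v => forall_congr' fun x => ?_)
  constructor
  · intro h _; exact h
  · intro h h'; exact h h'.le h'
instance D0.bex (f : ∀ i, (Fin m → M i) → M i) (R : ∀ i, (Fin m → M i) → M i → Prop) [hf : Tm f]
    [hR : D0 (fun i (w : Fin (m + 1) → M i) => R i (fun j => w (Fin.castSucc j)) (w (Fin.last m)))] :
    D0 (fun i v => ∃ x, x ≤ f i v ∧ R i v x) := by
  have := D0.ball f (fun i v x => ¬ R i v x)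
  refine (D0.not (fun i v => ∀ x, x ≤ f i v → ¬ R i v x)).congr (fun i v => ?_)
  push Not; rfl
instance D0.bext (f : ∀ i, (Fin m → M i) → M i) (R : ∀ i, (Fin m → M i) → M i → Prop) [hf : Tm f]
    [hR : D0 (fun i (w : Fin (m + 1) → M i) => R i (fun j => w (Fin.castSucc j)) (w (Fin.last m)))] :
    D0 (fun i v => ∃ x, x < f i v ∧ R i v x) := by
  have := D0.ballt f (fun i v x => ¬ R i v x)
  refine (D0.not (fun i v => ∀ x, x < f i v → ¬ R i v x)).congr (fun i v => ?_)
  push Not; rfl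

end Defin

section DfSec
universe u
variable {ι : Type u} {M : ι → Type} [∀ i, PAM (M i)] {m : ℕ}

theorem Df.congr {R R' : ∀ i, (Fin m → M i) → Prop} (hR : Df R) (h : ∀ i v, R' i v ↔ R i v) :
    Df R' := by
  have : R' = R := by funext i v; exact propext (h i v)
  rwa [this]

instance (priority := 10) Df.ofD0 (R : ∀ i, (Fin m → M i) → Prop) [hR : D0 R] : Df R := by
  obtain ⟨φ, d, e⟩ := hR.ex
  exact ⟨⟨φ, e⟩⟩

instance Df.imp (A B : ∀ i, (Fin m → M i) → Prop) [hA : Df A] [hB : Df B] :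
    Df (fun i v => A i v → B i v) := by
  obtain ⟨φ, e⟩ := hA.ex
  obtain ⟨ψ, e'⟩ := hB.ex
  exact ⟨⟨φ ⟹ ψ, fun i v => by rw [BoundedFormula.realize_imp, e, e']⟩⟩
instance Df.not (A : ∀ i, (Fin m → M i) → Prop) [hA : Df A] : Df (fun i v => ¬ A i v) :=
  Df.imp A (fun _ _ => False)
instance Df.or (A B : ∀ i, (Fin m → M i) → Prop) [hA : Df A] [hB : Df B] :
    Df (fun i v => A i v ∨ B i v) :=
  (Df.imp (fun i v => ¬ A i v) B).congr (fun i v => by tauto)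
instance Df.and (A B : ∀ i, (Fin m → M i) → Prop) [hA : Df A] [hB : Df B] :
    Df (fun i v => A i v ∧ B i v) :=
  (Df.not (fun i v => A i v → ¬ B i v)).congr (fun i v => by tauto)
instance Df.iff (A B : ∀ i, (Fin m → M i) → Prop) [hA : Df A] [hB : Df B] :
    Df (fun i v => A i v ↔ B i v) :=
  (Df.and (fun i v => A i v → B i v) (fun i v => B i v → A i v)).congr (fun i v => by tauto)
instance Df.all (R : ∀ i, (Fin m → M i) → M i → Prop)
    [hR : Df (fun i (w : Fin (m + 1) → M i) => R i (fun j => w (Fin.castSucc j)) (w (Fin.last m)))] :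
    Df (fun i v => ∀ x, R i v x) := by
  obtain ⟨φ, e⟩ := hR.ex
  refine ⟨⟨φ.all, fun i v => ?_⟩⟩
  rw [BoundedFormula.realize_all]
  refine forall_congr' fun x => ?_
  rw [e]
  simp only [Fin.snoc_castSucc, Fin.snoc_last]
instance Df.exi (R : ∀ i, (Fin m → M i) → M i → Prop)
    [hR : Df (fun i (w : Fin (m + 1) → M i) => R i (fun j => w (Fin.castSucc j)) (w (Fin.last m)))] :
    Df (fun i v => ∃ x, R i v x) := by
  refine (Df.not (fun i v => ∀ x, ¬ R i v x)).congr (fun i v => ?_)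
  push Not; rfl

theorem Df.sub {a : ℕ} (R : ∀ i, (Fin a → M i) → Prop) (hR : Df R)
    (g : Fin a → ∀ i, (Fin m → M i) → M i) (hg : ∀ j, Tm (g j)) :
    Df (fun i v => R i (fun j => g j i v)) := by
  obtain ⟨φ, e⟩ := hR.ex
  choose s hs using fun j => (hg j).ex
  refine ⟨⟨(φ.toFormula.subst (fun x => Sum.elim (fun e => e.elim) s x)).relabel
    (n := m) (k := 0) (fun x => x), fun i v => ?_⟩⟩
  rw [BoundedFormula.realize_relabel]
  have h1 : (Formula.Realize (φ.toFormula.subst (fun x => Sum.elim (fun e => e.elim) s x))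
    (Sum.elim default v)) ↔ R i (fun j => g j i v) := by
    rw [Formula.Realize, BoundedFormula.realize_subst]
    have h2 := BoundedFormula.realize_toFormula (M := M i) φ
      (fun x => Term.realize (Sum.elim default v) (Sum.elim (fun e => e.elim) s x))
    rw [Formula.Realize] at h2
    rw [h2, ← e]
    have : ((fun x => Term.realize (Sum.elim default v) (Sum.elim (fun e => Empty.elim e) s x)) ∘ Sum.inr :
      Fin a → M i) = fun j => g j i v := by
      funext j
      simp [hs]
    exact iff_of_eq (congrArg₂ _ (Subsingleton.elim _ _) this)
  rw [← h1, Formula.Realize]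
  have h4 : (Sum.elim (default : Empty → M i) ((v ∘ Fin.castAdd 0 : Fin m → M i)) ∘ fun x => x)
    = Sum.elim default v := by
    funext x; rcases x with x | x
    · exact x.elim
    · rfl
  rw [h4]
  exact iff_of_eq (congrArg₂ _ rfl (Subsingleton.elim _ _))

/-- Definable induction. -/
theorem dind (R : ∀ i, (Fin m → M i) → M i → Prop)
    [hR : Df (fun i (w : Fin (m + 1) → M i) => R i (fun j => w (Fin.castSucc j)) (w (Fin.last m)))]
    {i : ι} (v : Fin m → M i) (h0 : R i v 0) (hs : ∀ x, R i v x → R i v (x + 1)) (x : M i) :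
    R i v x := by
  obtain ⟨φ, e⟩ := hR.ex
  have key : ∀ x, φ.Realize default (Fin.snoc v x) ↔ R i v x := by
    intro x; rw [e]; simp only [Fin.snoc_castSucc, Fin.snoc_last]
  rw [← key]
  refine PAM.ind φ v ((key 0).2 h0) (fun x hx => (key _).2 (hs x ((key x).1 hx))) x

/-- Definable collection. -/
theorem dcoll (R : ∀ i, (Fin m → M i) → M i → M i → Prop)
    [hR : Df (fun i (w : Fin (m + 2) → M i) => R i (fun j => w (Fin.castSucc (Fin.castSucc j)))
      (w (Fin.castSucc (Fin.last m))) (w (Fin.last (m + 1))))]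
    {i : ι} (v : Fin m → M i) (b : M i) (h : ∀ y, y ≤ b → ∃ x, R i v y x) :
    ∃ z, ∀ y, y ≤ b → ∃ x, x ≤ z ∧ R i v y x := by
  have hR' : Df (fun i (w : Fin (m + 1 + 1 + 1 + 1) → M i) =>
      R i (fun j => w (Fin.castSucc (Fin.castSucc (Fin.castSucc (Fin.castSucc j)))))
      (w (Fin.castSucc (Fin.last (m + 2)))) (w (Fin.last (m + 3)))) := by
    refine (Df.sub (m := m + 4) _ hR (fun j i w => (Fin.snoc (Fin.snoc (fun j => w (Fin.castSucc (Fin.castSucc (Fin.castSucc (Fin.castSucc j)))))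
      (w (Fin.castSucc (Fin.last (m + 2)))) : Fin (m + 1) → M i) (w (Fin.last (m + 3))) : Fin (m + 2) → M i) j)
      (fun j => ?_)).congr (fun i v => ?_)
    · refine Fin.lastCases ?_ (fun j => ?_) j
      · simp only [Fin.snoc_last]; infer_instance
      · simp only [Fin.snoc_castSucc]
        refine Fin.lastCases ?_ (fun j => ?_) j
        · simp only [Fin.snoc_last]; infer_instance
        · simp only [Fin.snoc_castSucc]; infer_instance
    · simp only [Fin.snoc_castSucc, Fin.snoc_last]
  have hR'' : Df (fun i (w : Fin (m + 1 + 1 + 1) → M i) =>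
      R i (fun j => w (Fin.castSucc (Fin.castSucc (Fin.castSucc j))))
      (w (Fin.castSucc (Fin.last (m + 1)))) (w (Fin.last (m + 2)))) := by
    refine (Df.sub (m := m + 3) _ hR (fun j i w => (Fin.snoc (Fin.snoc (fun j => w ((Fin.castSucc (Fin.castSucc (Fin.castSucc j)))))
      (w (Fin.castSucc (Fin.last (m + 1)))) : Fin (m + 1) → M i) (w (Fin.last (m + 2))) : Fin (m + 2) → M i) j)
      (fun j => ?_)).congr (fun i v => ?_)
    · refine Fin.lastCases ?_ (fun j => ?_) j
      · simp only [Fin.snoc_last]; infer_instance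
      · simp only [Fin.snoc_castSucc]
        refine Fin.lastCases ?_ (fun j => ?_) j
        · simp only [Fin.snoc_last]; infer_instance
        · simp only [Fin.snoc_castSucc]; infer_instance
    · simp only [Fin.snoc_castSucc, Fin.snoc_last]
  refine dind (fun i v b => (∀ y, y ≤ b → ∃ x, R i v y x) → ∃ z, ∀ y, y ≤ b → ∃ x, x ≤ z ∧ R i v y x)
    v ?_ ?_ b h
  · intro h
    obtain ⟨x, hx⟩ := h 0 le_rfl
    refine ⟨x, fun y hy => ⟨x, le_rfl, ?_⟩⟩
    rwa [le_antisymm hy (PAM.zl y)]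
  · intro b ih h
    obtain ⟨z, hz⟩ := ih (fun y hy => h y (hy.trans le_self_add))
    obtain ⟨x, hx⟩ := h (b + 1) le_rfl
    refine ⟨z + x, fun y hy => ?_⟩
    rcases (PAM.le_succ _ _).1 hy with hy | rfl
    · obtain ⟨x', h1, h2⟩ := hz y hy
      exact ⟨x', h1.trans le_self_add, h2⟩
    · exact ⟨x, le_add_self, hx⟩

/-- Definable least number principle. -/
theorem dleast (R : ∀ i, (Fin m → M i) → M i → Prop)
    [hR : Df (fun i (w : Fin (m + 1) → M i) => R i (fun j => w (Fin.castSucc j)) (w (Fin.last m)))]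
    {i : ι} (v : Fin m → M i) (h : ∃ x, R i v x) :
    ∃ x, R i v x ∧ ∀ y, y < x → ¬ R i v y := by
  by_contra hc
  push Not at hc
  have hR' : Df (fun i (w : Fin (m + 1 + 1) → M i) =>
      R i (fun j => w (Fin.castSucc (Fin.castSucc j))) (w (Fin.last (m + 1)))) := by
    refine (Df.sub (m := m + 2) _ hR (fun j i w => (Fin.snoc (fun j => w (Fin.castSucc (Fin.castSucc j)))
      (w (Fin.last (m + 1))) : Fin (m + 1) → M i) j) (fun j => ?_)).congr (fun i v => ?_)
    · refine Fin.lastCases ?_ (fun j => ?_) j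
      · simp only [Fin.snoc_last]; infer_instance
      · simp only [Fin.snoc_castSucc]; infer_instance
    · simp only [Fin.snoc_castSucc, Fin.snoc_last]
  have := dind (fun i v b => ∀ y, y < b → ¬ R i v y) v (fun y hy => absurd hy (not_lt.2 (PAM.zl y)))
    (fun x ih y hy hy' => by
      obtain ⟨z, h1, h2⟩ := hc y hy'
      exact ih z (lt_of_lt_of_le h1 ((PAM.lt_succ _ _).1 hy)) h2)
  obtain ⟨x, hx⟩ := h
  exact this (x + 1) x (lt_add_one x) hx

end DfSec

section SgSec
universe u
variable {ι : Type u} {M : ι → Type} [∀ i, PAM (M i)] {m : ℕ}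

/-- Semantic `Σ_k` relations. -/
def SgP : ∀ (_ : ℕ) {m : ℕ} (_ : ∀ i, (Fin m → M i) → Prop), Prop
  | 0, _, R => D0 R
  | k + 1, m, R => ∃ S : ∀ i, (Fin (m + 1) → M i) → Prop, SgP k S ∧
      ∀ i v, R i v ↔ ∃ x, ¬ S i (Fin.snoc v x)

theorem SgP.congr {k : ℕ} {R R' : ∀ i, (Fin m → M i) → Prop} (hR : SgP k R)
    (h : ∀ i v, R' i v ↔ R i v) : SgP k R' := by
  have : R' = R := by funext i v; exact propext (h i v)
  rwa [this]

theorem Tm.snoc {a : ℕ} (g : Fin a → ∀ i, (Fin m → M i) → M i) (f : ∀ i, (Fin m → M i) → M i)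
    (hg : ∀ j, Tm (g j)) (hf : Tm f) (j : Fin (a + 1)) :
    Tm (fun i v => (Fin.snoc (fun j => g j i v) (f i v) : Fin (a + 1) → M i) j) := by
  refine Fin.lastCases ?_ (fun j => ?_) j
  · simp only [Fin.snoc_last]; exact hf
  · simp only [Fin.snoc_castSucc]; exact hg j

theorem SgP.sub {k : ℕ} : ∀ {a m : ℕ} (R : ∀ i, (Fin a → M i) → Prop) (hR : SgP k R)
    (g : Fin a → ∀ i, (Fin m → M i) → M i) (hg : ∀ j, Tm (g j)),
    SgP k (fun i v => R i (fun j => g j i v)) := by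
  induction k with
  | zero => intro a m R hR g hg; exact D0.sub R hR g hg
  | succ k ih =>
    intro a m R ⟨S, hS, h⟩ g hg
    have hg' : ∀ j, Tm (fun i (w : Fin (m + 1) → M i) => g j i (fun j => w (Fin.castSucc j))) :=
      fun j => Tm.sub (g j) (hg j) (fun j i w => w (Fin.castSucc j)) (fun j => inferInstance)
    refine ⟨_, ih S hS _ (Tm.snoc _ (fun i (w : Fin (m + 1) → M i) => w (Fin.last m)) hg'
      inferInstance), fun i v => ?_⟩
    beta_reduce
    rw [h]
    simp only [Fin.snoc_last, Fin.snoc_castSucc]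

theorem SgP.wk {k m : ℕ} {R : ∀ i, (Fin m → M i) → Prop} (hR : SgP k R) :
    SgP k (fun i (w : Fin (m + 1) → M i) => R i (fun j => w (Fin.castSucc j))) :=
  SgP.sub R hR (fun j i w => w (Fin.castSucc j)) (fun j => inferInstance)

theorem Tm.wk {m : ℕ} {f : ∀ i, (Fin m → M i) → M i} (hf : Tm f) :
    Tm (fun i (w : Fin (m + 1) → M i) => f i (fun j => w (Fin.castSucc j))) :=
  Tm.sub f hf (fun j i w => w (Fin.castSucc j)) (fun j => inferInstance)

theorem SgP.not_up {k m : ℕ} {R : ∀ i, (Fin m → M i) → Prop} (hR : SgP k R) :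
    SgP (k + 1) (fun i v => ¬ R i v) := by
  refine ⟨_, hR.wk, fun i v => ?_⟩
  simp only [Fin.snoc_castSucc]
  exact ⟨fun h => ⟨0, h⟩, fun ⟨_, h⟩ => h⟩

theorem SgP.up {k : ℕ} : ∀ {m : ℕ} {R : ∀ i, (Fin m → M i) → Prop} (hR : SgP k R),
    SgP (k + 1) R := by
  induction k with
  | zero =>
    intro m R hR
    have : D0 R := hR
    have h1 : SgP 0 (fun i v => ¬ R i v) := D0.not R
    exact h1.not_up.congr (fun i v => by simp)
  | succ k ih =>
    intro m R ⟨S, hS, h⟩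
    exact ⟨S, ih hS, h⟩

theorem SgP.df {k : ℕ} : ∀ {m : ℕ} {R : ∀ i, (Fin m → M i) → Prop} (hR : SgP k R), Df R := by
  induction k with
  | zero => intro m R hR; have : D0 R := hR; infer_instance
  | succ k ih =>
    intro m R ⟨S, hS, h⟩
    have h1 := ih hS
    have h2 : Df (fun i (w : Fin (m + 1) → M i) => S i (Fin.snoc (fun j => w (Fin.castSucc j))
      (w (Fin.last m)) : Fin (m + 1) → M i)) := by
      refine h1.congr (fun i v => ?_)
      have : (Fin.snoc (fun j => v (Fin.castSucc j)) (v (Fin.last m)) : Fin (m + 1) → M i) = v :=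
        Fin.snoc_init_self v
      rw [this]
    have h3 : Df (fun i v => ∃ x, ¬ S i (Fin.snoc v x)) := inferInstance
    exact h3.congr h

theorem SgP.fml {k : ℕ} : ∀ {m : ℕ} {R : ∀ i, (Fin m → M i) → Prop} (hR : SgP k R),
    (∃ φ : LA.BoundedFormula Empty m, IsSigmaFml k φ ∧ ∀ i v, φ.Realize default v ↔ R i v) ∧
    (∃ φ : LA.BoundedFormula Empty m, IsPiFml k φ ∧ ∀ i v, φ.Realize default v ↔ ¬ R i v) := by
  induction k with
  | zero =>
    intro m R hR
    have : D0 R := hR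
    obtain ⟨φ, d, e⟩ := this.ex
    obtain ⟨φ', d', e'⟩ := (D0.not R).ex
    exact ⟨⟨φ, .ofDelta0 d, e⟩, ⟨φ', .ofDelta0 d', e'⟩⟩
  | succ k ih =>
    intro m R ⟨S, hS, h⟩
    obtain ⟨⟨φ, d, e⟩, ⟨φ', d', e'⟩⟩ := ih hS
    refine ⟨⟨φ'.ex, .ex (.ofPi d'), fun i v => ?_⟩, ⟨φ.all, .all (.ofSigma d), fun i v => ?_⟩⟩
    · rw [BoundedFormula.realize_ex, h]; simp only [e']
    · rw [BoundedFormula.realize_all, h]; simp only [e]; push Not; rfl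

/-- Boolean and bounded-quantifier closure at level `k`. -/
structure Cl (M : ι → Type) [∀ i, PAM (M i)] (k : ℕ) : Prop where
  and : ∀ {m : ℕ} {A B : ∀ i, (Fin m → M i) → Prop}, SgP k A → SgP k B → SgP k (fun i v => A i v ∧ B i v)
  or : ∀ {m : ℕ} {A B : ∀ i, (Fin m → M i) → Prop}, SgP k A → SgP k B → SgP k (fun i v => A i v ∨ B i v)
  ball : ∀ {m : ℕ} (f : ∀ i, (Fin m → M i) → M i) (R : ∀ i, (Fin m → M i) → M i → Prop), Tm f →
    SgP k (fun i (w : Fin (m + 1) → M i) => R i (fun j => w (Fin.castSucc j)) (w (Fin.last m))) →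
    SgP k (fun i v => ∀ x, x ≤ f i v → R i v x)
  bex : ∀ {m : ℕ} (f : ∀ i, (Fin m → M i) → M i) (R : ∀ i, (Fin m → M i) → M i → Prop), Tm f →
    SgP k (fun i (w : Fin (m + 1) → M i) => R i (fun j => w (Fin.castSucc j)) (w (Fin.last m))) →
    SgP k (fun i v => ∃ x, x ≤ f i v ∧ R i v x)

/-- The relation `S(v, x)` seen in the context `(v, z, x)`. -/
theorem SgP.skip1 {k m : ℕ} {S : ∀ i, (Fin (m + 1) → M i) → Prop} (hS : SgP k S) :
    SgP k (fun i (w : Fin (m + 1 + 1) → M i) =>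
      S i (Fin.snoc (fun j => w (Fin.castSucc (Fin.castSucc j))) (w (Fin.last _)))) :=
  SgP.sub S hS _ (Tm.snoc (fun j i w => w (Fin.castSucc (Fin.castSucc j)))
    (fun i (w : Fin (m + 1 + 1) → M i) => w (Fin.last _)) (fun j => inferInstance) inferInstance)

/-- The relation `S(v, y, x)` seen in the context `(v, z, y, x)`. -/
theorem SgP.skip2 {k m : ℕ} {S : ∀ i, (Fin (m + 1 + 1) → M i) → Prop} (hS : SgP k S) :
    SgP k (fun i (w : Fin (m + 1 + 1 + 1) → M i) =>
      S i (Fin.snoc (Fin.snoc (fun j => w (Fin.castSucc (Fin.castSucc (Fin.castSucc j))))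
        (w (Fin.castSucc (Fin.last _))) : Fin (m + 1) → M i) (w (Fin.last _)))) :=
  SgP.sub S hS _ (Tm.snoc _
    (fun i (w : Fin (m + 1 + 1 + 1) → M i) => w (Fin.last _))
    (Tm.snoc (fun j i w => w (Fin.castSucc (Fin.castSucc (Fin.castSucc j))))
    (fun i (w : Fin (m + 1 + 1 + 1) → M i) => w (Fin.castSucc (Fin.last _)))
    (fun j => inferInstance) inferInstance) inferInstance)

theorem snoc_eta {N : Type} {m : ℕ} (v : Fin (m + 1) → N) :
    (Fin.snoc (fun j => v (Fin.castSucc j)) (v (Fin.last m)) : Fin (m + 1) → N) = v :=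
  Fin.snoc_init_self v

theorem cl_all (k : ℕ) : Cl M k := by
  induction k with
  | zero =>
    refine ⟨?_, ?_, ?_, ?_⟩
    · intro m A B hA hB
      have : D0 A := hA
      have : D0 B := hB
      exact D0.and A B
    · intro m A B hA hB
      have : D0 A := hA
      have : D0 B := hB
      exact D0.or A B
    · intro m f R hf hR
      have : D0 _ := hR
      exact D0.ball f R
    · intro m f R hf hR
      have : D0 _ := hR
      exact D0.bex f R
  | succ k ih =>
    refine ⟨?_, ?_, ?_, ?_⟩
    · rintro m A B ⟨S, hS, h⟩ ⟨S', hS', h'⟩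
      have h1 : SgP k (fun i (w : Fin (m + 1) → M i) => ∀ x, x ≤ w (Fin.last m) →
          S i (Fin.snoc (fun j => w (Fin.castSucc j)) x)) :=
        ih.ball (fun i w => w (Fin.last m)) (fun i w x => S i (Fin.snoc (fun j => w (Fin.castSucc j)) x))
        inferInstance hS.skip1
      have h2 : SgP k (fun i (w : Fin (m + 1) → M i) => ∀ x, x ≤ w (Fin.last m) →
          S' i (Fin.snoc (fun j => w (Fin.castSucc j)) x)) :=
        ih.ball (fun i w => w (Fin.last m)) (fun i w x => S' i (Fin.snoc (fun j => w (Fin.castSucc j)) x))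
        inferInstance hS'.skip1
      refine ⟨_, ih.or h1 h2, fun i v => ?_⟩
      beta_reduce
      rw [h, h']
      simp only [Fin.snoc_last, Fin.snoc_castSucc]
      push Not
      constructor
      · rintro ⟨⟨x, hx⟩, ⟨y, hy⟩⟩
        exact ⟨x + y, ⟨x, le_self_add, hx⟩, ⟨y, le_add_self, hy⟩⟩
      · rintro ⟨z, ⟨x, _, hx⟩, ⟨y, _, hy⟩⟩
        exact ⟨⟨x, hx⟩, ⟨y, hy⟩⟩
    · rintro m A B ⟨S, hS, h⟩ ⟨S', hS', h'⟩
      refine ⟨_, ih.and hS hS', fun i v => ?_⟩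
      beta_reduce
      rw [h, h', ← exists_or]
      simp only [not_and_or]
    · rintro m f R hf ⟨S, hS, h⟩
      have h1 : SgP k (fun i (w : Fin (m + 1 + 1) → M i) => ∀ x, x ≤ w (Fin.castSucc (Fin.last m)) →
          S i (Fin.snoc (Fin.snoc (fun j => w (Fin.castSucc (Fin.castSucc j))) (w (Fin.last _)) : Fin (m + 1) → M i) x)) :=
        ih.ball (fun i w => w (Fin.castSucc (Fin.last m))) (fun i w x =>
          S i (Fin.snoc (Fin.snoc (fun j => w (Fin.castSucc (Fin.castSucc j))) (w (Fin.last _)) : Fin (m + 1) → M i) x))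
        inferInstance hS.skip2
      have h2 := ih.bex (fun i (w : Fin (m + 1) → M i) => f i (fun j => w (Fin.castSucc j))) (fun i w y =>
        ∀ x, x ≤ w (Fin.last m) → S i (Fin.snoc (Fin.snoc (fun j => w (Fin.castSucc j)) y : Fin (m + 1) → M i) x))
        hf.wk h1
      refine ⟨_, h2, fun i v => ?_⟩
      have h3 : ∀ x, R i v x ↔ ∃ y, ¬ S i (Fin.snoc (Fin.snoc v x : Fin (m + 1) → M i) y) := by
        intro x
        have := h i (Fin.snoc v x)
        simp only [Fin.snoc_last, Fin.snoc_castSucc] at this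
        exact this
      simp only [Fin.snoc_last, Fin.snoc_castSucc, h3]
      push Not
      constructor
      · intro h4
        have : Df (fun i (w : Fin (m + 2) → M i) => ¬ S i
          (Fin.snoc (Fin.snoc (fun j => w (Fin.castSucc (Fin.castSucc j))) (w (Fin.castSucc (Fin.last m))) : Fin (m + 1) → M i)
            (w (Fin.last _)))) := by
          have := hS.df
          refine (Df.not S).congr fun i v => ?_
          have e := snoc_eta (fun j => v (Fin.castSucc j))
          rw [e, snoc_eta]
        exact dcoll (fun i v y x => ¬ S i (Fin.snoc (Fin.snoc v y : Fin (m + 1) → M i) x)) v (f i v) h4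
      · rintro ⟨z, hz⟩ x hx
        obtain ⟨y, _, hy⟩ := hz x hx
        exact ⟨y, hy⟩
    · rintro m f R hf ⟨S, hS, h⟩
      have h1 : SgP k (fun i (w : Fin (m + 1 + 1) → M i) => ∀ x, x ≤ w (Fin.castSucc (Fin.last m)) →
          S i (Fin.snoc (Fin.snoc (fun j => w (Fin.castSucc (Fin.castSucc j))) (w (Fin.last _)) : Fin (m + 1) → M i) x)) :=
        ih.ball (fun i w => w (Fin.castSucc (Fin.last m))) (fun i w x =>
          S i (Fin.snoc (Fin.snoc (fun j => w (Fin.castSucc (Fin.castSucc j))) (w (Fin.last _)) : Fin (m + 1) → M i) x))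
        inferInstance hS.skip2
      have h2 := ih.ball (fun i (w : Fin (m + 1) → M i) => f i (fun j => w (Fin.castSucc j))) (fun i w y =>
        ∀ x, x ≤ w (Fin.last m) → S i (Fin.snoc (Fin.snoc (fun j => w (Fin.castSucc j)) y : Fin (m + 1) → M i) x))
        hf.wk h1
      refine ⟨_, h2, fun i v => ?_⟩
      have h3 : ∀ x, R i v x ↔ ∃ y, ¬ S i (Fin.snoc (Fin.snoc v x : Fin (m + 1) → M i) y) := by
        intro x
        have := h i (Fin.snoc v x)
        simp only [Fin.snoc_last, Fin.snoc_castSucc] at this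
        exact this
      simp only [Fin.snoc_last, Fin.snoc_castSucc, h3]
      push Not
      constructor
      · rintro ⟨x, hx, y, hy⟩
        exact ⟨y, x, hx, y, le_rfl, hy⟩
      · rintro ⟨z, x, hx, y, _, hy⟩
        exact ⟨x, hx, y, hy⟩

theorem SgP.exi {k m : ℕ} (R : ∀ i, (Fin m → M i) → M i → Prop)
    (hR : SgP (k + 1) (fun i (w : Fin (m + 1) → M i) => R i (fun j => w (Fin.castSucc j)) (w (Fin.last m)))) :
    SgP (k + 1) (fun i v => ∃ x, R i v x) := by
  obtain ⟨S, hS, h⟩ := hR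
  have ih := cl_all (M := M) k
  have h1 : SgP k (fun i (w : Fin (m + 1 + 1) → M i) => ∀ x, x ≤ w (Fin.castSucc (Fin.last m)) →
      S i (Fin.snoc (Fin.snoc (fun j => w (Fin.castSucc (Fin.castSucc j))) (w (Fin.last _)) : Fin (m + 1) → M i) x)) :=
    ih.ball (fun i w => w (Fin.castSucc (Fin.last m))) (fun i w x =>
      S i (Fin.snoc (Fin.snoc (fun j => w (Fin.castSucc (Fin.castSucc j))) (w (Fin.last _)) : Fin (m + 1) → M i) x))
    inferInstance hS.skip2
  have h2 := ih.ball (fun i (w : Fin (m + 1) → M i) => w (Fin.last m)) (fun i w y =>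
    ∀ x, x ≤ w (Fin.last m) → S i (Fin.snoc (Fin.snoc (fun j => w (Fin.castSucc j)) y : Fin (m + 1) → M i) x))
    inferInstance h1
  refine ⟨_, h2, fun i v => ?_⟩
  have h3 : ∀ x, R i v x ↔ ∃ y, ¬ S i (Fin.snoc (Fin.snoc v x : Fin (m + 1) → M i) y) := by
    intro x
    have := h i (Fin.snoc v x)
    simp only [Fin.snoc_last, Fin.snoc_castSucc] at this
    exact this
  simp only [Fin.snoc_last, Fin.snoc_castSucc, h3]
  push Not
  constructor
  · rintro ⟨x, y, hy⟩
    exact ⟨x + y, x, le_self_add, y, le_add_self, hy⟩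
  · rintro ⟨z, x, hx, y, _, hy⟩
    exact ⟨x, y, hy⟩

mutual
theorem sigma_SgP : ∀ {k m : ℕ} {φ : LA.BoundedFormula Empty m} (_ : IsSigmaFml k φ),
    SgP (M := M) k (fun i v => φ.Realize default v)
  | _, _, _, .ofDelta0 d => (⟨⟨_, d, fun _ _ => Iff.rfl⟩⟩ : D0 _)
  | _, _, _, .ofPi h => (pi_SgP h).not_up.congr (fun i v => by simp)
  | _, _, _, .ex (φ := φ) h => by
    refine (SgP.exi (fun i v x => φ.Realize default (Fin.snoc v x)) ?_).congr
      (fun i v => BoundedFormula.realize_ex)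
    refine (sigma_SgP h).congr (fun i v => ?_)
    rw [snoc_eta]
theorem pi_SgP : ∀ {k m : ℕ} {φ : LA.BoundedFormula Empty m} (_ : IsPiFml k φ),
    SgP (M := M) k (fun i v => ¬ φ.Realize default v)
  | _, _, _, .ofDelta0 d => by
    have h1 : D0 (M := M) (fun i v => BoundedFormula.Realize _ default v) :=
      ⟨⟨_, d, fun _ _ => Iff.rfl⟩⟩
    exact D0.not _
  | _, _, _, .ofSigma h => (sigma_SgP h).not_up
  | _, _, _, .all (φ := φ) h => by
    refine (SgP.exi (fun i v x => ¬ φ.Realize default (Fin.snoc v x)) ?_).congr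
      (fun i v => ?_)
    · refine (pi_SgP h).congr (fun i v => ?_)
      rw [snoc_eta]
    · rw [BoundedFormula.realize_all]; push Not; rfl
end

/-- Semantic `Σ_k` relations, as a class. -/
class Sg (k : ℕ) (R : ∀ i, (Fin m → M i) → Prop) : Prop where
  p : SgP k R

theorem Sg.congr {k : ℕ} {R R' : ∀ i, (Fin m → M i) → Prop} (hR : Sg k R)
    (h : ∀ i v, R' i v ↔ R i v) : Sg k R' := ⟨hR.p.congr h⟩
instance (priority := 2000) Sg.ofD0 {k : ℕ} (R : ∀ i, (Fin m → M i) → Prop) [hR : D0 R] :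
    Sg k R := by
  have : SgP 0 R := hR
  have : SgP k R := by
    induction k with
    | zero => exact this
    | succ k ih => exact ih.up
  exact ⟨this⟩
theorem Sg.toDf {k : ℕ} (R : ∀ i, (Fin m → M i) → Prop) [hR : Sg k R] : Df R :=
  hR.p.df
instance Sg.and {k : ℕ} (A B : ∀ i, (Fin m → M i) → Prop) [hA : Sg k A] [hB : Sg k B] :
    Sg k (fun i v => A i v ∧ B i v) := ⟨(cl_all k).and hA.p hB.p⟩
instance Sg.or {k : ℕ} (A B : ∀ i, (Fin m → M i) → Prop) [hA : Sg k A] [hB : Sg k B] :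
    Sg k (fun i v => A i v ∨ B i v) := ⟨(cl_all k).or hA.p hB.p⟩
instance (priority := 1100) Sg.ball {k : ℕ} (f : ∀ i, (Fin m → M i) → M i) (R : ∀ i, (Fin m → M i) → M i → Prop) [hf : Tm f]
    [hR : Sg k (fun i (w : Fin (m + 1) → M i) => R i (fun j => w (Fin.castSucc j)) (w (Fin.last m)))] :
    Sg k (fun i v => ∀ x, x ≤ f i v → R i v x) := ⟨(cl_all k).ball f R hf hR.p⟩
instance (priority := 1100) Sg.bex {k : ℕ} (f : ∀ i, (Fin m → M i) → M i) (R : ∀ i, (Fin m → M i) → M i → Prop) [hf : Tm f]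
    [hR : Sg k (fun i (w : Fin (m + 1) → M i) => R i (fun j => w (Fin.castSucc j)) (w (Fin.last m)))] :
    Sg k (fun i v => ∃ x, x ≤ f i v ∧ R i v x) := ⟨(cl_all k).bex f R hf hR.p⟩
/-- Positive use of a bounded hypothesis. -/
instance Sg.impD0 {k : ℕ} (A B : ∀ i, (Fin m → M i) → Prop) [hA : D0 A] [hB : Sg k B] :
    Sg k (fun i v => A i v → B i v) :=
  (Sg.or (fun i v => ¬ A i v) B).congr (fun i v => by tauto)
instance (priority := 1100) Sg.ballt {k : ℕ} (f : ∀ i, (Fin m → M i) → M i) (R : ∀ i, (Fin m → M i) → M i → Prop) [hf : Tm f]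
    [hR : Sg k (fun i (w : Fin (m + 1) → M i) => R i (fun j => w (Fin.castSucc j)) (w (Fin.last m)))] :
    Sg k (fun i v => ∀ x, x < f i v → R i v x) := by
  have h1 := hf.wk
  refine (Sg.ball f (fun i v x => x < f i v → R i v x)).congr (fun i v => forall_congr' fun x => ?_)
  constructor
  · intro h _; exact h
  · intro h h'; exact h h'.le h'
instance Sg.exi {k : ℕ} (R : ∀ i, (Fin m → M i) → M i → Prop)
    [hR : Sg (k + 1) (fun i (w : Fin (m + 1) → M i) => R i (fun j => w (Fin.castSucc j)) (w (Fin.last m)))] :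
    Sg (k + 1) (fun i v => ∃ x, R i v x) := ⟨SgP.exi R hR.p⟩
theorem Sg.sub {k : ℕ} {a m : ℕ} (R : ∀ i, (Fin a → M i) → Prop) (hR : Sg k R)
    (g : Fin a → ∀ i, (Fin m → M i) → M i) (hg : ∀ j, Tm (g j)) :
    Sg k (fun i v => R i (fun j => g j i v)) := ⟨SgP.sub R hR.p g hg⟩

end SgSec

section Coding
variable {M : Type} [PAM M]

/-- A polynomial injective pairing. -/
def pr (x y : M) : M := (x + y) * (x + y) + x

theorem fst_le_pr (x y : M) : x ≤ pr x y := le_add_self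
theorem self_le_mul_self (x : M) : x ≤ x * x := by
  rcases PAM.zs x with rfl | ⟨y, rfl⟩
  · simp
  · calc y + 1 = (y + 1) * 1 := by ring
      _ ≤ (y + 1) * (y + 1) := by gcongr; exact le_add_self
theorem snd_le_pr (x y : M) : y ≤ pr x y :=
  calc y ≤ x + y := le_add_self
    _ ≤ (x + y) * (x + y) := self_le_mul_self _
    _ ≤ _ := le_self_add
theorem pr_mono {a b c d : M} (h : a ≤ c) (h' : b ≤ d) : pr a b ≤ pr c d := by
  unfold pr; gcongr

theorem pr_sum_le {a b c d : M} (h : pr a b = pr c d) : a + b ≤ c + d := by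
  by_contra hc
  rw [not_le, PAM.lt_iff] at hc
  have h1 : (c + d + 1) * (c + d + 1) ≤ (a + b) * (a + b) := by gcongr
  have h2 : pr c d < pr a b := by
    calc pr c d < (c + d + 1) * (c + d + 1) := by
          have : (c + d + 1) * (c + d + 1) = pr c d + (d + d + c + 1) := by unfold pr; ring
          rw [this]
          refine lt_add_of_pos_right _ (pos_iff_ne_zero.2 (PAM.s_ne _))
      _ ≤ (a + b) * (a + b) := h1
      _ ≤ _ := le_self_add
  exact h2.ne h.symm

theorem pr_inj {a b c d : M} : pr a b = pr c d ↔ a = c ∧ b = d := by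
  constructor
  · intro h
    have h1 : a + b = c + d := le_antisymm (pr_sum_le h) (pr_sum_le h.symm)
    have h2 : a = c := by
      unfold pr at h; rw [h1] at h; exact add_left_cancel h
    subst h2
    exact ⟨rfl, add_left_cancel h1⟩
  · rintro ⟨rfl, rfl⟩; rfl

theorem pr_cast (a b : ℕ) : ((pr a b : ℕ) : M) = pr (a : M) (b : M) := by
  unfold pr; push_cast; rfl

theorem dvd_of_add {d a b : M} (h : d ∣ a) (h' : d ∣ a + b) : d ∣ b := by
  obtain ⟨s, rfl⟩ := h
  obtain ⟨t, ht⟩ := h'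
  rcases le_total s t with hs | hs
  · obtain ⟨r, rfl⟩ := exists_add_of_le hs
    exact ⟨r, add_left_cancel (ht.trans (mul_add _ _ _))⟩
  · have : d * s + b ≤ d * s := by rw [ht]; gcongr
    have : b = 0 := by
      have h1 : d * s + b ≤ d * s + 0 := by rwa [add_zero]
      exact le_antisymm (le_of_add_le_add_left h1) (PAM.zl _)
    rw [this]; exact dvd_zero _

/-- The divisor attached to `x`. -/
def dv (m x : M) : M := 1 + (x + 1) * m

theorem dv_aux {m x p k l : M} (hm : m = k * l) (h : dv m x ∣ p * (k * m)) : dv m x ∣ p := by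
  have h1 : dv m x ∣ p * ((x + 1) * m) * ((x + 1) * m) := by
    have : p * ((x + 1) * m) * ((x + 1) * m) = (p * (k * m)) * (l * ((x + 1) * (x + 1))) := by
      calc p * ((x + 1) * m) * ((x + 1) * m) = p * m * ((x + 1) * (x + 1)) * m := by ring
        _ = p * m * ((x + 1) * (x + 1)) * (k * l) := by rw [← hm]
        _ = _ := by ring
    rw [this]
    exact h.mul_right _
  have h2 : dv m x ∣ p * ((x + 1) * m) := by
    refine dvd_of_add h1 ⟨p * ((x + 1) * m), ?_⟩
    unfold dv; ring
  refine dvd_of_add h2 ⟨p, ?_⟩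
  unfold dv; ring

theorem dv_cop {N m x b p : M} (hm : ∀ k, k ≠ 0 → k ≤ N → k ∣ m) (hx : x ≤ N) (hb : b ≤ N)
    (hne : x ≠ b) (h : dv m x ∣ p * dv m b) : dv m x ∣ p := by
  rcases le_total x b with hh | hh
  · obtain ⟨k, rfl⟩ := exists_add_of_le hh
    have hk : k ≠ 0 := by rintro rfl; simp at hne
    obtain ⟨l, hl⟩ := hm k hk (le_add_self.trans hb)
    refine dv_aux hl (dvd_of_add (a := p * dv m x) (dvd_mul_left _ _) ?_)
    convert h using 1
    unfold dv; ring
  · obtain ⟨k, rfl⟩ := exists_add_of_le hh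
    have hk : k ≠ 0 := by rintro rfl; simp at hne
    obtain ⟨l, hl⟩ := hm k hk (le_add_self.trans hx)
    refine dv_aux hl (dvd_of_add h ⟨p, ?_⟩)
    unfold dv; ring

/-- Membership in a coded set. -/
def Mem (x b m p : M) : Prop := x ≤ b ∧ ∃ q, q ≤ p ∧ p = dv m x * q

theorem Mem_iff {x b m p : M} : Mem x b m p ↔ x ≤ b ∧ dv m x ∣ p := by
  unfold Mem
  refine and_congr_right fun _ => ⟨fun ⟨q, _, h⟩ => ⟨q, h⟩, fun ⟨q, h⟩ => ⟨q, ?_, h⟩⟩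
  rw [h, dv, add_mul, one_mul]
  exact le_self_add

end Coding

section Comp
universe u
variable {ι : Type u} {M : ι → Type} [∀ i, PAM (M i)] {m : ℕ}

instance Tm.pr (f g : ∀ i, (Fin m → M i) → M i) [hf : Tm f] [hg : Tm g] :
    Tm (fun i v => pr (f i v) (g i v)) := by unfold Guaspari.pr; infer_instance
instance Tm.dv (f g : ∀ i, (Fin m → M i) → M i) [hf : Tm f] [hg : Tm g] :
    Tm (fun i v => dv (f i v) (g i v)) := by unfold Guaspari.dv; infer_instance

theorem Df.cur1 (R : ∀ i, (Fin m → M i) → M i → Prop)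
    (hR : Df (fun i (w : Fin (m + 1) → M i) => R i (fun j => w (Fin.castSucc j)) (w (Fin.last m))))
    {a : ℕ} (g : Fin m → ∀ i, (Fin a → M i) → M i) (f : ∀ i, (Fin a → M i) → M i)
    [hg : ∀ j, Tm (g j)] [hf : Tm f] : Df (fun i w => R i (fun j => g j i w) (f i w)) := by
  refine (Df.sub _ hR _ (Tm.snoc g f hg hf)).congr (fun i v => ?_)
  simp only [Fin.snoc_castSucc, Fin.snoc_last]

theorem exists_mult {N : Type} [PAM N] (n : N) : ∃ m : N, m ≠ 0 ∧ ∀ k, k ≠ 0 → k ≤ n → k ∣ m := by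
  refine dind (M := fun _ : Unit => N) (m := 0)
    (fun _ _ n => ∃ m : N, m ≠ 0 ∧ ∀ k, k ≠ 0 → k ≤ n → ∃ c, m = k * c) (i := ()) ![] ?_ ?_ n
  · exact ⟨1, one_ne_zero, fun k h1 h2 => absurd (le_antisymm h2 (PAM.zl _)) h1⟩
  · rintro n ⟨m, h0, h⟩
    refine ⟨m * (n + 1), mul_ne_zero h0 (PAM.s_ne n), fun k h1 h2 => ?_⟩
    rcases (PAM.le_succ _ _).1 h2 with h3 | rfl
    · obtain ⟨c, rfl⟩ := h k h1 h3
      exact ⟨c * (n + 1), by ring⟩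
    · exact ⟨m, by ring⟩

/-- Definable comprehension for coded sets. -/
theorem dcomp (R : ∀ i, (Fin m → M i) → M i → Prop)
    [hR : Df (fun i (w : Fin (m + 1) → M i) => R i (fun j => w (Fin.castSucc j)) (w (Fin.last m)))]
    {i : ι} (v : Fin m → M i) (b : M i) :
    ∃ m p, ∀ x, Mem x b m p ↔ x ≤ b ∧ R i v x := by
  have H := @Df.cur1 _ M _ m R hR
  obtain ⟨q, hq0, hq⟩ := exists_mult b
  have key := dind (fun i (v : Fin (m + 2) → M i) c => ∃ p, p ≠ 0 ∧ ∀ x, x ≤ v (Fin.castSucc (Fin.last m)) →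
      ((∃ r, p = dv (v (Fin.last (m + 1))) x * r) ↔
        x < c ∧ R i (fun j => v (Fin.castSucc (Fin.castSucc j))) x))
    (Fin.snoc (Fin.snoc v b : Fin (m + 1) → M i) q) ?_ ?_ (b + 1)
  · simp only [Fin.snoc_last, Fin.snoc_castSucc] at key
    obtain ⟨p, _, hp⟩ := key
    refine ⟨q, p, fun x => ?_⟩
    rw [Mem_iff]
    refine and_congr_right fun hx => (hp x hx).trans ?_
    rw [PAM.lt_succ]
    exact and_iff_right hx
  · simp only [Fin.snoc_last, Fin.snoc_castSucc]
    refine ⟨1, one_ne_zero, fun x _ => ⟨?_, fun h => absurd h.1 (not_lt.2 (PAM.zl _))⟩⟩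
    rintro ⟨r, hr⟩
    exfalso
    have h1 : r ≠ 0 := by rintro rfl; simp at hr
    obtain ⟨s, rfl⟩ := (PAM.ne_zero_iff r).1 h1
    obtain ⟨t, rfl⟩ := (PAM.ne_zero_iff q).1 hq0
    have : (1 : M i) + 0 = 1 + ((s + (x + 1) * (t + 1) * s) + (x * t + x + t) + 1) := by
      rw [add_zero]
      refine hr.trans ?_
      unfold dv; ring
    exact PAM.s_ne _ (add_left_cancel this).symm
  · intro c
    simp only [Fin.snoc_last, Fin.snoc_castSucc]
    rintro ⟨p, hp0, hp⟩
    by_cases hc : c ≤ b ∧ R i v c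
    · refine ⟨p * dv q c, mul_ne_zero hp0 ?_, fun x hx => ?_⟩
      · unfold dv; rw [add_comm]; exact PAM.s_ne _
      · by_cases hxc : x = c
        · subst hxc
          exact ⟨fun _ => ⟨lt_add_one _, hc.2⟩, fun _ => ⟨p, mul_comm _ _⟩⟩
        · have h1 : (∃ r, p * dv q c = dv q x * r) ↔ (∃ r, p = dv q x * r) :=
            ⟨fun h => dv_cop hq hx hc.1 hxc h, fun ⟨r, h⟩ => ⟨r * dv q c, by rw [h]; ring⟩⟩
          rw [h1, hp x hx, PAM.lt_succ, le_iff_lt_or_eq]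
          simp [hxc]
    · refine ⟨p, hp0, fun x hx => ?_⟩
      rw [hp x hx, PAM.lt_succ, le_iff_lt_or_eq]
      by_cases hxc : x = c
      · subst hxc
        simp only [lt_self_iff_false, false_and, false_or, true_and, or_true]
        exact ⟨fun h => h.elim, fun h => hc ⟨hx, h⟩⟩
      · simp [hxc]

instance D0.mem (x b q p : ∀ i, (Fin m → M i) → M i) [hx : Tm x] [hb : Tm b] [hq : Tm q] [hp : Tm p] :
    D0 (fun i v => Mem (x i v) (b i v) (q i v) (p i v)) := by
  unfold Mem
  have := hx.wk
  have := hq.wk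
  have := hp.wk
  infer_instance

end Comp

/-- Basic operations. -/
inductive Op : Type
  | zero | ident | succ | add | mul | fst | snd | eq | le | imp

/-- Expressions for bounded truth. -/
inductive Expr : Type
  | op (o : Op) : Expr
  | comp (k l : Expr) : Expr
  | pair (k l : Expr) : Expr
  | ball (k : Expr) : Expr

/-- Code of an operation. -/
def Op.code : Op → ℕ
  | zero => 0 | ident => 1 | succ => 2 | add => 3 | mul => 4
  | fst => 5 | snd => 6 | eq => 7 | le => 8 | imp => 9

/-- Code of an expression. -/
def Expr.code : Expr → ℕ
  | op o => pr 0 o.code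
  | comp k l => pr 1 (pr k.code l.code)
  | pair k l => pr 2 (pr k.code l.code)
  | ball k => pr 3 k.code

section
variable {M : Type} [PAM M]

/-- Unpairing, with default value `(0,0)`. -/
def UnP (w a b : M) : Prop :=
  w = pr a b ∨ (a = 0 ∧ b = 0 ∧ ¬ ∃ x, x ≤ w ∧ ∃ y, y ≤ w ∧ w = pr x y)

theorem UnP.le {w a b : M} (h : UnP w a b) : a ≤ w ∧ b ≤ w := by
  rcases h with rfl | ⟨rfl, rfl, _⟩
  · exact ⟨fst_le_pr _ _, snd_le_pr _ _⟩
  · exact ⟨PAM.zl _, PAM.zl _⟩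

theorem UnP.ex (w : M) : ∃ a b : M, UnP w a b := by
  by_cases h : ∃ x, x ≤ w ∧ ∃ y, y ≤ w ∧ w = pr x y
  · obtain ⟨x, _, y, _, h⟩ := h
    exact ⟨x, y, Or.inl h⟩
  · exact ⟨0, 0, Or.inr ⟨rfl, rfl, h⟩⟩

theorem UnP.uniq {w a b a' b' : M} (h : UnP w a b) (h' : UnP w a' b') : a = a' ∧ b = b' := by
  rcases h with h | ⟨h1, h2, h3⟩
  · rcases h' with h' | ⟨h1', h2', h3'⟩
    · exact pr_inj.1 (h.symm.trans h')
    · exact absurd ⟨a, h ▸ fst_le_pr a b, b, h ▸ snd_le_pr a b, h⟩ h3'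
  · rcases h' with h' | ⟨h1', h2', h3'⟩
    · exact absurd ⟨a', h' ▸ fst_le_pr a' b', b', h' ▸ snd_le_pr a' b', h'⟩ h3
    · exact ⟨h1.trans h1'.symm, h2.trans h2'.symm⟩

/-- First component. -/
noncomputable def p1 (w : M) : M := (UnP.ex w).choose
/-- Second component. -/
noncomputable def p2 (w : M) : M := (UnP.ex w).choose_spec.choose
theorem UnP.spec (w : M) : UnP w (p1 w) (p2 w) := (UnP.ex w).choose_spec.choose_spec
theorem UnP.iff {w a b : M} : UnP w a b ↔ a = p1 w ∧ b = p2 w :=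
  ⟨fun h => h.uniq (UnP.spec w), fun ⟨h, h'⟩ => h ▸ h' ▸ UnP.spec w⟩
@[simp] theorem p1_pr (a b : M) : p1 (pr a b) = a := ((UnP.iff (w := pr a b)).1 (Or.inl rfl)).1.symm
@[simp] theorem p2_pr (a b : M) : p2 (pr a b) = b := ((UnP.iff (w := pr a b)).1 (Or.inl rfl)).2.symm

/-- Truth value relation. -/
def TV (P : Prop) (y : M) : Prop := (P ∧ y = 1) ∨ (¬ P ∧ y = 0)

/-- Graph of operations by numerical code. -/
def OpG (o w y : M) : Prop :=
  ∃ a, a ≤ w ∧ ∃ b, b ≤ w ∧ UnP w a b ∧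
    ((o = 0 ∧ y = 0) ∨ (o = 1 ∧ y = w) ∨ (o = 2 ∧ y = w + 1) ∨ (o = 3 ∧ y = a + b) ∨
     (o = 4 ∧ y = a * b) ∨ (o = 5 ∧ y = a) ∨ (o = 6 ∧ y = b) ∨
     (o = 7 ∧ ((a = b ∧ y = 1) ∨ (¬ a = b ∧ y = 0))) ∨
     (o = 8 ∧ ((a ≤ b ∧ y = 1) ∨ (¬ a ≤ b ∧ y = 0))) ∨
     (o = 9 ∧ (((a = 1 → b = 1) ∧ y = 1) ∨ (¬ (a = 1 → b = 1) ∧ y = 0))))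

open Classical in
/-- Evaluation of operations. -/
noncomputable def Op.ev : Op → M → M
  | zero, _ => 0
  | ident, w => w
  | succ, w => w + 1
  | add, w => p1 w + p2 w
  | mul, w => p1 w * p2 w
  | fst, w => p1 w
  | snd, w => p2 w
  | eq, w => if p1 w = p2 w then 1 else 0
  | le, w => if p1 w ≤ p2 w then 1 else 0
  | imp, w => if (p1 w = 1 → p2 w = 1) then 1 else 0

theorem OpG_iff (o : Op) (w y : M) : OpG (o.code : M) w y ↔ y = o.ev w := by
  have h1 : OpG (o.code : M) w y ↔
    (((o.code : M) = (0:ℕ) ∧ y = 0) ∨ ((o.code : M) = (1:ℕ) ∧ y = w) ∨ ((o.code : M) = (2:ℕ) ∧ y = w + 1) ∨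
     ((o.code : M) = (3:ℕ) ∧ y = p1 w + p2 w) ∨
     ((o.code : M) = (4:ℕ) ∧ y = p1 w * p2 w) ∨ ((o.code : M) = (5:ℕ) ∧ y = p1 w) ∨ ((o.code : M) = (6:ℕ) ∧ y = p2 w) ∨
     ((o.code : M) = (7:ℕ) ∧ ((p1 w = p2 w ∧ y = 1) ∨ (¬ p1 w = p2 w ∧ y = 0))) ∨
     ((o.code : M) = (8:ℕ) ∧ ((p1 w ≤ p2 w ∧ y = 1) ∨ (¬ p1 w ≤ p2 w ∧ y = 0))) ∨
     ((o.code : M) = (9:ℕ) ∧ (((p1 w = 1 → p2 w = 1) ∧ y = 1) ∨ (¬ (p1 w = 1 → p2 w = 1) ∧ y = 0)))) := by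
    simp only [Nat.cast_zero, Nat.cast_one, Nat.cast_ofNat]
    constructor
    · rintro ⟨a, _, b, _, h, h'⟩
      obtain ⟨rfl, rfl⟩ := UnP.iff.1 h
      exact h'
    · intro h
      exact ⟨p1 w, (UnP.spec w).le.1, p2 w, (UnP.spec w).le.2, UnP.spec w, h⟩
  rw [h1]
  simp only [Nat.cast_inj]
  cases o <;> simp [Op.code, Op.ev] <;> split_ifs <;> simp_all

open Classical in
/-- Evaluation of expressions. -/
noncomputable def Expr.ev : Expr → M → M
  | op o, w => o.ev w
  | comp k l, w => k.ev (l.ev w)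
  | pair k l, w => pr (k.ev w) (l.ev w)
  | ball k, w => if ∀ x, x ≤ p2 w → k.ev (pr (p1 w) x) = 1 then 1 else 0

/-- Table entries. -/
def e3 (i w y : M) : M := pr (pr i w) y
theorem e3_inj {i w y i' w' y' : M} : e3 i w y = e3 i' w' y' ↔ i = i' ∧ w = w' ∧ y = y' := by
  unfold e3; rw [pr_inj, pr_inj, and_assoc]
theorem e3_le (i w y : M) : i ≤ e3 i w y ∧ w ≤ e3 i w y ∧ y ≤ e3 i w y :=
  ⟨(fst_le_pr _ _).trans (fst_le_pr _ _), (snd_le_pr _ _).trans (fst_le_pr _ _), snd_le_pr _ _⟩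

/-- Local justification relative to a set of entries. -/
def JX (X : M → Prop) (i w y : M) : Prop :=
  (∃ o, i = pr 0 o ∧ OpG o w y) ∨
  (∃ k l, i = pr 1 (pr k l) ∧ ∃ z, X (e3 l w z) ∧ X (e3 k z y)) ∨
  (∃ k l, i = pr 2 (pr k l) ∧ ∃ z z', X (e3 k w z) ∧ X (e3 l w z') ∧ y = pr z z') ∨
  (∃ k, i = pr 3 k ∧ ((y = 1 ∧ ∀ x, x ≤ p2 w → X (e3 k (pr (p1 w) x) 1)) ∨
      (y = 0 ∧ ∃ x, x ≤ p2 w ∧ ∃ z, z ≠ 1 ∧ X (e3 k (pr (p1 w) x) z))))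

theorem JX.mono {X Y : M → Prop} (h : ∀ x, X x → Y x) {i w y : M} (hj : JX X i w y) : JX Y i w y := by
  rcases hj with hj | ⟨k, l, h1, z, h2, h3⟩ | ⟨k, l, h1, z, z', h2, h3, h4⟩ | ⟨k, h1, h2⟩
  · exact Or.inl hj
  · exact Or.inr (Or.inl ⟨k, l, h1, z, h _ h2, h _ h3⟩)
  · exact Or.inr (Or.inr (Or.inl ⟨k, l, h1, z, z', h _ h2, h _ h3, h4⟩))
  · refine Or.inr (Or.inr (Or.inr ⟨k, h1, ?_⟩))
    rcases h2 with ⟨h2, h3⟩ | ⟨h2, x, h3, z, h4, h5⟩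
    · exact Or.inl ⟨h2, fun x hx => h _ (h3 x hx)⟩
    · exact Or.inr ⟨h2, x, h3, z, h4, h _ h5⟩

/-- Bounded form of local justification. -/
def JB (b q p i w y : M) : Prop :=
  (∃ o, o ≤ i ∧ i = pr 0 o ∧ OpG o w y) ∨
  (∃ k, k ≤ i ∧ ∃ l, l ≤ i ∧ i = pr 1 (pr k l) ∧ ∃ z, z ≤ b ∧ Mem (e3 l w z) b q p ∧ Mem (e3 k z y) b q p) ∨
  (∃ k, k ≤ i ∧ ∃ l, l ≤ i ∧ i = pr 2 (pr k l) ∧ ∃ z, z ≤ b ∧ ∃ z', z' ≤ b ∧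
    Mem (e3 k w z) b q p ∧ Mem (e3 l w z') b q p ∧ y = pr z z') ∨
  (∃ k, k ≤ i ∧ i = pr 3 k ∧ ∃ c, c ≤ w ∧ ∃ d, d ≤ w ∧ UnP w c d ∧
    ((y = 1 ∧ ∀ x, x ≤ d → Mem (e3 k (pr c x) 1) b q p) ∨
      (y = 0 ∧ ∃ x, x ≤ d ∧ ∃ z, z ≤ b ∧ z ≠ 1 ∧ Mem (e3 k (pr c x) z) b q p)))

theorem JB_iff (b q p i w y : M) : JB b q p i w y ↔ JX (fun x => Mem x b q p) i w y := by
  have hle : ∀ {k x z : M}, Mem (e3 k x z) b q p → x ≤ b ∧ z ≤ b := fun h =>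
    ⟨(e3_le _ _ _).2.1.trans h.1, (e3_le _ _ _).2.2.trans h.1⟩
  unfold JB JX
  refine or_congr ?_ (or_congr ?_ (or_congr ?_ ?_))
  · refine ⟨fun ⟨o, _, h⟩ => ⟨o, h⟩, fun ⟨o, h⟩ => ⟨o, ?_, h⟩⟩
    rw [h.1]; exact snd_le_pr _ _
  · constructor
    · rintro ⟨k, _, l, _, h1, z, _, h2, h3⟩; exact ⟨k, l, h1, z, h2, h3⟩
    · rintro ⟨k, l, h1, z, h2, h3⟩
      refine ⟨k, ?_, l, ?_, h1, z, (hle h2).2, h2, h3⟩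
      · rw [h1]; exact (fst_le_pr _ _).trans (snd_le_pr _ _)
      · rw [h1]; exact (snd_le_pr _ _).trans (snd_le_pr _ _)
  · constructor
    · rintro ⟨k, _, l, _, h1, z, _, z', _, h2, h3⟩; exact ⟨k, l, h1, z, z', h2, h3⟩
    · rintro ⟨k, l, h1, z, z', h2, h3, h4⟩
      refine ⟨k, ?_, l, ?_, h1, z, (hle h2).2, z', (hle h3).2, h2, h3, h4⟩
      · rw [h1]; exact (fst_le_pr _ _).trans (snd_le_pr _ _)
      · rw [h1]; exact (snd_le_pr _ _).trans (snd_le_pr _ _)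
  · constructor
    · rintro ⟨k, _, h1, c, _, d, _, h2, h3⟩
      obtain ⟨rfl, rfl⟩ := UnP.iff.1 h2
      refine ⟨k, h1, h3.imp id ?_⟩
      rintro ⟨h4, x, h5, z, _, h6⟩
      exact ⟨h4, x, h5, z, h6⟩
    · rintro ⟨k, h1, h3⟩
      refine ⟨k, ?_, h1, p1 w, (UnP.spec w).le.1, p2 w, (UnP.spec w).le.2, UnP.spec w, h3.imp id ?_⟩
      · rw [h1]; exact snd_le_pr _ _
      · rintro ⟨h4, x, h5, z, h6, h7⟩
        exact ⟨h4, x, h5, z, (hle h7).2, h6, h7⟩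

/-- Correct tables. -/
def Corr (b q p : M) : Prop :=
  ∀ i, i ≤ b → ∀ w, w ≤ b → ∀ y, y ≤ b → Mem (e3 i w y) b q p → JB b q p i w y

theorem Corr.j {b q p i w y : M} (h : Corr b q p) (hm : Mem (e3 i w y) b q p) :
    JX (fun x => Mem x b q p) i w y :=
  (JB_iff _ _ _ _ _ _).1 (h i ((e3_le _ _ _).1.trans hm.1) w ((e3_le _ _ _).2.1.trans hm.1) y
    ((e3_le _ _ _).2.2.trans hm.1) hm)

theorem Corr.sound {b q p : M} (h : Corr b q p) (e : Expr) : ∀ w y,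
    Mem (e3 (e.code : M) w y) b q p → y = e.ev w := by
  have tag : ∀ {a c : ℕ} {x y : M}, pr (a : M) x = pr (c : M) y ↔ a = c ∧ x = y := by
    intro a c x y; rw [pr_inj, Nat.cast_inj]
  induction e with
  | op o =>
    intro w y hm
    have := h.j hm
    simp only [JX, Expr.code, pr_cast, ← Nat.cast_zero (R := M), ← Nat.cast_one (R := M),
      ← Nat.cast_ofNat (R := M), tag] at this
    norm_num at this
    rw [OpG_iff] at this
    rw [this, Expr.ev]
  | comp k l ihk ihl =>
    intro w y hm
    have := h.j hm
    simp only [JX, Expr.code, pr_cast, ← Nat.cast_zero (R := M), ← Nat.cast_one (R := M),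
      ← Nat.cast_ofNat (R := M), tag] at this
    norm_num [pr_inj] at this
    obtain ⟨k', l', ⟨rfl, rfl⟩, z, h1, h2⟩ := this
    rw [ihk _ _ h2, ihl _ _ h1, Expr.ev]
  | pair k l ihk ihl =>
    intro w y hm
    have := h.j hm
    simp only [JX, Expr.code, pr_cast, ← Nat.cast_zero (R := M), ← Nat.cast_one (R := M),
      ← Nat.cast_ofNat (R := M), tag] at this
    norm_num [pr_inj] at this
    obtain ⟨k', l', ⟨rfl, rfl⟩, z, h1, z', h2, h3⟩ := this
    rw [h3, ihk _ _ h1, ihl _ _ h2, Expr.ev]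
  | ball k ih =>
    intro w y hm
    have := h.j hm
    simp only [JX, Expr.code, pr_cast] at this
    simp only [pr_inj] at this
    have n1 : (3 : M) ≠ 0 := by norm_num
    have n2 : (3 : M) ≠ 1 := by norm_num
    have n3 : (3 : M) ≠ 2 := by norm_num
    simp only [Nat.cast_ofNat, n1, n2, n3, false_and, exists_false, false_or, true_and] at this
    obtain ⟨k', rfl, h1⟩ := this
    rw [Expr.ev]
    rcases h1 with ⟨h1, h2⟩ | ⟨h1, x, h2, z, h3, h4⟩
    · rw [if_pos (fun x hx => (ih _ _ (h2 x hx)).symm), h1]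
    · rw [if_neg (fun h5 => h3 ((ih _ _ h4).trans (h5 x h2))), h1]

end

section EvDef
universe u
variable {ι : Type u} {M : ι → Type} [∀ i, PAM (M i)] {m : ℕ}

instance Tm.e3 (f g h : ∀ i, (Fin m → M i) → M i) [hf : Tm f] [hg : Tm g] [hh : Tm h] :
    Tm (fun i v => e3 (f i v) (g i v) (h i v)) := by unfold Guaspari.e3; infer_instance

instance D0.unp (x b q : ∀ i, (Fin m → M i) → M i) [hx : Tm x] [hb : Tm b] [hq : Tm q] :
    D0 (fun i v => UnP (x i v) (b i v) (q i v)) :=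
  D0.sub (fun i (v : Fin 3 → M i) => UnP (v 0) (v 1) (v 2)) (by unfold UnP; infer_instance) ![x, b, q]
    (by intro j; fin_cases j <;> assumption)

set_option synthInstance.maxHeartbeats 1000000 in
set_option synthInstance.maxSize 10000 in
instance D0.opg (x b q : ∀ i, (Fin m → M i) → M i) [hx : Tm x] [hb : Tm b] [hq : Tm q] :
    D0 (fun i v => OpG (x i v) (b i v) (q i v)) :=
  D0.sub (fun i (v : Fin 3 → M i) => OpG (v 0) (v 1) (v 2)) (by unfold OpG; infer_instance) ![x, b, q]
    (by intro j; fin_cases j <;> assumption)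

set_option synthInstance.maxHeartbeats 1000000 in
set_option synthInstance.maxSize 10000 in
instance D0.jb (b q p x y z : ∀ i, (Fin m → M i) → M i) [hb : Tm b] [hq : Tm q] [hp : Tm p]
    [hx : Tm x] [hy : Tm y] [hz : Tm z] :
    D0 (fun i v => JB (b i v) (q i v) (p i v) (x i v) (y i v) (z i v)) :=
  D0.sub (fun i (v : Fin 6 → M i) => JB (v 0) (v 1) (v 2) (v 3) (v 4) (v 5))
    (by unfold JB; infer_instance) ![b, q, p, x, y, z]
    (by intro j; fin_cases j <;> assumption)

set_option synthInstance.maxHeartbeats 1000000 in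
set_option synthInstance.maxSize 10000 in
instance D0.corr (x b q : ∀ i, (Fin m → M i) → M i) [hx : Tm x] [hb : Tm b] [hq : Tm q] :
    D0 (fun i v => Corr (x i v) (b i v) (q i v)) :=
  D0.sub (fun i (v : Fin 3 → M i) => Corr (v 0) (v 1) (v 2)) (by unfold Corr; infer_instance) ![x, b, q]
    (by intro j; fin_cases j <;> assumption)

theorem Df.ev_of {e : Expr} (h : Df (fun i (v : Fin 2 → M i) => v 1 = e.ev (v 0)))
    {m : ℕ} (f g : ∀ i, (Fin m → M i) → M i) [hf : Tm f] [hg : Tm g] :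
    Df (fun i v => g i v = e.ev (f i v)) :=
  Df.sub (fun i (v : Fin 2 → M i) => v 1 = e.ev (v 0)) h ![f, g]
    (by intro j; fin_cases j <;> assumption)

theorem Df.ev_aux (e : Expr) : Df (fun i (v : Fin 2 → M i) => v 1 = e.ev (v 0)) := by
  induction e with
  | op o =>
    have : Df (fun i (v : Fin 2 → M i) => OpG (o.code : M i) (v 0) (v 1)) := inferInstance
    exact this.congr fun i v => by rw [OpG_iff, Expr.ev]
  | comp k l ihk ihl =>
    have hk := @Df.ev_of _ M _ k ihk
    have hl := @Df.ev_of _ M _ l ihl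
    have : Df (fun i (v : Fin 2 → M i) => ∃ z, z = l.ev (v 0) ∧ v 1 = k.ev z) := inferInstance
    exact this.congr fun i v => by simp [Expr.ev]
  | pair k l ihk ihl =>
    have hk := @Df.ev_of _ M _ k ihk
    have hl := @Df.ev_of _ M _ l ihl
    have : Df (fun i (v : Fin 2 → M i) => ∃ z, z = l.ev (v 0) ∧ ∃ y, y = k.ev (v 0) ∧ v 1 = pr y z) :=
      inferInstance
    exact this.congr fun i v => by simp [Expr.ev]
  | ball k ihk =>
    have hk := @Df.ev_of _ M _ k ihk
    have : Df (fun i (v : Fin 2 → M i) => ∃ c, ∃ d, UnP (v 0) c d ∧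
        ((v 1 = 1 ∧ ∀ x, x ≤ d → 1 = k.ev (pr c x)) ∨ (v 1 = 0 ∧ ¬ ∀ x, x ≤ d → 1 = k.ev (pr c x)))) :=
      inferInstance
    refine this.congr fun i v => ?_
    simp only [Expr.ev, UnP.iff]
    constructor
    · intro h
      refine ⟨_, _, ⟨rfl, rfl⟩, ?_⟩
      split_ifs at h with h1
      · exact Or.inl ⟨h, fun x hx => (h1 x hx).symm⟩
      · exact Or.inr ⟨h, fun h2 => h1 fun x hx => (h2 x hx).symm⟩
    · rintro ⟨c, d, ⟨rfl, rfl⟩, ⟨h1, h2⟩ | ⟨h1, h2⟩⟩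
      · rw [if_pos (fun x hx => (h2 x hx).symm), h1]
      · rw [if_neg (fun h3 => h2 fun x hx => (h3 x hx).symm), h1]

instance Df.ev (e : Expr) (f g : ∀ i, (Fin m → M i) → M i) [hf : Tm f] [hg : Tm g] :
    Df (fun i v => g i v = e.ev (f i v)) := Df.ev_of (Df.ev_aux e) f g

end EvDef

section Complete
variable {N : Type} [PAM N]

theorem ev_bound (e : Expr) (b : N) : ∃ c, ∀ w, w ≤ b → e.ev w ≤ c := by
  obtain ⟨z, hz⟩ := dcoll (M := fun _ : Unit => N) (m := 0) (fun _ _ w y => y = e.ev w) (i := ()) ![] b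
    (fun y _ => ⟨_, rfl⟩)
  refine ⟨z, fun w hw => ?_⟩
  obtain ⟨x, hx, rfl⟩ := hz w hw
  exact hx

theorem corr_mk {b q p : N} (h : ∀ i w y, Mem (e3 i w y) b q p → JX (fun x => Mem x b q p) i w y) :
    Corr b q p := fun i _ w _ y _ hm => (JB_iff _ _ _ _ _ _).2 (h i w y hm)

theorem corr_union {b q p b' q' p' : N} (h : Corr b q p) (h' : Corr b' q' p') :
    ∃ c r s, Corr c r s ∧ (∀ x, Mem x b q p → Mem x c r s) ∧ (∀ x, Mem x b' q' p' → Mem x c r s) := by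
  obtain ⟨r, s, hrs⟩ := dcomp (M := fun _ : Unit => N) (m := 6)
    (fun _ v x => Mem x (v 0) (v 1) (v 2) ∨ Mem x (v 3) (v 4) (v 5)) (i := ()) ![b, q, p, b', q', p'] (b + b')
  have hrs : ∀ x, Mem x (b + b') r s ↔ x ≤ b + b' ∧ (Mem x b q p ∨ Mem x b' q' p') := hrs
  have i1 : ∀ x, Mem x b q p → Mem x (b + b') r s := fun x hx =>
    (hrs x).2 ⟨hx.1.trans le_self_add, Or.inl hx⟩
  have i2 : ∀ x, Mem x b' q' p' → Mem x (b + b') r s := fun x hx =>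
    (hrs x).2 ⟨hx.1.trans le_add_self, Or.inr hx⟩
  refine ⟨b + b', r, s, corr_mk fun i w y hm => ?_, i1, i2⟩
  rcases ((hrs _).1 hm).2 with h1 | h1
  · exact (h.j h1).mono i1
  · exact (h'.j h1).mono i2

theorem corr_ext {b q p : N} (h : Corr b q p) (e : Expr) (b0 : N)
    (hj : ∀ w, w ≤ b0 → JX (fun x => Mem x b q p) (e.code : N) w (e.ev w)) :
    ∃ c r s, Corr c r s ∧ (∀ w, w ≤ b0 → Mem (e3 (e.code : N) w (e.ev w)) c r s) := by
  obtain ⟨d, hd⟩ := ev_bound e b0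
  obtain ⟨r, s, hrs⟩ := dcomp (M := fun _ : Unit => N) (m := 4)
    (fun _ v x => Mem x (v 0) (v 1) (v 2) ∨ ∃ w, w ≤ v 3 ∧ ∃ y, y = e.ev w ∧ x = e3 (e.code : N) w y)
    (i := ()) ![b, q, p, b0] (b + e3 (e.code : N) b0 d)
  have hrs : ∀ x, Mem x (b + e3 (e.code : N) b0 d) r s ↔ x ≤ b + e3 (e.code : N) b0 d ∧
    (Mem x b q p ∨ ∃ w, w ≤ b0 ∧ ∃ y, y = e.ev w ∧ x = e3 (e.code : N) w y) := hrs
  have i1 : ∀ x, Mem x b q p → Mem x (b + e3 (e.code : N) b0 d) r s := fun x hx =>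
    (hrs x).2 ⟨hx.1.trans le_self_add, Or.inl hx⟩
  refine ⟨b + e3 (e.code : N) b0 d, r, s, corr_mk fun i w y hm => ?_, fun w hw => ?_⟩
  · rcases ((hrs _).1 hm).2 with h1 | ⟨w', hw', y', rfl, h1⟩
    · exact (h.j h1).mono i1
    · obtain ⟨rfl, rfl, rfl⟩ := e3_inj.1 h1
      exact (hj w hw').mono i1
  · refine (hrs _).2 ⟨le_trans ?_ le_add_self, Or.inr ⟨w, hw, _, rfl, rfl⟩⟩
    exact pr_mono (pr_mono le_rfl hw) (hd w hw)

theorem corr_empty : ∃ b q p : N, Corr b q p := by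
  obtain ⟨r, s, hrs⟩ := dcomp (M := fun _ : Unit => N) (m := 0) (fun _ v x => False) (i := ()) ![] 0
  exact ⟨0, r, s, corr_mk fun i w y hm => ((hrs _).1 hm).2.elim⟩

theorem corr_complete (e : Expr) : ∀ b0 : N, ∃ b q p, Corr b q p ∧
    ∀ w, w ≤ b0 → Mem (e3 (e.code : N) w (e.ev w)) b q p := by
  induction e with
  | op o =>
    intro b0
    obtain ⟨b, q, p, h⟩ := corr_empty (N := N)
    refine corr_ext h _ b0 fun w _ => Or.inl ⟨o.code, ?_, ?_⟩
    · rw [Expr.code, pr_cast, Nat.cast_zero]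
    · rw [OpG_iff, Expr.ev]
  | comp k l ihk ihl =>
    intro b0
    obtain ⟨c, hc⟩ := ev_bound l b0
    obtain ⟨b, q, p, h, hk⟩ := ihk c
    obtain ⟨b', q', p', h', hl⟩ := ihl b0
    obtain ⟨_, _, _, h3, h4, h5⟩ := corr_union h h'
    refine corr_ext h3 _ b0 fun w hw => Or.inr (Or.inl ⟨k.code, l.code, ?_, l.ev w, h5 _ (hl w hw), ?_⟩)
    · rw [Expr.code, pr_cast, pr_cast, Nat.cast_one]
    · rw [Expr.ev]; exact h4 _ (hk _ (hc w hw))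
  | pair k l ihk ihl =>
    intro b0
    obtain ⟨b, q, p, h, hk⟩ := ihk b0
    obtain ⟨b', q', p', h', hl⟩ := ihl b0
    obtain ⟨_, _, _, h3, h4, h5⟩ := corr_union h h'
    refine corr_ext h3 _ b0 fun w hw => Or.inr (Or.inr (Or.inl
      ⟨k.code, l.code, ?_, k.ev w, l.ev w, h4 _ (hk w hw), h5 _ (hl w hw), ?_⟩))
    · rw [Expr.code, pr_cast, pr_cast, Nat.cast_ofNat]
    · rw [Expr.ev]
  | ball k ih =>
    intro b0
    obtain ⟨b, q, p, h, hk⟩ := ih (pr b0 b0)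
    refine corr_ext h _ b0 fun w hw => Or.inr (Or.inr (Or.inr ⟨k.code, ?_, ?_⟩))
    · rw [Expr.code, pr_cast, Nat.cast_ofNat]
    · have hb : ∀ x, x ≤ p2 w → pr (p1 w) x ≤ pr b0 b0 := fun x hx =>
        pr_mono ((UnP.spec w).le.1.trans hw) (hx.trans ((UnP.spec w).le.2.trans hw))
      by_cases hx : ∀ x, x ≤ p2 w → k.ev (pr (p1 w) x) = 1
      · refine Or.inl ⟨by rw [Expr.ev, if_pos hx], fun x hx' => ?_⟩
        have := hk _ (hb x hx')
        rwa [hx x hx'] at this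
      · have hx0 := hx
        push Not at hx
        obtain ⟨x, hx', hne⟩ := hx
        exact Or.inr ⟨by rw [Expr.ev, if_neg hx0], x, hx', _, hne, hk _ (hb x hx')⟩

/-- Partial truth predicate for negated bounded formulas. -/
def SatM (e w : N) : Prop := ∃ b q p, Corr b q p ∧ ∃ z, z ≤ b ∧ z ≠ 1 ∧ Mem (e3 e w z) b q p

theorem SatM_iff (e : Expr) (w : N) : SatM (e.code : N) w ↔ e.ev w ≠ 1 := by
  constructor
  · rintro ⟨b, q, p, h, z, _, hz, hm⟩
    rwa [← h.sound e w z hm]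
  · intro h
    obtain ⟨b, q, p, h1, h2⟩ := corr_complete e w
    exact ⟨b, q, p, h1, e.ev w, (e3_le _ _ _).2.2.trans (h2 w le_rfl).1, h, h2 w le_rfl⟩

/-- Partial truth predicates: `Sat k` is universal for `Σ_{k+1}`. -/
def Sat : ℕ → N → N → Prop
  | 0, e, w => ∃ x, SatM e (pr w x)
  | k + 1, e, w => ∃ x, ¬ Sat k e (pr w x)

/-- Coding of tuples. -/
def stk : ∀ {m : ℕ}, (Fin m → N) → N
  | 0, _ => 0
  | m + 1, v => pr (stk (fun j : Fin m => v (Fin.castSucc j))) (v (Fin.last m))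

theorem stk_snoc {m : ℕ} (v : Fin m → N) (x : N) : stk (Fin.snoc v x : Fin (m + 1) → N) = pr (stk v) x := by
  simp only [stk, Fin.snoc_castSucc, Fin.snoc_last]

end Complete

section SatDef
universe u
variable {ι : Type u} {M : ι → Type} [∀ i, PAM (M i)] {m : ℕ}

instance Sg.not {k : ℕ} (A : ∀ i, (Fin m → M i) → Prop) [hA : Sg k A] :
    Sg (k + 1) (fun i v => ¬ A i v) := ⟨hA.p.not_up⟩

theorem Sg.sat_aux (k : ℕ) : Sg (k + 1) (fun i (v : Fin 2 → M i) => Sat k (v 0) (v 1)) := by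
  induction k with
  | zero => unfold Sat SatM; infer_instance
  | succ k ih =>
    have h := Sg.sub (m := 3) _ ih ![fun i (v : Fin 3 → M i) => v 0, fun i v => pr (v 1) (v 2)]
      (by
        intro j; fin_cases j
        · exact Tm.var 0
        · exact Tm.pr (fun i (v : Fin 3 → M i) => v 1) (fun i v => v 2))
    have h' : Sg (k + 1) (fun i (v : Fin 3 → M i) => Sat k (v 0) (pr (v 1) (v 2))) := h
    exact @Sg.exi _ M _ _ _ (fun i (v : Fin 2 → M i) x => ¬ Sat k (v 0) (pr (v 1) x)) (Sg.not _ (hA := h'))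

instance Sg.sat (k : ℕ) (f g : ∀ i, (Fin m → M i) → M i) [hf : Tm f] [hg : Tm g] :
    Sg (k + 1) (fun i v => Sat k (f i v) (g i v)) :=
  Sg.sub _ (Sg.sat_aux k) ![f, g] (by intro j; fin_cases j <;> assumption)

theorem Tm.stk {a : ℕ} : ∀ (g : Fin a → ∀ i, (Fin m → M i) → M i) (hg : ∀ j, Tm (g j)),
    Tm (fun i v => stk (fun j => g j i v)) := by
  induction a with
  | zero => intro g hg; exact Tm.zero
  | succ a ih =>
    intro g hg
    have := ih (fun j => g (Fin.castSucc j)) (fun j => hg _)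
    have := hg (Fin.last a)
    unfold Guaspari.stk
    infer_instance

/-- Expressions realizing a term. -/
theorem expr_term (t : LA.Term (Empty ⊕ Fin m)) : ∃ e : Expr, ∀ i (v : Fin m → M i),
    e.ev (stk v) = t.realize (Sum.elim default v) := by
  induction t with
  | var a =>
    rcases a with a | a
    · exact a.elim
    · have : ∀ {m : ℕ} (a : Fin m), ∃ e : Expr, ∀ i (v : Fin m → M i), e.ev (Guaspari.stk v) = v a := by
        intro m
        induction m with
        | zero => exact fun a => a.elim0
        | succ m ih =>
          intro a
          refine Fin.lastCases ?_ (fun a => ?_) a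
          · exact ⟨.op .snd, fun i v => by simp [Expr.ev, Op.ev, Guaspari.stk]⟩
          · obtain ⟨e, he⟩ := ih a
            exact ⟨.comp e (.op .fst), fun i v => by simp [Expr.ev, Op.ev, Guaspari.stk, he]⟩
      obtain ⟨e, he⟩ := this a
      exact ⟨e, fun i v => by rw [he]; rfl⟩
  | @func l f ts ih =>
    match l, f, ts, ih with
    | 0, f, ts, ih =>
      refine ⟨.op .zero, fun i v => ?_⟩
      have : (Term.func f ts).realize (Sum.elim default v) = rz (M i) := by
        rw [Term.realize_func]; unfold rz; congr 1; exact Subsingleton.elim _ _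
      rw [this, PAM.r_zero]; rfl
    | 1, f, ts, ih =>
      obtain ⟨e, he⟩ := ih 0
      refine ⟨.comp (.op .succ) e, fun i v => ?_⟩
      have : (Term.func f ts).realize (Sum.elim default v) = rs ((ts 0).realize (Sum.elim default v)) := by
        rw [Term.realize_func]; unfold rs; congr 1; funext j; rw [Subsingleton.elim j 0]; rfl
      rw [this, PAM.r_succ, ← he]; rfl
    | 2, false, ts, ih =>
      obtain ⟨e, he⟩ := ih 0
      obtain ⟨e', he'⟩ := ih 1
      refine ⟨.comp (.op .add) (.pair e e'), fun i v => ?_⟩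
      have : (Term.func (show LA.Functions 2 from false) ts).realize (Sum.elim default v) =
          ra ((ts 0).realize (Sum.elim default v)) ((ts 1).realize (Sum.elim default v)) := by
        rw [Term.realize_func]; unfold ra; congr 1; funext j; fin_cases j <;> rfl
      refine Eq.trans ?_ this.symm
      rw [PAM.r_add, ← he, ← he']; simp [Expr.ev, Op.ev]
    | 2, true, ts, ih =>
      obtain ⟨e, he⟩ := ih 0
      obtain ⟨e', he'⟩ := ih 1
      refine ⟨.comp (.op .mul) (.pair e e'), fun i v => ?_⟩
      have : (Term.func (show LA.Functions 2 from true) ts).realize (Sum.elim default v) =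
          rm ((ts 0).realize (Sum.elim default v)) ((ts 1).realize (Sum.elim default v)) := by
        rw [Term.realize_func]; unfold rm; congr 1; funext j; fin_cases j <;> rfl
      refine Eq.trans ?_ this.symm
      rw [PAM.r_mul, ← he, ← he']; simp [Expr.ev, Op.ev]
    | l + 3, f, ts, ih => exact f.elim

theorem stk_snoc' {N : Type} [PAM N] {m : ℕ} (v : Fin m → N) (x : N) :
    pr (Guaspari.stk v) x = Guaspari.stk (Fin.snoc v x : Fin (m + 1) → N) := (stk_snoc v x).symm

theorem ev_bool {N : Type} [PAM N] {P : Prop} [Decidable P] : (if P then (1 : N) else 0) = 1 ↔ P := by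
  split_ifs with h <;> simp [h]

theorem ev_imp1 {N : Type} [PAM N] (k l : Expr) (w : N) :
    (Expr.comp (.op .imp) (.pair k l)).ev w = 1 ↔ (k.ev w = 1 → l.ev w = 1) := by
  have h : ∀ z : N, Op.imp.ev z = 1 ↔ (p1 z = 1 → p2 z = 1) := fun z => by
    rw [Op.ev]; exact ev_bool
  rw [Expr.ev, Expr.ev, h, Expr.ev, p1_pr, p2_pr]
theorem ev_ball1 {N : Type} [PAM N] (k l : Expr) (w : N) :
    (Expr.comp (.ball k) (.pair (.op .ident) l)).ev w = 1 ↔ ∀ x, x ≤ l.ev w → k.ev (pr w x) = 1 := by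
  have h : ∀ z : N, (Expr.ball k).ev z = 1 ↔ (∀ x, x ≤ p2 z → k.ev (pr (p1 z) x) = 1) := fun z => by
    rw [Expr.ev]; exact @ev_bool _ _ _ (_)
  rw [Expr.ev, h, Expr.ev, p1_pr, p2_pr]; rfl

theorem real_wk (t : LA.Term (Empty ⊕ Fin m)) {i : ι} (v : Fin m → M i) (x : M i) :
    (t.relabel (Sum.map id Fin.castSucc)).realize (Sum.elim default (Fin.snoc v x : Fin (m + 1) → M i)) =
      t.realize (Sum.elim (default : Empty → M i) v) := by
  rw [Term.realize_relabel]
  congr 1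
  funext j
  rcases j with j | j
  · exact j.elim
  · simp

/-- Expressions realizing a bounded formula. -/
theorem expr_d0 {φ : LA.BoundedFormula Empty m} (h : IsDelta0 φ) : ∃ e : Expr, ∀ i (v : Fin m → M i),
    e.ev (Guaspari.stk v) = 1 ↔ φ.Realize default v := by
  induction h with
  | falsum => exact ⟨.op .zero, fun i v => by simp [Expr.ev, Op.ev, BoundedFormula.Realize]⟩
  | equal t u =>
    obtain ⟨e, he⟩ := expr_term (M := M) t
    obtain ⟨e', he'⟩ := expr_term (M := M) u
    refine ⟨.comp (.op .eq) (.pair e e'), fun i v => ?_⟩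
    simp only [Expr.ev, Op.ev, p1_pr, p2_pr, ev_bool, he, he', BoundedFormula.realize_bdEqual]
  | le t u =>
    obtain ⟨e, he⟩ := expr_term (M := M) t
    obtain ⟨e', he'⟩ := expr_term (M := M) u
    refine ⟨.comp (.op .le) (.pair e e'), fun i v => ?_⟩
    simp only [Expr.ev, Op.ev, p1_pr, p2_pr, ev_bool, he, he', real_leF, PAM.r_le]
  | imp _ _ ih ih' =>
    obtain ⟨e, he⟩ := ih
    obtain ⟨e', he'⟩ := ih'
    refine ⟨.comp (.op .imp) (.pair e e'), fun i v => ?_⟩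
    rw [ev_imp1, he, he', BoundedFormula.realize_imp]
  | ball t _ ih =>
    obtain ⟨k, hk⟩ := ih
    obtain ⟨e, he⟩ := expr_term (M := M) t
    refine ⟨.comp (.ball k) (.pair (.op .ident) e), fun i v => ?_⟩
    rw [ev_ball1]
    simp only [he, stk_snoc', hk, BoundedFormula.realize_all,
      BoundedFormula.realize_imp, real_leF, PAM.r_le, real_wk, real_vT, Fin.snoc_last]
  | bex t _ ih =>
    obtain ⟨k, hk⟩ := ih
    obtain ⟨e, he⟩ := expr_term (M := M) t
    refine ⟨.comp (.op .imp) (.pair (.comp (.ball (.comp (.op .imp) (.pair k (.op .zero))))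
      (.pair (.op .ident) e)) (.op .zero)), fun i v => ?_⟩
    rw [ev_imp1, ev_ball1]
    simp only [ev_imp1]
    simp only [Expr.ev, Op.ev, he, stk_snoc', hk, BoundedFormula.realize_ex,
      BoundedFormula.realize_inf, real_leF, PAM.r_le, real_wk, real_vT, Fin.snoc_last, zero_ne_one]
    simp

/-- Universality of the partial truth predicates. -/
theorem sat_univ : ∀ {k m : ℕ} {R : ∀ i, (Fin m → M i) → Prop} (h : SgP (k + 1) R),
    ∃ e : ℕ, ∀ i v, R i v ↔ Sat k (e : M i) (Guaspari.stk v) := by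
  intro k
  induction k with
  | zero =>
    rintro m R ⟨S, hS, hR⟩
    obtain ⟨φ, hφ, hS'⟩ := (show D0 S from hS).ex
    obtain ⟨e, he⟩ := expr_d0 (M := M) hφ
    refine ⟨e.code, fun i v => ?_⟩
    rw [hR]
    simp only [Sat, SatM_iff, stk_snoc', ne_eq, he, hS']
  | succ k ih =>
    rintro m R ⟨S, hS, hR⟩
    obtain ⟨e, he⟩ := ih hS
    refine ⟨e, fun i v => ?_⟩
    rw [hR]
    simp only [Sat, stk_snoc', ← he]

end SatDef

section RecDef
variable {m : ℕ}

/-- The constant family with value the standard model. -/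
abbrev NF : Unit → Type := fun _ => ℕ

theorem npair_iff (p a b : ℕ) : p = Nat.pair a b ↔ (a < b ∧ p = b * b + a) ∨ (¬ a < b ∧ p = a * a + a + b) := by
  unfold Nat.pair; split_ifs with h <;> simp [h]

instance D0.npair (p a b : ∀ i, (Fin m → NF i) → NF i) [hp : Tm p] [ha : Tm a] [hb : Tm b] :
    D0 (M := NF) (fun i v => p i v = Nat.pair (a i v) (b i v)) := by
  have : D0 (M := NF) (fun i v => (a i v < b i v ∧ p i v = b i v * b i v + a i v) ∨
    (¬ a i v < b i v ∧ p i v = a i v * a i v + a i v + b i v)) := inferInstance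
  exact this.congr fun i v => npair_iff _ _ _

/-- A partial function with `Σ_1` graph. -/
def GrS (f : ℕ →. ℕ) : Prop := Sg (M := NF) 1 (fun _ (v : Fin 2 → ℕ) => v 1 ∈ f (v 0))

theorem GrS.sg {f : ℕ →. ℕ} (h : GrS f) (x y : ∀ i, (Fin m → NF i) → NF i) [hx : Tm x] [hy : Tm y] :
    Sg (M := NF) 1 (fun i v => y i v ∈ f (x i v)) :=
  Sg.sub _ h ![x, y] (by intro j; fin_cases j <;> assumption)

theorem GrS.mk' {f : ℕ →. ℕ} {R : ℕ → ℕ → Prop} (hR : Sg (M := NF) 1 (fun _ (v : Fin 2 → ℕ) => R (v 0) (v 1)))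
    (h : ∀ x y, y ∈ f x ↔ R x y) : GrS f :=
  hR.congr fun i v => h _ _

/-- The recursion operator. -/
theorem prec_mem (f g : ℕ →. ℕ) (a n y : ℕ) :
    y ∈ (n.rec (f a) fun y IH => IH >>= fun i => g (Nat.pair a (Nat.pair y i)) : Part ℕ) ↔
    ∃ b q p : ℕ, Mem (pr n y) b q p ∧ ∀ j, j ≤ n → ∀ z, z ≤ b → Mem (pr j z) b q p →
      (j = 0 ∧ z ∈ f a) ∨ ∃ k, k ≤ j ∧ j = k + 1 ∧ ∃ z', z' ≤ b ∧ Mem (pr k z') b q p ∧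
        ∃ s, s = Nat.pair k z' ∧ ∃ t, t = Nat.pair a s ∧ z ∈ g t := by
  constructor
  · induction n generalizing y with
    | zero =>
      intro h
      obtain ⟨q, p, hqp⟩ := dcomp (M := NF) (m := 1) (fun _ v x => x = pr 0 (v 0)) (i := ()) ![y] (pr 0 y)
      have hqp : ∀ x, Mem x (pr 0 y) q p ↔ x ≤ pr 0 y ∧ x = pr 0 y := hqp
      refine ⟨_, q, p, (hqp _).2 ⟨le_rfl, rfl⟩, fun j _ z _ hm => Or.inl ?_⟩
      obtain ⟨rfl, rfl⟩ := pr_inj.1 ((hqp _).1 hm).2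
      exact ⟨rfl, h⟩
    | succ n ih =>
      intro h
      simp only [Part.bind_eq_bind, Part.mem_bind_iff] at h
      obtain ⟨z, hz, hy⟩ := h
      obtain ⟨b, q, p, h1, h2⟩ := ih z hz
      obtain ⟨q', p', hqp⟩ := dcomp (M := NF) (m := 5)
        (fun _ v x => (∃ j, j ≤ v 3 ∧ ∃ z, z ≤ v 0 ∧ x = pr j z ∧ Mem x (v 0) (v 1) (v 2)) ∨ x = pr (v 3 + 1) (v 4))
        (i := ()) ![b, q, p, n, y] (b + pr (n + 1) y)
      have hqp : ∀ x, Mem x (b + pr (n + 1) y) q' p' ↔ x ≤ b + pr (n + 1) y ∧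
        ((∃ j, j ≤ n ∧ ∃ z, z ≤ b ∧ x = pr j z ∧ Mem x b q p) ∨ x = pr (n + 1) y) := hqp
      have i1 : ∀ j z, j ≤ n → Mem (pr j z) b q p → Mem (pr j z) (b + pr (n + 1) y) q' p' := fun j z hj hx =>
        (hqp _).2 ⟨hx.1.trans le_self_add, Or.inl ⟨j, hj, z, (snd_le_pr _ _).trans hx.1, rfl, hx⟩⟩
      have i2 : Mem (pr (n + 1) y) (b + pr (n + 1) y) q' p' := (hqp _).2 ⟨le_add_self, Or.inr rfl⟩
      refine ⟨_, q', p', i2, fun j hj z' hz' hm => ?_⟩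
      rcases ((hqp _).1 hm).2 with ⟨j', hj', w, hw, h3, h4⟩ | h3
      · obtain ⟨rfl, rfl⟩ := pr_inj.1 h3
        rcases h2 _ hj' _ hw h4 with h5 | ⟨k, hk, h5, u, hu, h6, h7⟩
        · exact Or.inl h5
        · exact Or.inr ⟨k, hk, h5, u, hu.trans le_self_add, i1 _ _ (by omega) h6, h7⟩
      · obtain ⟨rfl, rfl⟩ := pr_inj.1 h3
        exact Or.inr ⟨n, by omega, rfl, z, ((snd_le_pr _ _).trans h1.1).trans le_self_add, i1 _ _ le_rfl h1,
          _, rfl, _, rfl, hy⟩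
  · rintro ⟨b, q, p, h1, h2⟩
    have : ∀ j, j ≤ n → ∀ z, Mem (pr j z) b q p →
        z ∈ (j.rec (f a) fun y IH => IH >>= fun i => g (Nat.pair a (Nat.pair y i)) : Part ℕ) := by
      intro j
      induction j with
      | zero =>
        intro hj z hz
        rcases h2 0 hj z ((snd_le_pr _ _).trans hz.1) hz with h3 | ⟨k, _, h3, _⟩
        · exact h3.2
        · omega
      | succ j ih =>
        intro hj z hz
        rcases h2 _ hj z ((snd_le_pr _ _).trans hz.1) hz with h3 | ⟨k, _, h3, u, _, h4, _, rfl, _, rfl, h5⟩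
        · omega
        · obtain rfl : j = k := by omega
          simp only [Part.bind_eq_bind, Part.mem_bind_iff]
          exact ⟨u, ih (by omega) u h4, h5⟩
    exact this n le_rfl y h1

theorem GrS.of_partrec {f : ℕ →. ℕ} (hf : Nat.Partrec f) : GrS f := by
  induction hf with
  | zero => exact GrS.mk' (R := fun x y => y = 0) inferInstance (fun x y => by simp [pure, PFun.pure])
  | succ => exact GrS.mk' (R := fun x y => y = x + 1) inferInstance (fun x y => by simp)
  | left =>
    refine GrS.mk' (R := fun x y => ∃ z, x = Nat.pair y z) inferInstance (fun x y => ?_)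
    simp only [PFun.coe_val, Part.mem_some_iff]
    exact ⟨fun h => ⟨x.unpair.2, by rw [h, Nat.pair_unpair]⟩, fun ⟨z, h⟩ => by rw [h, Nat.unpair_pair]⟩
  | right =>
    refine GrS.mk' (R := fun x y => ∃ z, x = Nat.pair z y) inferInstance (fun x y => ?_)
    simp only [PFun.coe_val, Part.mem_some_iff]
    exact ⟨fun h => ⟨x.unpair.1, by rw [h, Nat.pair_unpair]⟩, fun ⟨z, h⟩ => by rw [h, Nat.unpair_pair]⟩
  | @pair f g _ _ ihf ihg =>
    have h1 := fun {m} => @GrS.sg m f ihf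
    have h2 := fun {m} => @GrS.sg m g ihg
    refine GrS.mk' (R := fun x y => ∃ a, a ∈ f x ∧ ∃ b, b ∈ g x ∧ y = Nat.pair a b) inferInstance (fun x y => ?_)
    simp [Seq.seq, eq_comm]
  | @comp f g _ _ ihf ihg =>
    have h1 := fun {m} => @GrS.sg m f ihf
    have h2 := fun {m} => @GrS.sg m g ihg
    refine GrS.mk' (R := fun x y => ∃ a, a ∈ g x ∧ y ∈ f a) inferInstance (fun x y => ?_)
    exact Part.mem_bind_iff
  | @prec f g _ _ ihf ihg =>
    have h1 := fun {m} => @GrS.sg m f ihf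
    have h2 := fun {m} => @GrS.sg m g ihg
    refine GrS.mk' (R := fun x y => ∃ a n, x = Nat.pair a n ∧ ∃ b q p : ℕ, Mem (pr n y) b q p ∧ ∀ j, j ≤ n → ∀ z, z ≤ b → Mem (pr j z) b q p →
      (j = 0 ∧ z ∈ f a) ∨ ∃ k, k ≤ j ∧ j = k + 1 ∧ ∃ z', z' ≤ b ∧ Mem (pr k z') b q p ∧
        ∃ s, s = Nat.pair k z' ∧ ∃ t, t = Nat.pair a s ∧ z ∈ g t) inferInstance (fun x y => ?_)
    simp only [← prec_mem]
    constructor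
    · intro h
      exact ⟨x.unpair.1, x.unpair.2, (Nat.pair_unpair x).symm, h⟩
    · rintro ⟨a, n, rfl, h⟩
      simpa [Nat.unpaired] using h
  | @rfind f _ ihf =>
    have h1 := fun {m} => @GrS.sg m f ihf
    refine GrS.mk' (R := fun x y => (∃ s, s = Nat.pair x y ∧ 0 ∈ f s) ∧ ∀ j, j < y → ∃ s, s = Nat.pair x j ∧
      ∃ c, c ∈ f s ∧ c ≠ 0) inferInstance (fun x y => ?_)
    refine Iff.trans (Nat.mem_rfind (p := fun n => (fun m => m = 0) <$> f (Nat.pair x n))) ?_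
    simp [eq_comm]

/-- Recursively enumerable predicates are `Σ_1`. -/
theorem sg_of_computable {p : ℕ → Prop} (h : ComputablePred p) (x : ∀ i, (Fin m → NF i) → NF i) [hx : Tm x] :
    Sg (M := NF) 1 (fun i v => p (x i v)) := by
  have h1 : Nat.Partrec _ := h.to_re
  have h2 := fun {m} => @GrS.sg m _ (GrS.of_partrec h1)
  have : Sg (M := NF) 1 (fun i v => ∃ y, y ∈ (fun n => Part.bind (Encodable.decode n : Option ℕ) fun a =>
      (Part.assert (p a) fun _ => Part.some ()).map Encodable.encode) (x i v)) := by
    have := hx.wk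
    infer_instance
  refine this.congr fun i v => ?_
  simp [Part.mem_bind_iff]

/-- Primitive recursive binary functions have `Σ_1` graphs. -/
theorem sg_of_primrec {f : ℕ → ℕ → ℕ} (h : Primrec₂ f) (x y z : ∀ i, (Fin m → NF i) → NF i)
    [hx : Tm x] [hy : Tm y] [hz : Tm z] :
    Sg (M := NF) 1 (fun i v => z i v = f (x i v) (y i v)) := by
  have h0 : Primrec (fun n : ℕ => f n.unpair.1 n.unpair.2) :=
    h.comp (Primrec.fst.comp Primrec.unpair) (Primrec.snd.comp Primrec.unpair)
  have h1 := Nat.Partrec.of_primrec (Primrec.nat_iff.1 h0)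
  have h2 := fun {m} => @GrS.sg m _ (GrS.of_partrec h1)
  have : Sg (M := NF) 1 (fun i v => ∃ s, s = Nat.pair (x i v) (y i v) ∧ z i v ∈
      ((fun n : ℕ => f n.unpair.1 n.unpair.2 : ℕ → ℕ) : ℕ →. ℕ) s) := by
    have := hx.wk
    have := hy.wk
    have := hz.wk
    infer_instance
  refine this.congr fun i v => ?_
  simp

end RecDef

section Clauses
variable {m : ℕ}

/-- Satisfaction of a coded clause. -/
def SatC (ρ : ℕ → Prop) (c : ℕ) : Prop :=
  ρ (p1 (p1 c)) → ρ (p1 (p2 (p1 c))) → ρ (p2 (p2 (p1 c))) → ρ (p1 (p2 c)) ∨ ρ (p2 (p2 c))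

/-- Clause code. -/
def clc (p q r s t : ℕ) : ℕ := pr (pr p (pr q r)) (pr s t)

theorem SatC_clc (ρ : ℕ → Prop) (p q r s t : ℕ) :
    SatC ρ (clc p q r s t) ↔ (ρ p → ρ q → ρ r → ρ s ∨ ρ t) := by
  simp [SatC, clc]

instance Tm.clc (p q r s t : ∀ i, (Fin m → NF i) → NF i) [hp : Tm p] [hq : Tm q] [hr : Tm r] [hs : Tm s] [ht : Tm t] :
    Tm (M := NF) (fun i v => (clc (p i v) (q i v) (r i v) (s i v) (t i v) : ℕ)) := by
  unfold Guaspari.clc; infer_instance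

/-- Conditions on assignments given by a `Σ_1` set of clauses. -/
class CF (G : ∀ i, (Fin m → NF i) → (ℕ → Prop) → Prop) : Prop where
  ex : ∃ R : ∀ i, (Fin m → NF i) → ℕ → Prop,
    Sg (M := NF) 1 (fun i (w : Fin (m + 1) → NF i) => R i (fun j => w (Fin.castSucc j)) (w (Fin.last m))) ∧
    ∀ i v (ρ : ℕ → Prop), ρ 1 → ¬ ρ 0 → (G i v ρ ↔ ∀ p q r s t, R i v (clc p q r s t) → ρ p → ρ q → ρ r → ρ s ∨ ρ t)

theorem clc_inj {p q r s t p' q' r' s' t' : ℕ} (h : clc p q r s t = clc p' q' r' s' t') :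
    p = p' ∧ q = q' ∧ r = r' ∧ s = s' ∧ t = t' := by
  simp only [clc, pr_inj] at h; tauto

theorem CF.base (p q r s t : ∀ i, (Fin m → NF i) → NF i) (hp : Tm p) (hq : Tm q) (hr : Tm r) (hs : Tm s) (ht : Tm t)
    (G : ∀ i, (Fin m → NF i) → (ℕ → Prop) → Prop)
    (h : ∀ i v (ρ : ℕ → Prop), ρ 1 → ¬ ρ 0 → (G i v ρ ↔ (ρ (p i v) → ρ (q i v) → ρ (r i v) → ρ (s i v) ∨ ρ (t i v)))) :
    CF G := by
  refine ⟨fun i v c => c = Guaspari.clc (p i v) (q i v) (r i v) (s i v) (t i v), ?_, fun i v ρ h1 h0 => ?_⟩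
  · have := hp.wk
    have := hq.wk
    have := hr.wk
    have := hs.wk
    have := ht.wk
    infer_instance
  · rw [h i v ρ h1 h0]
    constructor
    · intro h p q r s t hc
      obtain ⟨rfl, rfl, rfl, rfl, rfl⟩ := clc_inj hc
      exact h
    · intro h; exact h _ _ _ _ _ rfl

instance CF.b0 (s : ∀ i, (Fin m → NF i) → NF i) [hs : Tm s] : CF (fun i v ρ => ρ (s i v)) :=
  CF.base (fun _ _ => (1 : ℕ)) (fun _ _ => (1 : ℕ)) (fun _ _ => (1 : ℕ)) s s inferInstance inferInstance inferInstance hs hs _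
    (fun i v ρ h1 h0 => by tauto)
instance CF.b1 (p s : ∀ i, (Fin m → NF i) → NF i) [hp : Tm p] [hs : Tm s] : CF (fun i v ρ => ρ (p i v) → ρ (s i v)) :=
  CF.base p p p s s hp hp hp hs hs _
    (fun i v ρ h1 h0 => by tauto)
instance CF.b2 (p q s : ∀ i, (Fin m → NF i) → NF i) [hp : Tm p] [hq : Tm q] [hs : Tm s] :
    CF (fun i v ρ => ρ (p i v) → ρ (q i v) → ρ (s i v)) :=
  CF.base p p q s s hp hp hq hs hs _
    (fun i v ρ h1 h0 => by tauto)
instance CF.b3 (p q r s : ∀ i, (Fin m → NF i) → NF i) [hp : Tm p] [hq : Tm q] [hr : Tm r] [hs : Tm s] :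
    CF (fun i v ρ => ρ (p i v) → ρ (q i v) → ρ (r i v) → ρ (s i v)) :=
  CF.base p q r s s hp hq hr hs hs _
    (fun i v ρ h1 h0 => by tauto)
instance CF.b22 (p q s t : ∀ i, (Fin m → NF i) → NF i) [hp : Tm p] [hq : Tm q] [hs : Tm s] [ht : Tm t] :
    CF (fun i v ρ => ρ (p i v) → ρ (q i v) → ρ (s i v) ∨ ρ (t i v)) :=
  CF.base p p q s t hp hp hq hs ht _
    (fun i v ρ h1 h0 => by tauto)
instance CF.bn (p : ∀ i, (Fin m → NF i) → NF i) [hp : Tm p] : CF (fun i v ρ => ¬ ρ (p i v)) :=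
  CF.base p p p (fun _ _ => (0 : ℕ)) (fun _ _ => (0 : ℕ)) hp hp hp inferInstance inferInstance _
    (fun i v ρ h1 h0 => by tauto)

instance CF.and (G H : ∀ i, (Fin m → NF i) → (ℕ → Prop) → Prop) [hG : CF G] [hH : CF H] :
    CF (fun i v ρ => G i v ρ ∧ H i v ρ) := by
  obtain ⟨R, hR, h⟩ := hG
  obtain ⟨S, hS, h'⟩ := hH
  refine ⟨fun i v c => R i v c ∨ S i v c, inferInstance, fun i v ρ h1 h0 => ?_⟩
  rw [h i v ρ h1 h0, h' i v ρ h1 h0]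
  constructor
  · rintro ⟨a, b⟩ p q r s t (hc | hc)
    exacts [a _ _ _ _ _ hc, b _ _ _ _ _ hc]
  · exact fun a => ⟨fun p q r s t hc => a _ _ _ _ _ (Or.inl hc), fun p q r s t hc => a _ _ _ _ _ (Or.inr hc)⟩

instance CF.cond (A : ∀ i, (Fin m → NF i) → Prop) (G : ∀ i, (Fin m → NF i) → (ℕ → Prop) → Prop) [hA : Sg (M := NF) 1 A] [hG : CF G] :
    CF (fun i v ρ => A i v → G i v ρ) := by
  obtain ⟨R, hR, h⟩ := hG
  have hA' : Sg (M := NF) 1 (fun i (w : Fin (m + 1) → NF i) => A i (fun j => w (Fin.castSucc j))) := ⟨hA.p.wk⟩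
  refine ⟨fun i v c => A i v ∧ R i v c, inferInstance, fun i v ρ h1 h0 => ?_⟩
  rw [h i v ρ h1 h0]
  constructor
  · rintro a p q r s t ⟨hc, hc'⟩
    exact a hc _ _ _ _ _ hc'
  · exact fun a hA p q r s t hc => a _ _ _ _ _ ⟨hA, hc⟩

instance CF.all (G : ∀ i, (Fin m → NF i) → NF i → (ℕ → Prop) → Prop)
    [hG : CF (fun i (w : Fin (m + 1) → NF i) => G i (fun j => w (Fin.castSucc j)) (w (Fin.last m)))] :
    CF (fun i v ρ => ∀ x, G i v x ρ) := by
  obtain ⟨R, hR, h⟩ := hG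
  refine ⟨fun i v c => ∃ x, R i (Fin.snoc v x : Fin (m + 1) → ℕ) c, ?_, fun i v ρ h1 h0 => ?_⟩
  · have h2 := Sg.sub (m := m + 2) _ hR _ (Tm.snoc (M := NF) _ (fun i (w : Fin (m + 2) → ℕ) => w (Fin.castSucc (Fin.last _)))
      (Tm.snoc (M := NF) (fun j i (w : Fin (m + 2) → ℕ) => w (Fin.castSucc (Fin.castSucc j)))
        (fun i w => w (Fin.last _)) (fun j => inferInstance) inferInstance) inferInstance)
    simp only [Fin.snoc_castSucc, Fin.snoc_last] at h2
    exact Sg.exi _ (hR := h2)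
  · have := fun x => h i (Fin.snoc v x) ρ h1 h0
    simp only [Fin.snoc_castSucc, Fin.snoc_last] at this
    constructor
    · rintro a p q r s t ⟨x, hc⟩
      exact (this x).1 (a x) _ _ _ _ _ hc
    · intro a x
      exact (this x).2 fun p q r s t hc => a _ _ _ _ _ ⟨x, hc⟩

theorem CF.congr {G G' : ∀ i, (Fin m → NF i) → (ℕ → Prop) → Prop} (hG : CF G) (h : ∀ i v ρ, G' i v ρ ↔ G i v ρ) : CF G' := by
  have : G' = G := by funext i v ρ; exact propext (h i v ρ)
  rwa [this]

theorem pr_pow : Primrec₂ (fun _ n : ℕ => 2 ^ n) := by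
  have : Primrec₂ (fun n y : ℕ => y * 2) := Primrec.nat_mul.comp Primrec.snd (Primrec.const 2)
  have h := Primrec.nat_rec (α := ℕ) (f := fun _ => 1) (g := fun _ p => p.2 * 2) (Primrec.const 1)
    (Primrec.nat_mul.comp (Primrec.snd.comp Primrec.snd) (Primrec.const 2))
  refine h.of_eq fun a n => ?_
  induction n with
  | zero => rfl
  | succ n ih => rw [pow_succ, ← ih]

theorem pr_bit : Primrec₂ (fun b p : ℕ => b / 2 ^ p % 2) :=
  Primrec.nat_mod.comp (Primrec.nat_div.comp Primrec.fst (pr_pow.comp (Primrec.const 0) Primrec.snd)) (Primrec.const 2)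

/-- Unsatisfiability of a `Σ_1` set of clauses is `Σ_1`. -/
theorem CF.sg (G : ∀ i, (Fin m → NF i) → (ℕ → Prop) → Prop) (hG : CF G) :
    Sg (M := NF) 1 (fun i v => ¬ ∃ ρ : ℕ → Prop, ρ 1 ∧ ¬ ρ 0 ∧ G i v ρ) := by
  obtain ⟨R, hR, h⟩ := hG
  have hb := fun {m : ℕ} => @sg_of_primrec m _ pr_bit
  have hw := fun {m : ℕ} => @sg_of_primrec m _ pr_pow
  have hRR : ∀ (a : ℕ) (f : Fin m → ∀ i, (Fin a → NF i) → NF i) (hf : ∀ j, Tm (f j))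
      (g : ∀ i, (Fin a → NF i) → NF i) [Tm g],
      Sg (M := NF) 1 (fun i v => R i (fun j => f j i v) (g i v)) := by
    intro a f hf g hg
    have h2 := Sg.sub (m := a) _ hR _ (Tm.snoc (M := NF) f g hf hg)
    simp only [Fin.snoc_castSucc, Fin.snoc_last] at h2
    exact h2
  have hR5 := hRR (m + 8) (fun j i v => v (Fin.castAdd 8 j)) inferInstance (fun i v => clc (v (Fin.natAdd m 3)) (v (Fin.natAdd m 4)) (v (Fin.natAdd m 5)) (v (Fin.natAdd m 6)) (v (Fin.natAdd m 7)))
  have key : Sg (M := NF) 1 (fun i v => ∃ n B, B = 2 ^ (n + 2) ∧ ∀ b, b < B → (1 = b / 2 ^ 0 % 2) ∨ (0 = b / 2 ^ 1 % 2) ∨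
      ∃ p, ∃ q, ∃ r, ∃ s, ∃ t, R i v (clc p q r s t) ∧
        (p < n ∧ q < n ∧ r < n ∧ s < n ∧ t < n) ∧ 1 = b / 2 ^ p % 2 ∧ 1 = b / 2 ^ q % 2 ∧ 1 = b / 2 ^ r % 2 ∧ 0 = b / 2 ^ s % 2 ∧ 0 = b / 2 ^ t % 2) := by
    have e1 := @hw (m + 2) (fun _ _ => (0 : ℕ)) (fun i w => w (Fin.castSucc (Fin.last m)) + 2) (fun i w => w (Fin.last (m + 1))) _ _ _
    have e2 := fun {a : ℕ} (x : ∀ i, (Fin a → NF i) → NF i) [Tm x] => @hb a x (fun _ _ => (0 : ℕ)) (fun _ _ => (1 : ℕ)) _ _ _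
    have e3 := fun {a : ℕ} (x : ∀ i, (Fin a → NF i) → NF i) [Tm x] => @hb a x (fun _ _ => (1 : ℕ)) (fun _ _ => (0 : ℕ)) _ _ _
    have e4 := fun {a : ℕ} (x y : ∀ i, (Fin a → NF i) → NF i) [Tm x] [Tm y] => @hb a x y (fun _ _ => (0 : ℕ)) _ _ _
    have e5 := fun {a : ℕ} (x y : ∀ i, (Fin a → NF i) → NF i) [Tm x] [Tm y] => @hb a x y (fun _ _ => (1 : ℕ)) _ _ _
    refine Sg.exi _ (hR := Sg.exi _ (hR := @Sg.and _ _ _ _ _ _ _ e1 (Sg.ballt _ _ (hR := @Sg.or _ _ _ _ _ _ _ (e2 _) (@Sg.or _ _ _ _ _ _ _ (e3 _)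
      (Sg.exi _ (hR := Sg.exi _ (hR := Sg.exi _ (hR := Sg.exi _ (hR := Sg.exi _ (hR := @Sg.and _ _ _ _ _ _ _ hR5 (@Sg.and _ _ _ _ _ _ _ inferInstance (@Sg.and _ _ _ _ _ _ _ (e5 _ _) (@Sg.and _ _ _ _ _ _ _ (e5 _ _) (@Sg.and _ _ _ _ _ _ _ (e5 _ _) (@Sg.and _ _ _ _ _ _ _ (e4 _ _) (e4 _ _)))))))))))))))))
  refine key.congr fun i v => ?_
  constructor
  · intro hu
    by_contra hn
    push Not at hn
    have hn' : ∀ n, ∃ b : ℕ, b / 2 ^ 0 % 2 ≠ 1 ∧ b / 2 ^ 1 % 2 ≠ 0 ∧ ∀ p q r s t, R i v (clc p q r s t) →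
        (p < n ∧ q < n ∧ r < n ∧ s < n ∧ t < n) → 1 = b / 2 ^ p % 2 → 1 = b / 2 ^ q % 2 → 1 = b / 2 ^ r % 2 →
        0 = b / 2 ^ s % 2 → 0 ≠ b / 2 ^ t % 2 := by
      intro n
      obtain ⟨b, _, h1, h2, h3⟩ := hn n _ rfl
      exact ⟨b, h1.symm, h2.symm, h3⟩
    choose b hb0 hb1 hb2 using hn'
    refine hu ⟨fun x => ∀ᶠ n in (Filter.hyperfilter ℕ : Filter ℕ), 1 = b n / 2 ^ x % 2, ?_, ?_, ?_⟩
    · exact Filter.Eventually.of_forall fun n => by have := hb1 n; omega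
    · rw [← Ultrafilter.eventually_not]
      exact Filter.Eventually.of_forall fun n => by have := hb0 n; omega
    · refine (h i v _ ?_ ?_).2 ?_
      · exact Filter.Eventually.of_forall fun n => by have := hb1 n; omega
      · rw [← Ultrafilter.eventually_not]
        exact Filter.Eventually.of_forall fun n => by have := hb0 n; omega
      intro p q r s t hc hp hq hr
      rw [← Ultrafilter.eventually_or]
      have hl : ∀ᶠ n in (Filter.hyperfilter ℕ : Filter ℕ), p + q + r + s + t < n :=
        Nat.hyperfilter_le_atTop (Filter.eventually_gt_atTop _)
      filter_upwards [hp, hq, hr, hl] with n hp hq hr hl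
      have := hb2 n p q r s t hc ⟨by omega, by omega, by omega, by omega, by omega⟩ hp hq hr
      omega
  · rintro ⟨n, _, rfl, hb⟩ ⟨ρ, h1, h0, hG⟩
    classical
    have hG := (h i v ρ h1 h0).1 hG
    have ht : ∀ x, x < n + 2 → (Nat.ofBits (fun j : Fin (n + 2) => decide (ρ j)) / 2 ^ x % 2 = 1 ↔ ρ x) := by
      intro x hx
      have := Nat.testBit_ofBits_lt (fun j : Fin (n + 2) => decide (ρ j)) x hx
      rw [Nat.testBit_eq_decide_div_mod_eq] at this
      simpa using this
    have ht' : ∀ x, x < n + 2 → 0 = Nat.ofBits (fun j : Fin (n + 2) => decide (ρ j)) / 2 ^ x % 2 → ¬ ρ x := by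
      intro x hx h
      rw [← ht x hx, ← h]; simp
    rcases hb _ (Nat.ofBits_lt_two_pow (fun j : Fin (n + 2) => decide (ρ j))) with h2 | h2 | ⟨p, q, r, s, t, hc, ⟨hp, hq, hr, hs, ht1⟩, a, b, c, d, e⟩
    · exact h0 ((ht 0 (by omega)).1 h2.symm)
    · exact ht' 1 (by omega) h2 h1
    · rcases hG p q r s t hc ((ht _ (by omega)).1 a.symm) ((ht _ (by omega)).1 b.symm) ((ht _ (by omega)).1 c.symm) with h3 | h3
      · exact ht' s (by omega) d h3
      · exact ht' t (by omega) e h3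
end Clauses

section Codes
open Encodable

/-- Code of a term. -/
def tc {k : ℕ} (t : LA.Term (Empty ⊕ Fin k)) : ℕ := encode t
/-- Code of a formula. -/
def fc {k : ℕ} (φ : LA.BoundedFormula Empty k) : ℕ := encode φ.listEncode

theorem gnum_eq (φ : Snt) : gnum φ = fc φ := rfl

theorem tc_inj {k : ℕ} {t u : LA.Term (Empty ⊕ Fin k)} (h : tc t = tc u) : t = u := encode_injective h

theorem fc_inj {k : ℕ} {φ ψ : LA.BoundedFormula Empty k} (h : fc φ = fc ψ) : φ = ψ := by
  have h1 : φ.listEncode = ψ.listEncode := encode_injective h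
  have h2 := BoundedFormula.listEncode_sigma_injective (a₁ := ⟨k, φ⟩) (a₂ := ⟨k, ψ⟩) h1
  simpa using h2

/-- Cons on list codes. -/
def cns (a l : ℕ) : ℕ := Nat.pair a l + 1
/-- Append on list codes. -/
def app (x y : ℕ) : ℕ := encode (Denumerable.ofNat (List ℕ) x ++ Denumerable.ofNat (List ℕ) y)

theorem app_primrec : Primrec₂ app := by
  have h : Primrec (Denumerable.ofNat (List ℕ)) := Primrec.ofNat (List ℕ)
  exact Primrec.encode.comp (Primrec.list_append.comp (h.comp Primrec.fst) (h.comp Primrec.snd))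

theorem enc_cons {α : Type} [Encodable α] (a : α) (l : List α) : encode (a :: l) = cns (encode a) (encode l) :=
  encode_list_cons a l
theorem enc_nil {α : Type} [Encodable α] : encode ([] : List α) = 0 := rfl

theorem enc_map {α : Type} [Encodable α] (l : List α) : encode (l.map encode) = encode l := by
  induction l with
  | nil => rfl
  | cons a l ih => rw [List.map_cons, enc_cons, enc_cons, ih]; rfl

theorem enc_app {α : Type} [Encodable α] (l l' : List α) : encode (l ++ l') = app (encode l) (encode l') := by
  rw [app, ← enc_map l, ← enc_map l', Denumerable.ofNat_encode, Denumerable.ofNat_encode, ← List.map_append, enc_map]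

/-- Symbol code of `0`. -/
def cZ : ℕ := 2 * encode (⟨0, Unit.unit⟩ : Σ i, LA.Functions i) + 1
/-- Symbol code of `S`. -/
def cS : ℕ := 2 * encode (⟨1, Unit.unit⟩ : Σ i, LA.Functions i) + 1
/-- Symbol code of `+`. -/
def cA : ℕ := 2 * encode (⟨2, false⟩ : Σ i, LA.Functions i) + 1
/-- Symbol code of `*`. -/
def cM : ℕ := 2 * encode (⟨2, true⟩ : Σ i, LA.Functions i) + 1
/-- Symbol code of `≤`. -/
def cR : ℕ := 2 * (2 * encode (⟨2, Unit.unit⟩ : Σ i, LA.Relations i)) + 1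

theorem tc_def {k : ℕ} (t : LA.Term (Empty ⊕ Fin k)) : tc t = encode t.listEncode := rfl

theorem tc_var {k : ℕ} (j : Fin k) : tc (vT j) = cns (4 * j + 2) 0 := by
  rw [tc_def, vT, Term.listEncode, enc_cons, enc_nil, encode_inl, encode_inr]
  congr 1
  have : encode j = (j : ℕ) := rfl
  rw [this]; omega

theorem tc_zero {k : ℕ} : tc (zeroT : LA.Term (Empty ⊕ Fin k)) = cns cZ 0 := by
  rw [tc_def, zeroT, Constants.term, Term.listEncode, enc_cons, encode_inr]
  rfl
theorem tc_succ {k : ℕ} (t : LA.Term (Empty ⊕ Fin k)) : tc (succT t) = cns cS (tc t) := by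
  rw [tc_def, succT, Functions.apply₁, Term.listEncode, enc_cons, encode_inr]
  have : (List.finRange 1).flatMap (fun i => (![t] i).listEncode) = t.listEncode := by simp [List.finRange_succ]
  rw [this]; rfl
theorem flat2 {k : ℕ} (t u : LA.Term (Empty ⊕ Fin k)) :
    (List.finRange 2).flatMap (fun i => (![t, u] i).listEncode) = t.listEncode ++ u.listEncode := by
  simp [List.finRange_succ]
theorem tc_add {k : ℕ} (t u : LA.Term (Empty ⊕ Fin k)) : tc (addT t u) = cns cA (app (tc t) (tc u)) := by
  rw [tc_def, addT, Functions.apply₂, Term.listEncode, enc_cons, encode_inr, flat2, enc_app]; rfl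
theorem tc_mul {k : ℕ} (t u : LA.Term (Empty ⊕ Fin k)) : tc (mulT t u) = cns cM (app (tc t) (tc u)) := by
  rw [tc_def, mulT, Functions.apply₂, Term.listEncode, enc_cons, encode_inr, flat2, enc_app]; rfl

theorem fc_falsum {k : ℕ} : fc (⊥ : LA.BoundedFormula Empty k) = cns (4 * k + 11) 0 := by
  show encode (BoundedFormula.listEncode (BoundedFormula.falsum)) = _
  rw [BoundedFormula.listEncode, enc_cons, enc_nil, encode_inr, encode_inr]
  congr 1
  have : encode (k + 2) = k + 2 := rfl
  rw [this]; omega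

/-- Code of an equation. -/
def eqc (k t u : ℕ) : ℕ := cns (2 * Nat.pair k t) (cns (2 * Nat.pair k u) 0)

theorem fc_eq {k : ℕ} (t u : LA.Term (Empty ⊕ Fin k)) : fc (t =' u : LA.BoundedFormula Empty k) = eqc k (tc t) (tc u) := by
  show encode (BoundedFormula.listEncode (BoundedFormula.equal t u)) = _
  rw [BoundedFormula.listEncode, enc_cons, enc_cons, enc_nil, encode_inl, encode_inl]
  rfl
theorem fc_le {k : ℕ} (t u : LA.Term (Empty ⊕ Fin k)) :
    fc (leF t u : LA.BoundedFormula Empty k) = cns cR (cns (4 * k + 3) (eqc k (tc t) (tc u))) := by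
  show encode (BoundedFormula.listEncode (BoundedFormula.rel _ _)) = _
  rw [BoundedFormula.listEncode]
  simp only [List.cons_append, List.nil_append, enc_cons, encode_inr, encode_inl]
  have h1 : encode k = k := rfl
  have h2 : 2 * (2 * k + 1) + 1 = 4 * k + 3 := by omega
  rw [h1, h2]
  simp [List.finRange_succ, enc_cons, enc_nil]
  rfl
theorem fc_imp {k : ℕ} (φ ψ : LA.BoundedFormula Empty k) : fc (φ ⟹ ψ) = cns 3 (app (fc φ) (fc ψ)) := by
  show encode (BoundedFormula.listEncode (BoundedFormula.imp _ _)) = _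
  rw [BoundedFormula.listEncode, List.cons_append, enc_cons, enc_app]; rfl
theorem fc_all {k : ℕ} (φ : LA.BoundedFormula Empty (k + 1)) : fc (∀' φ) = cns 7 (fc φ) := by
  show encode (BoundedFormula.listEncode (BoundedFormula.all _)) = _
  rw [BoundedFormula.listEncode, enc_cons]; rfl

theorem term_ind {k : ℕ} {P : LA.Term (Empty ⊕ Fin k) → Prop} (hv : ∀ j, P (vT j)) (hz : P zeroT)
    (hs : ∀ t, P t → P (succT t)) (ha : ∀ t u, P t → P u → P (addT t u)) (hm : ∀ t u, P t → P u → P (mulT t u))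
    (t : LA.Term (Empty ⊕ Fin k)) : P t := by
  induction t with
  | var j => rcases j with j | j; exacts [j.elim, hv j]
  | @func l f ts ih =>
    match l, f, ts, ih with
    | 0, f, ts, ih =>
      have : Term.func f ts = (zeroT : LA.Term (Empty ⊕ Fin k)) := by
        rw [zeroT, Constants.term]; congr; funext j; exact j.elim0
      rw [this]; exact hz
    | 1, f, ts, ih =>
      have : Term.func f ts = (succT (ts 0) : LA.Term (Empty ⊕ Fin k)) := by
        rw [succT, Functions.apply₁]; congr; funext j; fin_cases j; rfl
      rw [this]; exact hs _ (ih _)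
    | 2, f, ts, ih =>
      have h1 : ts = ![ts 0, ts 1] := by funext j; fin_cases j <;> rfl
      have : Term.func f ts = (addT (ts 0) (ts 1) : LA.Term (Empty ⊕ Fin k)) ∨ Term.func f ts = (mulT (ts 0) (ts 1)) := by
        rw [addT, mulT, Functions.apply₂, Functions.apply₂, ← h1]
        cases f
        · exact Or.inl rfl
        · exact Or.inr rfl
      rcases this with h | h <;> rw [h]
      exacts [ha _ _ (ih _) (ih _), hm _ _ (ih _) (ih _)]
    | (l + 3), f, ts, ih => exact Empty.elim f

theorem fml_ind {P : ∀ {k : ℕ}, LA.BoundedFormula Empty k → Prop} (hf : ∀ k, P (⊥ : LA.BoundedFormula Empty k))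
    (he : ∀ k (t u : LA.Term (Empty ⊕ Fin k)), P (t =' u : LA.BoundedFormula Empty k))
    (hl : ∀ k (t u : LA.Term (Empty ⊕ Fin k)), P (leF t u : LA.BoundedFormula Empty k))
    (hi : ∀ k (φ ψ : LA.BoundedFormula Empty k), P φ → P ψ → P (φ ⟹ ψ))
    (ha : ∀ k (φ : LA.BoundedFormula Empty (k + 1)), P φ → P (∀' φ))
    {k : ℕ} (φ : LA.BoundedFormula Empty k) : P φ := by
  induction φ with
  | falsum => exact hf _
  | equal t u => exact he _ t u
  | @rel n l R ts =>
    match l, R, ts with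
    | 0, R, ts => exact Empty.elim R
    | 1, R, ts => exact Empty.elim R
    | 2, R, ts =>
      have : BoundedFormula.rel R ts = (leF (ts 0) (ts 1) : LA.BoundedFormula Empty n) := by
        rw [leF, Relations.boundedFormula₂, Relations.boundedFormula]; congr; funext j; fin_cases j <;> rfl
      rw [this]; exact hl _ _ _
    | (l + 3), R, ts => exact Empty.elim R
  | imp φ ψ h1 h2 => exact hi _ _ _ h1 h2
  | all φ h => exact ha _ _ h

theorem tc_lift {k : ℕ} (t : LA.Term (Empty ⊕ Fin k)) :
    tc (t.relabel (Sum.map id Fin.castSucc) : LA.Term (Empty ⊕ Fin (k + 1))) = tc t := by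
  induction t using term_ind with
  | hv j => exact (tc_var (Fin.castSucc j)).trans (tc_var j).symm
  | hz => rw [tc_zero, ← tc_zero (k := k + 1)]; congr 1; simp [zeroT, Constants.term]; refine congrArg _ (funext fun j => j.elim0)
  | hs t ih => rw [tc_succ, ← ih, ← tc_succ]; congr 1; simp [succT, Functions.apply₁]; refine congrArg _ (funext fun j => ?_); fin_cases j; rfl
  | ha t u ih ih' => rw [tc_add, ← ih, ← ih', ← tc_add]; congr 1; simp [addT, Functions.apply₂]; refine congrArg _ (funext fun j => ?_); fin_cases j <;> rfl
  | hm t u ih ih' => rw [tc_mul, ← ih, ← ih', ← tc_mul]; congr 1; simp [mulT, Functions.apply₂]; refine congrArg _ (funext fun j => ?_); fin_cases j <;> rfl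

end Codes

section Henkin
variable {m : ℕ}

/-- Names. -/
abbrev nN (a : ℕ) : ℕ := pr 0 a
/-- Names. -/
abbrev nS (d : ℕ) : ℕ := pr 1 d
/-- Names. -/
abbrev nA (d e : ℕ) : ℕ := pr 2 (pr d e)
/-- Names. -/
abbrev nM (d e : ℕ) : ℕ := pr 3 (pr d e)
/-- Names of Henkin witnesses. -/
abbrev nW (f k a : ℕ) : ℕ := pr 4 (pr f (pr k a))
/-- Atoms. -/
abbrev aE (d e : ℕ) : ℕ := pr 2 (pr d e)
/-- Atoms. -/
abbrev aL (d e : ℕ) : ℕ := pr 3 (pr d e)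
/-- Atoms. -/
abbrev aV (t k a d : ℕ) : ℕ := pr 4 (pr (pr t k) (pr a d))
/-- Atoms. -/
abbrev aW (f k : ℕ) : ℕ := pr 5 (pr f k)
/-- Atoms. -/
abbrev aF (f k a : ℕ) : ℕ := pr 6 (pr (pr f k) a)

instance D0.cns (s a b : ∀ i, (Fin m → NF i) → NF i) [hp : Tm s] [ha : Tm a] [hb : Tm b] :
    D0 (M := NF) (fun i v => s i v = Guaspari.cns (a i v) (b i v)) := by
  have := hp.wk
  have := ha.wk
  have := hb.wk
  have : D0 (M := NF) (fun i v => ∃ p, p ≤ s i v ∧ s i v = p + 1 ∧ p = Nat.pair (a i v) (b i v)) := inferInstance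
  refine this.congr fun i v => ?_
  constructor
  · intro h; exact ⟨_, by rw [h]; exact Nat.le_succ _, h, rfl⟩
  · rintro ⟨p, _, h, rfl⟩; exact h

instance Sg.app (s a b : ∀ i, (Fin m → NF i) → NF i) [hp : Tm s] [ha : Tm a] [hb : Tm b] :
    Sg (M := NF) 1 (fun i v => s i v = Guaspari.app (a i v) (b i v)) := sg_of_primrec app_primrec _ _ _

instance Sg.eqc (s k t u : ∀ i, (Fin m → NF i) → NF i) [hs : Tm s] [hk : Tm k] [ht : Tm t] [hu : Tm u] :
    Sg (M := NF) 1 (fun i v => s i v = Guaspari.eqc (k i v) (t i v) (u i v)) := by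
  have := hs.wk.wk.wk
  have := hk.wk
  have := hk.wk.wk
  have := ht.wk
  have := hu.wk.wk
  have : Sg (M := NF) 1 (fun i v => ∃ p, p = Nat.pair (k i v) (t i v) ∧ ∃ q, q = Nat.pair (k i v) (u i v) ∧
    ∃ r, r = Guaspari.cns (2 * q) 0 ∧ s i v = Guaspari.cns (2 * p) r) := inferInstance
  refine this.congr fun i v => ?_
  simp [Guaspari.eqc]

/-- Equality axioms. -/
def GE (ρ : ℕ → Prop) : Prop :=
  (∀ d, ρ (aE d d)) ∧ (∀ d e f, ρ (aE d e) → ρ (aE d f) → ρ (aE e f)) ∧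
  (∀ d e, ρ (aE d e) → ρ (aE (nS d) (nS e))) ∧
  (∀ d e d' e', ρ (aE d d') → ρ (aE e e') → ρ (aE (nA d e) (nA d' e'))) ∧
  (∀ d e d' e', ρ (aE d d') → ρ (aE e e') → ρ (aE (nM d e) (nM d' e'))) ∧
  (∀ d e d' e', ρ (aE d d') → ρ (aE e e') → ρ (aL d e) → ρ (aL d' e')) ∧
  (∀ a, ρ (aE (nS (nN a)) (nN (a + 1))))

/-- Evaluation of terms. -/
def GV (ρ : ℕ → Prop) : Prop :=
  (∀ k s, s = cns (4 * k + 2) 0 → ∀ a d, ρ (aV s (k + 1) (pr a d) d)) ∧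
  (∀ t k a d x, ρ (aV t k a d) → ρ (aV t (k + 1) (pr a x) d)) ∧
  (∀ s, s = cns cZ 0 → ∀ k a, ρ (aV s k a (nN 0))) ∧
  (∀ t s, s = cns cS t → ∀ k a d, ρ (aV t k a d) → ρ (aV s k a (nS d))) ∧
  (∀ t u w, w = app t u → ∀ s, s = cns cA w → ∀ k a d e, ρ (aV t k a d) → ρ (aV u k a e) → ρ (aV s k a (nA d e))) ∧
  (∀ t u w, w = app t u → ∀ s, s = cns cM w → ∀ k a d e, ρ (aV t k a d) → ρ (aV u k a e) → ρ (aV s k a (nM d e)))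

/-- Truth of atomic formulas. -/
def GA (ρ : ℕ → Prop) : Prop :=
  (∀ k s, s = cns (4 * k + 11) 0 → ρ (aW s k)) ∧
  (∀ k s, s = cns (4 * k + 11) 0 → ∀ a, ¬ ρ (aF s k a)) ∧
  (∀ k t u s, s = eqc k t u → ∀ a d e, ρ (aV t k a d) → ρ (aV u k a e) → ρ (aW s k)) ∧
  (∀ k t u s, s = eqc k t u → ∀ a d e, ρ (aV t k a d) → ρ (aV u k a e) → ρ (aF s k a) → ρ (aE d e)) ∧
  (∀ k t u s, s = eqc k t u → ∀ a d e, ρ (aV t k a d) → ρ (aV u k a e) → ρ (aE d e) → ρ (aF s k a)) ∧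
  (∀ k t u w, w = eqc k t u → ∀ z, z = cns (4 * k + 3) w → ∀ s, s = cns cR z →
    ∀ a d e, ρ (aV t k a d) → ρ (aV u k a e) → ρ (aW s k)) ∧
  (∀ k t u w, w = eqc k t u → ∀ z, z = cns (4 * k + 3) w → ∀ s, s = cns cR z →
    ∀ a d e, ρ (aV t k a d) → ρ (aV u k a e) → ρ (aF s k a) → ρ (aL d e)) ∧
  (∀ k t u w, w = eqc k t u → ∀ z, z = cns (4 * k + 3) w → ∀ s, s = cns cR z →
    ∀ a d e, ρ (aV t k a d) → ρ (aV u k a e) → ρ (aL d e) → ρ (aF s k a))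

/-- Truth of compound formulas. -/
def GF (ρ : ℕ → Prop) : Prop :=
  (∀ f g w, w = app f g → ∀ s, s = cns 3 w → ∀ k, ρ (aW f k) → ρ (aW g k) → ρ (aW s k)) ∧
  (∀ f g w, w = app f g → ∀ s, s = cns 3 w → ∀ k a, ρ (aF s k a) → ρ (aF f k a) → ρ (aW g k) → ρ (aF g k a)) ∧
  (∀ f g w, w = app f g → ∀ s, s = cns 3 w → ∀ k a, ρ (aW f k) → ρ (aW g k) → ρ (aF s k a) ∨ ρ (aF f k a)) ∧
  (∀ f g w, w = app f g → ∀ s, s = cns 3 w → ∀ k a, ρ (aW f k) → ρ (aF g k a) → ρ (aF s k a)) ∧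
  (∀ f s, s = cns 7 f → ∀ k, ρ (aW f (k + 1)) → ρ (aW s k)) ∧
  (∀ f s, s = cns 7 f → ∀ k a d, ρ (aW f (k + 1)) → ρ (aF s k a) → ρ (aF f (k + 1) (pr a d))) ∧
  (∀ f s, s = cns 7 f → ∀ k a, ρ (aF f (k + 1) (pr a (nW f k a))) → ρ (aF s k a))

instance CF.ge : CF (m := m) (fun i v ρ => GE ρ) := by
  unfold GE
  refine @CF.and _ _ _ ?_ ?_
  · infer_instance
  refine @CF.and _ _ _ ?_ ?_
  · infer_instance
  refine @CF.and _ _ _ ?_ ?_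
  · infer_instance
  refine @CF.and _ _ _ ?_ ?_
  · infer_instance
  refine @CF.and _ _ _ ?_ ?_
  · infer_instance
  refine @CF.and _ _ _ ?_ ?_
  · infer_instance
  infer_instance
instance CF.gv : CF (m := m) (fun i v ρ => GV ρ) := by
  unfold GV
  refine @CF.and _ _ _ ?_ ?_
  · infer_instance
  refine @CF.and _ _ _ ?_ ?_
  · infer_instance
  refine @CF.and _ _ _ ?_ ?_
  · infer_instance
  refine @CF.and _ _ _ ?_ ?_
  · infer_instance
  refine @CF.and _ _ _ ?_ ?_
  · infer_instance
  infer_instance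
set_option synthInstance.maxHeartbeats 400000 in
instance CF.ga : CF (m := m) (fun i v ρ => GA ρ) := by
  unfold GA
  refine @CF.and _ _ _ ?_ ?_
  · infer_instance
  refine @CF.and _ _ _ ?_ ?_
  · infer_instance
  refine @CF.and _ _ _ ?_ ?_
  · infer_instance
  refine @CF.and _ _ _ ?_ ?_
  · infer_instance
  refine @CF.and _ _ _ ?_ ?_
  · infer_instance
  refine @CF.and _ _ _ ?_ ?_
  · infer_instance
  refine @CF.and _ _ _ ?_ ?_
  · infer_instance
  infer_instance
set_option synthInstance.maxHeartbeats 400000 in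
instance CF.gf : CF (m := m) (fun i v ρ => GF ρ) := by
  unfold GF
  refine @CF.and _ _ _ ?_ ?_
  · infer_instance
  refine @CF.and _ _ _ ?_ ?_
  · infer_instance
  refine @CF.and _ _ _ ?_ ?_
  · infer_instance
  refine @CF.and _ _ _ ?_ ?_
  · infer_instance
  refine @CF.and _ _ _ ?_ ?_
  · infer_instance
  refine @CF.and _ _ _ ?_ ?_
  · infer_instance
  infer_instance

/-- All conditions. -/
def GG (TT : ℕ → Prop) (c m A : ℕ) (ρ : ℕ → Prop) : Prop :=
  GE ρ ∧ GV ρ ∧ GA ρ ∧ GF ρ ∧ (∀ s, TT s → ρ (aF s 0 0)) ∧ ¬ ρ (aF c m A)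

theorem CF.gg (TT : ℕ → Prop) (hT : ComputablePred TT) (c m : ℕ) :
    CF (fun i (v : Fin m → NF i) ρ => GG TT c m (stk (fun j => nN (v j))) ρ) := by
  unfold GG
  have h1 := fun {a : ℕ} (x : ∀ i, (Fin a → NF i) → NF i) [hx : Tm x] => sg_of_computable hT x
  have h2 : Tm (M := NF) (fun i (v : Fin m → NF i) => stk (fun j => nN (v j))) :=
    Tm.stk (fun j i v => nN (v j)) (fun j => inferInstance)
  infer_instance

end Henkin

section Sound
variable (M : Type) [LA.Structure M]

/-- Numerals in a raw structure. -/
def rnum : ℕ → M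
  | 0 => rz M
  | n + 1 => rs (rnum n)

/-- Components of a stack code. -/
noncomputable def comp : ∀ k : ℕ, ℕ → Fin k → ℕ
  | 0, _ => fun j => j.elim0
  | k + 1, a => Fin.snoc (comp k (p1 a)) (p2 a)

theorem comp_le : ∀ (k a : ℕ) (j : Fin k), comp k a j ≤ a
  | 0, _, j => j.elim0
  | k + 1, a, j => by
    have h := (UnP.spec a).le
    refine Fin.lastCases ?_ (fun j => ?_) j
    · rw [comp, Fin.snoc_last]; exact h.2
    · rw [comp, Fin.snoc_castSucc]; exact (comp_le k _ j).trans h.1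

theorem comp_stk : ∀ {k : ℕ} (v : Fin k → ℕ), comp k (stk v) = v
  | 0, v => funext fun j => j.elim0
  | k + 1, v => by
    rw [comp, stk, p1_pr, p2_pr, comp_stk]
    exact Fin.snoc_init_self v

theorem comp_pr (k a d : ℕ) : comp (k + 1) (pr a d) = Fin.snoc (comp k a) d := by
  rw [comp, p1_pr, p2_pr]

open Classical in
/-- Interpretation of a Henkin witness. -/
noncomputable def witI (g : ℕ → M) (f k a : ℕ) : M :=
  if h : ∃ z, ∃ φ : LA.BoundedFormula Empty (k + 1), fc φ = f ∧
      ¬ φ.Realize default (Fin.snoc (fun j => g (comp k a j)) z)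
      then h.choose else rz M

open Classical in
/-- One step of the interpretation of names. -/
noncomputable def stepI (g : ℕ → M) (d : ℕ) : M :=
  match p1 d with
  | 0 => rnum M (p2 d)
  | 1 => rs (g (p2 d))
  | 2 => ra (g (p1 (p2 d))) (g (p2 (p2 d)))
  | 3 => rm (g (p1 (p2 d))) (g (p2 (p2 d)))
  | _ => witI M g (p1 (p2 d)) (p1 (p2 (p2 d))) (p2 (p2 (p2 d)))

open Classical in
/-- Interpretation of names. -/
noncomputable def nmI : ℕ → M :=
  Nat.lt_wfRel.wf.fix (C := fun _ => M) fun d ih => stepI M (fun e => if h : e < d then ih e h else rz M) d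

open Classical in
theorem nmI_eq (d : ℕ) : nmI M d = stepI M (fun e => if e < d then nmI M e else rz M) d := by
  rw [nmI, WellFounded.fix_eq]
  simp only [dite_eq_ite]

theorem lt_pr (t e : ℕ) : e < pr (t + 1) e := by
  have h : pr (t + 1) e = (t + 1 + e) * (t + 1 + e) + (t + 1) := rfl
  have := Nat.le_mul_self (t + 1 + e)
  omega

theorem nmI_N (a : ℕ) : nmI M (nN a) = rnum M a := by
  rw [nmI_eq, stepI]; simp only [nN, p1_pr, p2_pr]
theorem nmI_S (d : ℕ) : nmI M (nS d) = rs (nmI M d) := by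
  rw [nmI_eq, stepI]; simp only [nS, p1_pr, p2_pr]
  rw [if_pos (lt_pr 0 d)]
theorem nmI_A (d e : ℕ) : nmI M (nA d e) = ra (nmI M d) (nmI M e) := by
  rw [nmI_eq, stepI]; simp only [nA, p1_pr, p2_pr]
  have := lt_pr 1 (pr d e)
  have h1 : d ≤ pr d e := fst_le_pr d e
  have h2 : e ≤ pr d e := snd_le_pr d e
  rw [if_pos (h1.trans_lt this), if_pos (h2.trans_lt this)]
theorem nmI_M (d e : ℕ) : nmI M (nM d e) = rm (nmI M d) (nmI M e) := by
  rw [nmI_eq, stepI]; simp only [nM, p1_pr, p2_pr]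
  have := lt_pr 2 (pr d e)
  have h1 : d ≤ pr d e := fst_le_pr d e
  have h2 : e ≤ pr d e := snd_le_pr d e
  rw [if_pos (h1.trans_lt this), if_pos (h2.trans_lt this)]

/-- Assignments. -/
noncomputable def asg (k a : ℕ) : Fin k → M := fun j => nmI M (comp k a j)

theorem asg_pr (k a d : ℕ) : asg M (k + 1) (pr a d) = Fin.snoc (asg M k a) (nmI M d) := by
  funext j
  rw [asg, comp_pr]
  refine Fin.lastCases ?_ (fun j => ?_) j
  · simp
  · simp [asg]

theorem witI_congr (g g' : ℕ → M) (f k a : ℕ) (h : ∀ j, g (comp k a j) = g' (comp k a j)) :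
    witI M g f k a = witI M g' f k a := by
  have e : (fun j => g (comp k a j)) = fun j => g' (comp k a j) := funext h
  unfold witI
  rw [e]

theorem nmI_W (k a : ℕ) (φ : LA.BoundedFormula Empty (k + 1)) (z : M)
    (h : ¬ φ.Realize default (Fin.snoc (asg M k a) z)) :
    ¬ φ.Realize default (Fin.snoc (asg M k a) (nmI M (nW (fc φ) k a))) := by
  have ha : ∀ j, comp k a j < nW (fc φ) k a := fun j =>
    ((comp_le k a j).trans ((snd_le_pr k a).trans (snd_le_pr (fc φ) _))).trans_lt (lt_pr 3 _)
  rw [nmI_eq, stepI]; simp only [nW, p1_pr, p2_pr]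
  rw [witI_congr M _ (nmI M) _ k a (fun j => if_pos (ha j)), witI]
  have hz : ∃ z, ∃ ψ : LA.BoundedFormula Empty (k + 1), fc ψ = fc φ ∧
      ¬ ψ.Realize default (Fin.snoc (fun j => nmI M (comp k a j)) z) := ⟨z, φ, rfl, h⟩
  rw [dif_pos hz]
  obtain ⟨ψ, h1, h2⟩ := hz.choose_spec
  rw [fc_inj h1] at h2
  exact h2

/-- Term evaluation. -/
def hV (t k a d : ℕ) : Prop := ∃ u : LA.Term (Empty ⊕ Fin k), tc u = t ∧
    u.realize (Sum.elim default (asg M k a)) = nmI M d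
/-- Formula codes. -/
def hW (f k : ℕ) : Prop := ∃ φ : LA.BoundedFormula Empty k, fc φ = f
/-- Truth. -/
def hF (f k a : ℕ) : Prop := ∃ φ : LA.BoundedFormula Empty k, fc φ = f ∧ φ.Realize default (asg M k a)

/-- The assignment of truth values given by a structure. -/
noncomputable def rhoM (x : ℕ) : Prop :=
  match p1 x with
  | 0 => p2 x = 1
  | 2 => nmI M (p1 (p2 x)) = nmI M (p2 (p2 x))
  | 3 => rl (nmI M (p1 (p2 x))) (nmI M (p2 (p2 x)))
  | 4 => hV M (p1 (p1 (p2 x))) (p2 (p1 (p2 x))) (p1 (p2 (p2 x))) (p2 (p2 (p2 x)))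
  | 5 => hW (p1 (p2 x)) (p2 (p2 x))
  | _ => hF M (p1 (p1 (p2 x))) (p2 (p1 (p2 x))) (p2 (p2 x))

theorem rho_E (d e : ℕ) : rhoM M (aE d e) ↔ nmI M d = nmI M e := by
  simp only [rhoM, aE, p1_pr, p2_pr]
theorem rho_L (d e : ℕ) : rhoM M (aL d e) ↔ rl (nmI M d) (nmI M e) := by
  simp only [rhoM, aL, p1_pr, p2_pr]
theorem rho_V (t k a d : ℕ) : rhoM M (aV t k a d) ↔ ∃ u : LA.Term (Empty ⊕ Fin k), tc u = t ∧
    u.realize (Sum.elim default (asg M k a)) = nmI M d := by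
  simp only [rhoM, aV, p1_pr, p2_pr]; rfl
theorem rho_W (f k : ℕ) : rhoM M (aW f k) ↔ ∃ φ : LA.BoundedFormula Empty k, fc φ = f := by
  simp only [rhoM, aW, p1_pr, p2_pr]; rfl
theorem rho_F (f k a : ℕ) : rhoM M (aF f k a) ↔ ∃ φ : LA.BoundedFormula Empty k, fc φ = f ∧ φ.Realize default (asg M k a) := by
  simp only [rhoM, aF, p1_pr, p2_pr]; rfl
theorem rho_1 : rhoM M 1 := by
  have h : (1 : ℕ) = pr 0 1 := rfl
  rw [h]
  simp only [rhoM, p1_pr, p2_pr]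
theorem rho_0 : ¬ rhoM M 0 := by
  have h : (0 : ℕ) = pr 0 0 := rfl
  rw [h]
  simp [rhoM, p1_pr, p2_pr]

theorem rho_GE : GE (rhoM M) := by
  simp only [GE, rho_E, rho_L, nmI_N, nmI_S, nmI_A, nmI_M]
  refine ⟨fun _ => trivial, fun d e f h h' => h.symm.trans h', fun d e h => by rw [h], fun d e d' e' h h' => by rw [h, h'],
    fun d e d' e' h h' => by rw [h, h'], fun d e d' e' h h' => by rw [h, h']; exact id, fun a => rfl⟩

theorem rho_GV : GV (rhoM M) := by
  simp only [GV, rho_V, nmI_N, nmI_S, nmI_A, nmI_M]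
  refine ⟨?_, ?_, ?_, ?_, ?_, ?_⟩
  · rintro k _ rfl a d
    refine ⟨vT (Fin.last k), ?_, ?_⟩
    · rw [tc_var]; rfl
    · rw [real_vT, asg_pr, Fin.snoc_last]
  · rintro _ k a d x ⟨t, rfl, h⟩
    refine ⟨t.relabel (Sum.map id Fin.castSucc), tc_lift t, ?_⟩
    rw [Term.realize_relabel, ← h, asg_pr]
    congr 1
    funext j
    rcases j with j | j
    · exact j.elim
    · simp
  · rintro _ rfl k a
    exact ⟨zeroT, tc_zero, real_zeroT _⟩
  · rintro _ _ rfl k a d ⟨t, rfl, h⟩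
    exact ⟨succT t, tc_succ _, by rw [real_succT, h]⟩
  · rintro _ _ _ rfl _ rfl k a d e ⟨t, rfl, h⟩ ⟨u, rfl, h'⟩
    exact ⟨addT t u, tc_add _ _, by rw [real_addT, h, h']⟩
  · rintro _ _ _ rfl _ rfl k a d e ⟨t, rfl, h⟩ ⟨u, rfl, h'⟩
    exact ⟨mulT t u, tc_mul _ _, by rw [real_mulT, h, h']⟩

theorem rho_GA : GA (rhoM M) := by
  simp only [GA, rho_V, rho_W, rho_F, rho_E, rho_L]
  refine ⟨?_, ?_, ?_, ?_, ?_, ?_, ?_, ?_⟩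
  · rintro k _ rfl; exact ⟨⊥, fc_falsum⟩
  · rintro k _ rfl a ⟨φ, h, h'⟩
    rw [← fc_falsum] at h
    rw [fc_inj h] at h'
    exact h'
  · rintro k _ _ _ rfl a d e ⟨t, rfl, h⟩ ⟨u, rfl, h'⟩
    exact ⟨_, fc_eq t u⟩
  · rintro k _ _ _ rfl a d e ⟨t, rfl, h⟩ ⟨u, rfl, h'⟩ ⟨φ, h1, h2⟩
    rw [← fc_eq] at h1
    rw [fc_inj h1, BoundedFormula.realize_bdEqual, h, h'] at h2
    exact h2
  · rintro k _ _ _ rfl a d e ⟨t, rfl, h⟩ ⟨u, rfl, h'⟩ h2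
    exact ⟨_, fc_eq t u, by rw [BoundedFormula.realize_bdEqual, h, h', h2]⟩
  · rintro k _ _ _ rfl _ rfl _ rfl a d e ⟨t, rfl, h⟩ ⟨u, rfl, h'⟩
    exact ⟨_, fc_le t u⟩
  · rintro k _ _ _ rfl _ rfl _ rfl a d e ⟨t, rfl, h⟩ ⟨u, rfl, h'⟩ ⟨φ, h1, h2⟩
    rw [← fc_le] at h1
    rw [fc_inj h1, real_leF, h, h'] at h2
    exact h2
  · rintro k _ _ _ rfl _ rfl _ rfl a d e ⟨t, rfl, h⟩ ⟨u, rfl, h'⟩ h2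
    exact ⟨_, fc_le t u, by rw [real_leF, h, h']; exact h2⟩

theorem rho_GF : GF (rhoM M) := by
  simp only [GF, rho_W, rho_F]
  refine ⟨?_, ?_, ?_, ?_, ?_, ?_, ?_⟩
  · rintro _ _ _ rfl _ rfl k ⟨φ, rfl⟩ ⟨ψ, rfl⟩
    exact ⟨_, fc_imp φ ψ⟩
  · rintro _ _ _ rfl _ rfl k a ⟨χ, h, h'⟩ ⟨φ, rfl, h1⟩ ⟨ψ, rfl⟩
    rw [← fc_imp] at h
    rw [fc_inj h] at h'
    exact ⟨ψ, rfl, h' h1⟩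
  · rintro _ _ _ rfl _ rfl k a ⟨φ, rfl⟩ ⟨ψ, rfl⟩
    by_cases h : φ.Realize default (asg M k a)
    · exact Or.inr ⟨φ, rfl, h⟩
    · exact Or.inl ⟨_, fc_imp φ ψ, fun h' => (h h').elim⟩
  · rintro _ _ _ rfl _ rfl k a ⟨φ, rfl⟩ ⟨ψ, rfl, h⟩
    exact ⟨_, fc_imp φ ψ, fun _ => h⟩
  · rintro _ _ rfl k ⟨φ, rfl⟩
    exact ⟨_, fc_all φ⟩
  · rintro _ _ rfl k a d ⟨φ, rfl⟩ ⟨χ, h, h'⟩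
    rw [← fc_all] at h
    rw [fc_inj h] at h'
    exact ⟨φ, rfl, by rw [asg_pr]; exact h' _⟩
  · rintro _ _ rfl k a ⟨φ, rfl, h⟩
    refine ⟨_, fc_all φ, ?_⟩
    rw [asg_pr] at h
    intro z
    by_contra hz
    exact nmI_W M k a φ z hz h

theorem rho_GG (T : Thy) (hM : M ⊨ T) {m : ℕ} (χ : LA.BoundedFormula Empty m) (v : Fin m → ℕ)
    (h : ¬ χ.Realize default (fun j => rnum M (v j))) :
    GG (fun s => ∃ φ ∈ T, gnum φ = s) (fc χ) m (stk (fun j => nN (v j))) (rhoM M) := by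
  refine ⟨rho_GE M, rho_GV M, rho_GA M, rho_GF M, ?_, ?_⟩
  · rintro _ ⟨φ, hφ, rfl⟩
    rw [rho_F]
    refine ⟨φ, rfl, ?_⟩
    have h1 : M ⊨ φ := hM.realize_of_mem _ hφ
    have : asg M 0 0 = default := Subsingleton.elim _ _
    rw [this]; exact h1
  · rw [rho_F]
    rintro ⟨φ, h1, h2⟩
    rw [fc_inj h1] at h2
    apply h
    have : asg M m (stk (fun j => nN (v j))) = fun j => rnum M (v j) := by
      funext j; rw [asg, comp_stk, nmI_N]
    rw [← this]; exact h2
end Sound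

section Complete

/-- The term model setoid. -/
def hst (ρ : ℕ → Prop) (h : GE ρ) : Setoid ℕ where
  r d e := ρ (aE d e)
  iseqv := ⟨h.1, fun {d e} hd => h.2.1 d e d hd (h.1 d),
    fun {d e f} h1 h2 => h.2.1 e d f (h.2.1 d e d h1 (h.1 d)) h2⟩

/-- The term model. -/
def HQ (ρ : ℕ → Prop) (h : GE ρ) : Type := Quotient (hst ρ h)

variable (ρ : ℕ → Prop) (h : GE ρ)

/-- Class of a name. -/
def cl (d : ℕ) : HQ ρ h := Quotient.mk (hst ρ h) d
/-- Representative. -/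
noncomputable def rep (x : HQ ρ h) : ℕ := Quotient.out (s := hst ρ h) x
theorem cl_rep (x : HQ ρ h) : cl ρ h (rep ρ h x) = x := Quotient.out_eq (s := hst ρ h) x
theorem cl_eq (d e : ℕ) : cl ρ h d = cl ρ h e ↔ ρ (aE d e) := Quotient.eq (r := hst ρ h)
theorem rep_cl (d : ℕ) : ρ (aE (rep ρ h (cl ρ h d)) d) := (cl_eq ρ h _ _).1 (cl_rep ρ h _)

noncomputable instance : LA.Structure (HQ ρ h) where
  funMap := fun {n} f x => match n, f, x with
    | 0, _, _ => cl ρ h (nN 0)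
    | 1, _, x => cl ρ h (nS (rep ρ h (x 0)))
    | 2, false, x => cl ρ h (nA (rep ρ h (x 0)) (rep ρ h (x 1)))
    | 2, true, x => cl ρ h (nM (rep ρ h (x 0)) (rep ρ h (x 1)))
    | _ + 3, f, _ => Empty.elim f
  RelMap := fun {n} f x => match n, f, x with
    | 0, f, _ => Empty.elim f
    | 1, f, _ => Empty.elim f
    | 2, _, x => ρ (aL (rep ρ h (x 0)) (rep ρ h (x 1)))
    | _ + 3, f, _ => Empty.elim f

instance : Nonempty (HQ ρ h) := ⟨cl ρ h 0⟩

theorem hq_z : rz (HQ ρ h) = cl ρ h (nN 0) := rfl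
theorem hq_s (d : ℕ) : rs (cl ρ h d) = cl ρ h (nS d) := (cl_eq ρ h _ _).2 (h.2.2.1 _ _ (rep_cl ρ h d))
theorem hq_a (d e : ℕ) : ra (cl ρ h d) (cl ρ h e) = cl ρ h (nA d e) :=
  (cl_eq ρ h _ _).2 (h.2.2.2.1 _ _ _ _ (rep_cl ρ h d) (rep_cl ρ h e))
theorem hq_m (d e : ℕ) : rm (cl ρ h d) (cl ρ h e) = cl ρ h (nM d e) :=
  (cl_eq ρ h _ _).2 (h.2.2.2.2.1 _ _ _ _ (rep_cl ρ h d) (rep_cl ρ h e))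
theorem hq_l (d e : ℕ) : rl (cl ρ h d) (cl ρ h e) ↔ ρ (aL d e) := by
  have hd := rep_cl ρ h d
  have he := rep_cl ρ h e
  have sy : ∀ d e, ρ (aE d e) → ρ (aE e d) := fun d e hd => h.2.1 d e d hd (h.1 d)
  constructor
  · intro h1; exact h.2.2.2.2.2.1 _ _ _ _ hd he h1
  · intro h1; exact h.2.2.2.2.2.1 _ _ _ _ (sy _ _ hd) (sy _ _ he) h1
theorem hq_num (n : ℕ) : rnum (HQ ρ h) n = cl ρ h (nN n) := by
  induction n with
  | zero => rfl
  | succ n ih => rw [rnum, ih, hq_s, cl_eq]; exact h.2.2.2.2.2.2 n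

theorem hq_var (hv : GV ρ) : ∀ {k : ℕ} (v : Fin k → ℕ) (j : Fin k), ρ (aV (tc (vT j)) k (stk v) (v j))
  | 0, v, j => j.elim0
  | k + 1, v, j => by
    refine Fin.lastCases ?_ (fun j => ?_) j
    · rw [tc_var]; exact hv.1 k _ rfl _ _
    · have := hq_var hv (fun j => v (Fin.castSucc j)) j
      rw [tc_var] at this ⊢
      exact hv.2.1 _ _ _ _ _ this

theorem hq_term (hv : GV ρ) {k : ℕ} (v : Fin k → ℕ) (t : LA.Term (Empty ⊕ Fin k)) :
    ∃ d, ρ (aV (tc t) k (stk v) d) ∧ t.realize (Sum.elim default (fun j => cl ρ h (v j))) = cl ρ h d := by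
  obtain ⟨h1, h2, h3, h4, h5, h6⟩ := hv
  induction t using term_ind with
  | hv j => exact ⟨v j, hq_var ρ ⟨h1, h2, h3, h4, h5, h6⟩ v j, rfl⟩
  | hz => exact ⟨nN 0, by rw [tc_zero]; exact h3 _ rfl _ _, real_zeroT _⟩
  | hs t ih =>
    obtain ⟨d, hd, e⟩ := ih
    exact ⟨nS d, by rw [tc_succ]; exact h4 _ _ rfl _ _ _ hd, by rw [real_succT, e, hq_s]⟩
  | ha t u ih ih' =>
    obtain ⟨d, hd, e⟩ := ih
    obtain ⟨d', hd', e'⟩ := ih'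
    exact ⟨nA d d', by rw [tc_add]; exact h5 _ _ _ rfl _ rfl _ _ _ _ hd hd', by rw [real_addT, e, e', hq_a]⟩
  | hm t u ih ih' =>
    obtain ⟨d, hd, e⟩ := ih
    obtain ⟨d', hd', e'⟩ := ih'
    exact ⟨nM d d', by rw [tc_mul]; exact h6 _ _ _ rfl _ rfl _ _ _ _ hd hd', by rw [real_mulT, e, e', hq_m]⟩

theorem hq_fml (hv : GV ρ) (ha : GA ρ) (hf : GF ρ) {k : ℕ} (φ : LA.BoundedFormula Empty k) :
    ρ (aW (fc φ) k) ∧ ∀ v : Fin k → ℕ, ρ (aF (fc φ) k (stk v)) ↔ φ.Realize default (fun j => cl ρ h (v j)) := by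
  obtain ⟨a1, a2, a3, a4, a5, a6, a7, a8⟩ := ha
  obtain ⟨f1, f2, f3, f4, f5, f6, f7⟩ := hf
  induction φ using fml_ind with
  | hf k =>
    rw [fc_falsum]
    exact ⟨a1 _ _ rfl, fun v => ⟨fun h => (a2 _ _ rfl _ h).elim, fun h => h.elim⟩⟩
  | he k t u =>
    rw [fc_eq]
    have ht := fun v => hq_term ρ h hv v t
    have hu := fun v => hq_term ρ h hv v u
    constructor
    · obtain ⟨d, hd, -⟩ := ht (fun _ => 0)
      obtain ⟨e, he, -⟩ := hu (fun _ => 0)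
      exact a3 _ _ _ _ rfl _ _ _ hd he
    · intro v
      obtain ⟨d, hd, hd'⟩ := ht v
      obtain ⟨e, he, he'⟩ := hu v
      rw [BoundedFormula.realize_bdEqual, hd', he', cl_eq]
      exact ⟨a4 _ _ _ _ rfl _ _ _ hd he, a5 _ _ _ _ rfl _ _ _ hd he⟩
  | hl k t u =>
    rw [fc_le]
    have ht := fun v => hq_term ρ h hv v t
    have hu := fun v => hq_term ρ h hv v u
    constructor
    · obtain ⟨d, hd, -⟩ := ht (fun _ => 0)
      obtain ⟨e, he, -⟩ := hu (fun _ => 0)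
      exact a6 _ _ _ _ rfl _ rfl _ rfl _ _ _ hd he
    · intro v
      obtain ⟨d, hd, hd'⟩ := ht v
      obtain ⟨e, he, he'⟩ := hu v
      rw [real_leF, hd', he', hq_l]
      exact ⟨a7 _ _ _ _ rfl _ rfl _ rfl _ _ _ hd he, a8 _ _ _ _ rfl _ rfl _ rfl _ _ _ hd he⟩
  | hi k φ ψ ih ih' =>
    rw [fc_imp]
    refine ⟨f1 _ _ _ rfl _ rfl _ ih.1 ih'.1, fun v => ?_⟩
    rw [BoundedFormula.realize_imp, ← ih.2, ← ih'.2]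
    constructor
    · exact fun h1 h2 => f2 _ _ _ rfl _ rfl _ _ h1 h2 ih'.1
    · intro h1
      rcases f3 _ _ _ rfl _ rfl k (stk v) ih.1 ih'.1 with h2 | h2
      · exact h2
      · exact f4 _ _ _ rfl _ rfl _ _ ih.1 (h1 h2)
  | ha k φ ih =>
    rw [fc_all]
    refine ⟨f5 _ _ rfl _ ih.1, fun v => ?_⟩
    rw [BoundedFormula.realize_all]
    have key : ∀ d, ρ (aF (fc φ) (k + 1) (pr (stk v) d)) ↔
        φ.Realize default (Fin.snoc (fun j => cl ρ h (v j)) (cl ρ h d)) := by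
      intro d
      rw [← stk_snoc, ih.2]
      have : (fun j => cl ρ h ((Fin.snoc v d : Fin (k + 1) → ℕ) j)) =
          (Fin.snoc (fun j => cl ρ h (v j)) (cl ρ h d) : Fin (k + 1) → HQ ρ h) := by
        funext j
        refine Fin.lastCases ?_ (fun j => ?_) j <;> simp
      rw [this]
    constructor
    · intro h1 x
      rw [← cl_rep ρ h x, ← key]
      exact f6 _ _ rfl _ _ _ ih.1 h1
    · intro h1
      exact f7 _ _ rfl _ _ ((key _).2 (h1 _))

/-- Semantic consequence with numerals. -/
def Csq (T : Thy) {m : ℕ} (χ : LA.BoundedFormula Empty m) (v : Fin m → ℕ) : Prop :=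
  ∀ (M : Type) [LA.Structure M] [Nonempty M], M ⊨ T → χ.Realize default (fun j => rnum M (v j))

theorem csq_iff (T : Thy) {m : ℕ} (χ : LA.BoundedFormula Empty m) (v : Fin m → ℕ) :
    (¬ ∃ ρ : ℕ → Prop, ρ 1 ∧ ¬ ρ 0 ∧ GG (fun s => ∃ φ ∈ T, gnum φ = s) (fc χ) m (stk (fun j => nN (v j))) ρ) ↔ Csq T χ v := by
  constructor
  · intro h M _ _ hM
    by_contra hc
    exact h ⟨rhoM M, rho_1 M, rho_0 M, rho_GG M T hM χ v hc⟩
  · rintro h ⟨ρ, -, -, he, hv, ha, hf, hT, hc⟩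
    have key := fun {k : ℕ} (φ : LA.BoundedFormula Empty k) => (hq_fml ρ he hv ha hf φ).2
    have hM : HQ ρ he ⊨ T := by
      refine ⟨fun φ hφ => ?_⟩
      have h1 := (key φ default).1 (hT _ ⟨φ, hφ, rfl⟩)
      have : (fun j => cl ρ he ((default : Fin 0 → ℕ) j)) = default := Subsingleton.elim _ _
      rw [this] at h1
      exact h1
    have h2 := h _ hM
    simp only [hq_num] at h2
    exact hc ((key χ _).2 h2)

theorem csq_sg (T : Thy) (hT : CompThy T) {m : ℕ} (χ : LA.BoundedFormula Empty m) :
    Sg (M := NF) 1 (fun i v => Csq T χ v) :=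
  (CF.sg _ (CF.gg _ hT (fc χ) m)).congr fun i v => (csq_iff T χ v).symm

end Complete

section Tools

/-- Bundled models of PA. -/
structure PAMod : Type 1 where
  /-- Carrier. -/
  C : Type
  /-- Structure. -/
  inst : PAM C

/-- The family of all models of PA. -/
abbrev PF : PAMod → Type := fun N => N.C
instance (N : PAMod) : PAM (PF N) := N.inst

/-- The standard model. -/
def stdM : PAMod := ⟨ℕ, inferInstance⟩

theorem rnum_cast {N : Type} [PAM N] (n : ℕ) : rnum N n = (n : N) := by
  induction n with
  | zero => rw [rnum, PAM.r_zero, Nat.cast_zero]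
  | succ n ih => rw [rnum, ih, PAM.r_succ, Nat.cast_succ]

theorem prv_iff (T : Thy) (φ : Snt) :
    Prv T φ ↔ ∀ (M : Type) [LA.Structure M] [Nonempty M], M ⊨ T → M ⊨ φ := by
  rw [Prv, Theory.models_sentence_iff]
  constructor
  · intro h M _ _ hM
    exact h (Theory.ModelType.of T M)
  · intro h M
    exact h M M.is_model

instance (N : Type) [PAM N] : Nonempty N := ⟨0⟩

theorem prv_pam (T : Thy) (hT : ExtPA T) (φ : Snt) :
    Prv T φ ↔ ∀ N : PAMod, N.C ⊨ T → N.C ⊨ φ := by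
  rw [prv_iff]
  constructor
  · intro h N hN; exact h N.C hN
  · intro h M i1 i2 hM
    have hp : M ⊨ PAAx := ⟨fun ψ hψ => (prv_iff T ψ).1 (hT ψ hψ) M hM⟩
    exact h ⟨M, PAM.ofModel M hp⟩ hM

theorem rnum_ofModel (M : Type) [i : LA.Structure M] (hp : M ⊨ PAAx) (N0 : PAMod)
    (e : N0 = ⟨M, PAM.ofModel M hp⟩) {m : ℕ} (χ : LA.BoundedFormula Empty m) (v : Fin m → ℕ)
    (h : χ.Realize default (fun j => ((v j : ℕ) : PF N0))) :
    χ.Realize default (fun j => rnum M (v j)) := by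
  simp only [← rnum_cast] at h
  subst e
  exact h

theorem csq_pam (T : Thy) (hT : ExtPA T) {m : ℕ} (χ : LA.BoundedFormula Empty m) (v : Fin m → ℕ) :
    Csq T χ v ↔ ∀ N : PAMod, N.C ⊨ T → χ.Realize default (fun j => ((v j : ℕ) : PF N)) := by
  constructor
  · intro h N hN
    have := h N.C hN
    simp only [rnum_cast] at this
    exact this
  · intro h M i1 i2 hM
    have hp : M ⊨ PAAx := ⟨fun ψ hψ => (prv_iff T ψ).1 (hT ψ hψ) M hM⟩
    exact rnum_ofModel M hp ⟨M, PAM.ofModel M hp⟩ rfl χ v (h ⟨M, PAM.ofModel M hp⟩ hM)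

theorem re_of_df (T : Thy) (hc : CompThy T) (hT : ExtPA T) {m : ℕ} (R : ∀ i, (Fin m → PF i) → Prop) (hR : Df R) :
    Sg (M := NF) 1 (fun i v => ∀ N : PAMod, N.C ⊨ T → R N (fun j => ((v j : ℕ) : PF N))) := by
  obtain ⟨χ, hχ⟩ := hR.ex
  refine (csq_sg T hc χ).congr fun i v => ?_
  rw [csq_pam T hT]
  simp only [hχ]

theorem D0_abs {m : ℕ} (φ : LA.BoundedFormula Empty m) (h : IsDelta0 φ) {N : Type} [PAM N] (v : Fin m → ℕ)
    (d : Empty → N) (d' : Empty → ℕ) :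
    φ.Realize (M := N) d (fun j => (v j : N)) ↔ φ.Realize (M := ℕ) d' v := by
  have ht : ∀ {m : ℕ} (t : LA.Term (Empty ⊕ Fin m)) (v : Fin m → ℕ),
      t.realize (M := N) (Sum.elim d (fun j => (v j : N))) = ((t.realize (M := ℕ) (Sum.elim d' v) : ℕ) : N) := by
    intro m t v
    obtain rfl : d = default := Subsingleton.elim _ _
    obtain rfl : d' = default := Subsingleton.elim _ _
    induction t using term_ind with
    | hv j => rfl
    | hz => rw [real_zeroT, real_zeroT, PAM.r_zero, PAM.r_zero, Nat.cast_zero]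
    | hs t ih => rw [real_succT, real_succT, PAM.r_succ, PAM.r_succ, ih]; exact (Nat.cast_add_one _).symm
    | ha t u ih ih' => rw [real_addT, real_addT, PAM.r_add, PAM.r_add, ih, ih', Nat.cast_add]
    | hm t u ih ih' => rw [real_mulT, real_mulT, PAM.r_mul, PAM.r_mul, ih, ih', Nat.cast_mul]
  have hc : ∀ {m : ℕ} (v : Fin m → ℕ) (a : ℕ), (Fin.snoc (fun j => (v j : N)) (a : N) : Fin (m + 1) → N) =
      fun j => (((Fin.snoc v a : Fin (m + 1) → ℕ) j : ℕ) : N) := by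
    intro m v a
    funext j
    refine Fin.lastCases ?_ (fun j => ?_) j <;> simp
  have hl : ∀ {K : Type} [LA.Structure K] (d : Empty → K) {m : ℕ} (t : LA.Term (Empty ⊕ Fin m)) (v : Fin m → K) (x : K),
      (t.relabel (Sum.map id Fin.castSucc)).realize (Sum.elim d (Fin.snoc v x : Fin (m + 1) → K)) =
      t.realize (Sum.elim d v) := by
    intro K _ d m t v x
    rw [Term.realize_relabel]
    congr 1
    funext j
    rcases j with j | j
    · exact j.elim
    · simp
  induction h with
  | falsum => exact Iff.rfl
  | equal t u =>
    rw [BoundedFormula.realize_bdEqual, BoundedFormula.realize_bdEqual, ht, ht, Nat.cast_inj]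
  | le t u => rw [real_leF, real_leF, ht, ht, PAM.r_le, PAM.r_le, Nat.cast_le]
  | imp _ _ ih ih' => exact imp_congr (ih v) (ih' v)
  | ball t _ ih =>
    rw [BoundedFormula.realize_all, BoundedFormula.realize_all]
    simp only [BoundedFormula.realize_imp, real_leF, hl, real_vT, Fin.snoc_last, PAM.r_le, ht]
    constructor
    · intro h a ha
      have := h a (Nat.cast_le.2 ha)
      rw [hc] at this
      exact (ih _).1 this
    · intro h x hx
      obtain ⟨a, ha, rfl⟩ := PAM.std _ x hx
      rw [hc]
      exact (ih _).2 (h a ha)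
  | bex t _ ih =>
    rw [BoundedFormula.realize_ex, BoundedFormula.realize_ex]
    simp only [BoundedFormula.realize_inf, real_leF, hl, real_vT, Fin.snoc_last, PAM.r_le, ht]
    constructor
    · rintro ⟨x, hx, h⟩
      obtain ⟨a, ha, rfl⟩ := PAM.std _ x hx
      rw [hc] at h
      exact ⟨a, ha, (ih _).1 h⟩
    · rintro ⟨a, ha, h⟩
      refine ⟨a, Nat.cast_le.2 ha, ?_⟩
      rw [hc]; exact (ih _).2 h

section Kap
variable {N : Type} [PAM N]
/-- Bounded satisfaction. -/
def kap (e y w : N) : Prop := ∃ x, x ≤ w ∧ ∃ b, b ≤ w ∧ ∃ q, q ≤ w ∧ ∃ p, p ≤ w ∧ Corr b q p ∧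
  ∃ z, z ≤ b ∧ z ≠ 1 ∧ Mem (e3 e (pr y x) z) b q p

theorem sat0_iff (e y : N) : Sat 0 e y ↔ ∃ w, kap e y w := by
  constructor
  · rintro ⟨x, b, q, p, h⟩
    refine ⟨x + b + q + p, x, ?_, b, ?_, q, ?_, p, ?_, h⟩
    · rw [add_assoc, add_assoc]; exact le_self_add
    · exact (le_add_self.trans le_self_add).trans le_self_add
    · exact le_add_self.trans le_self_add
    · exact le_add_self
  · rintro ⟨w, x, _, b, _, q, _, p, _, h⟩
    exact ⟨x, b, q, p, h⟩
end Kap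

section KapI
universe u
variable {ι : Type u} {M : ι → Type} [∀ i, PAM (M i)] {m : ℕ}
instance D0.kap (x b q : ∀ i, (Fin m → M i) → M i) [hx : Tm x] [hb : Tm b] [hq : Tm q] :
    D0 (fun i v => kap (x i v) (b i v) (q i v)) :=
  D0.sub (fun i (v : Fin 3 → M i) => Guaspari.kap (v 0) (v 1) (v 2)) (by unfold Guaspari.kap; infer_instance) ![x, b, q]
    (by intro j; fin_cases j <;> assumption)
end KapI

theorem kap_abs {N : Type} [PAM N] (e y w : ℕ) : kap (e : N) (y : N) (w : N) ↔ kap e y w := by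
  have h : D0 (M := PF) (fun i (v : Fin 3 → PF i) => kap (v 0) (v 1) (v 2)) := inferInstance
  obtain ⟨φ, d, hφ⟩ := h.ex
  have h2 := hφ ⟨N, inferInstance⟩ (fun j => ((![e, y, w] j : ℕ) : N))
  have h3 := hφ stdM ![e, y, w]
  exact h2.symm.trans ((D0_abs φ d (N := N) ![e, y, w] _ _).trans h3)

theorem re_index {m : ℕ} (A : (Fin m → ℕ) → Prop) (hA : Sg (M := NF) 1 (fun i v => A v)) :
    ∃ a : ℕ, ∀ v, A v ↔ ∃ w, kap a (stk v) w := by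
  obtain ⟨a, ha⟩ := sat_univ hA.p
  refine ⟨a, fun v => ?_⟩
  rw [← sat0_iff]
  exact ha () v

end Tools

section Snt

theorem mod_iff (N : PAMod) (φ : Snt) (v : Fin 0 → PF N) :
    N.C ⊨ φ ↔ BoundedFormula.Realize (M := PF N) φ default v := by
  rw [Subsingleton.elim v default]; exact Iff.rfl

theorem snt_sigma {k : ℕ} (R : PAMod → Prop) (h : Sg (M := PF) k (fun i (v : Fin 0 → PF i) => R i)) :
    ∃ φ ∈ SigmaS k, ∀ N : PAMod, N.C ⊨ φ ↔ R N := by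
  obtain ⟨φ, h1, h2⟩ := h.p.fml.1
  exact ⟨φ, h1, fun N => (mod_iff N φ default).trans (h2 N default)⟩

theorem snt_pi {k : ℕ} (R : PAMod → Prop) (h : Sg (M := PF) k (fun i (v : Fin 0 → PF i) => R i)) :
    ∃ φ ∈ PiS k, ∀ N : PAMod, N.C ⊨ φ ↔ ¬ R N := by
  obtain ⟨φ, h1, h2⟩ := h.p.fml.2
  exact ⟨φ, h1, fun N => (mod_iff N φ default).trans (h2 N default)⟩

theorem sigma_idx {k : ℕ} {φ : Snt} (h : φ ∈ SigmaS (k + 1)) :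
    ∃ e : ℕ, ∀ N : PAMod, N.C ⊨ φ ↔ Sat k (e : PF N) 0 := by
  obtain ⟨e, he⟩ := sat_univ (sigma_SgP (M := PF) h)
  exact ⟨e, fun N => (mod_iff N φ default).trans (he N default)⟩

theorem pi_idx {k : ℕ} {φ : Snt} (h : φ ∈ PiS (k + 1)) :
    ∃ e : ℕ, ∀ N : PAMod, N.C ⊨ φ ↔ ¬ Sat k (e : PF N) 0 := by
  obtain ⟨e, he⟩ := sat_univ (pi_SgP (M := PF) h)
  refine ⟨e, fun N => (mod_iff N φ default).trans ?_⟩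
  have := he N default
  rw [show stk (default : Fin 0 → PF N) = 0 from rfl] at this
  rw [← this, not_not]

theorem mod_add {T : Thy} {φ : Snt} {N : PAMod} : N.C ⊨ add T φ ↔ N.C ⊨ T ∧ N.C ⊨ φ := by
  constructor
  · intro h
    exact ⟨⟨fun ψ hψ => h.realize_of_mem ψ (Set.mem_insert_of_mem _ hψ)⟩,
      h.realize_of_mem φ (Set.mem_insert _ _)⟩
  · rintro ⟨h, h1⟩
    refine ⟨fun ψ hψ => ?_⟩
    rcases hψ with rfl | hψ
    · exact h1
    · exact h.realize_of_mem ψ hψ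

theorem prv_mem {T : Thy} {φ : Snt} (h : φ ∈ T) : Prv T φ :=
  (prv_iff T φ).2 fun M _ _ hM => hM.realize_of_mem φ h

theorem prv_mono {T T' : Thy} {φ : Snt} (hs : T ⊆ T') (h : Prv T φ) : Prv T' φ :=
  (prv_iff _ _).2 fun M _ _ hM => (prv_iff _ _).1 h M ⟨fun ψ hψ => hM.realize_of_mem ψ (hs hψ)⟩

theorem ext_add {T : Thy} (hT : ExtPA T) (φ : Snt) : ExtPA (add T φ) :=
  fun ψ hψ => prv_mono (Set.subset_insert _ _) (hT ψ hψ)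

theorem ext_PA : ExtPA PAAx := fun φ h => prv_mem h

theorem prv_add {T : Thy} (hT : ExtPA T) (φ ψ : Snt) :
    Prv (add T φ) ψ ↔ ∀ N : PAMod, N.C ⊨ T → N.C ⊨ φ → N.C ⊨ ψ := by
  rw [prv_pam _ (ext_add hT φ)]
  simp only [mod_add, and_imp]

theorem con_mod {T : Thy} (hT : ExtPA T) : Con T ↔ ∃ N : PAMod, N.C ⊨ T := by
  rw [Con, prv_pam T hT]
  push Not
  constructor
  · rintro ⟨N, h, _⟩; exact ⟨N, h⟩
  · rintro ⟨N, h⟩; exact ⟨N, h, fun h => h⟩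

theorem sub_mod {V T : Thy} (h : SubThy V T) (hT : ExtPA T) {N : PAMod} (hN : N.C ⊨ T) : N.C ⊨ V :=
  ⟨fun ψ hψ => (prv_pam T hT ψ).1 (h.2 ψ (prv_mem hψ)) N hN⟩

theorem mod_PA (N : PAMod) {T : Thy} (hT : ExtPA T) (h : N.C ⊨ T) : N.C ⊨ PAAx :=
  ⟨fun ψ hψ => (prv_pam T hT ψ).1 (hT ψ hψ) N h⟩

end Snt

section Phi
variable {N : Type} [PAM N]

/-- The self referential sigma formula. -/
def Phi (k : ℕ) (a b : N) : Prop := ∃ e, ∃ w, (kap a (pr (pr (pr 0 a) b) e) w ∧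
  (∀ x, x ≤ e + w → ¬ kap b (pr (pr 0 a) b) x)) ∧ Sat k e 0

/-- The second self referential sigma formula. -/
def Psi (k : ℕ) (a b : N) : Prop := ∃ x, kap b (pr (pr 0 a) b) x ∧
  (∀ e, e ≤ x → ∀ w, w ≤ x → kap a (pr (pr (pr 0 a) b) e) w → Sat k e 0)
end Phi

section PhiI
universe u
variable {ι : Type u} {M : ι → Type} [∀ i, PAM (M i)] {m : ℕ}

instance Sg.phi (k : ℕ) (f g : ∀ i, (Fin m → M i) → M i) [hf : Tm f] [hg : Tm g] :
    Sg (k + 1) (fun i v => Phi k (f i v) (g i v)) :=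
  Sg.sub (fun i (v : Fin 2 → M i) => Phi k (v 0) (v 1)) (by unfold Phi; infer_instance) ![f, g]
    (by intro j; fin_cases j <;> assumption)

instance Sg.psi (k : ℕ) (f g : ∀ i, (Fin m → M i) → M i) [hf : Tm f] [hg : Tm g] :
    Sg (k + 1) (fun i v => Psi k (f i v) (g i v)) :=
  Sg.sub (fun i (v : Fin 2 → M i) => Psi k (v 0) (v 1)) (by unfold Psi; infer_instance) ![f, g]
    (by intro j; fin_cases j <;> assumption)
end PhiI

section Fix

theorem kapc3 {N : Type} [PAM N] (a b e w : ℕ) :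
    kap (a : N) (pr (pr (pr 0 (a : N)) (b : N)) (e : N)) (w : N) ↔ kap a (pr (pr (pr 0 a) b) e) w := by
  rw [← kap_abs (N := N)]; simp only [pr_cast, Nat.cast_zero]
theorem kapc2 {N : Type} [PAM N] (a b w : ℕ) :
    kap (b : N) (pr (pr 0 (a : N)) (b : N)) (w : N) ↔ kap b (pr (pr 0 a) b) w := by
  rw [← kap_abs (N := N)]; simp only [pr_cast, Nat.cast_zero]

theorem fix_pt (T U W : Thy) (hT : GoodThy T) (hU : GoodThy U) (hW : GoodThy W)
    (G : ∀ N : PAMod, N.C → N.C → N.C → Prop) (H : ∀ N : PAMod, N.C → N.C → Prop)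
    (hG : Df (M := PF) (fun i (v : Fin 3 → PF i) => G i (v 0) (v 1) (v 2)))
    (hH : Df (M := PF) (fun i (v : Fin 2 → PF i) => H i (v 0) (v 1))) :
    ∃ a b : ℕ,
      (∀ e : ℕ, ((∀ N : PAMod, N.C ⊨ T → G N (a : PF N) (b : PF N) (e : PF N)) ∨
        (∀ N : PAMod, N.C ⊨ U → G N (a : PF N) (b : PF N) (e : PF N))) ↔
        ∃ w, kap a (pr (pr (pr 0 a) b) e) w) ∧
      ((∀ N : PAMod, N.C ⊨ W → H N (a : PF N) (b : PF N)) ↔ ∃ w, kap b (pr (pr 0 a) b) w) := by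
  have hT1 := re_of_df T hT.1 hT.2.2 _ hG
  have hU1 := re_of_df U hU.1 hU.2.2 _ hG
  have hA : Sg (M := NF) 1 (fun i (v : Fin 3 → NF i) =>
      (∀ N : PAMod, N.C ⊨ T → G N ((v 0 : ℕ) : PF N) ((v 1 : ℕ) : PF N) ((v 2 : ℕ) : PF N)) ∨
      (∀ N : PAMod, N.C ⊨ U → G N ((v 0 : ℕ) : PF N) ((v 1 : ℕ) : PF N) ((v 2 : ℕ) : PF N))) :=
    @Sg.or _ _ _ _ _ _ _ hT1 hU1
  obtain ⟨a, ha⟩ := re_index (fun v : Fin 3 → ℕ =>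
      (∀ N : PAMod, N.C ⊨ T → G N ((v 0 : ℕ) : PF N) ((v 1 : ℕ) : PF N) ((v 2 : ℕ) : PF N)) ∨
      (∀ N : PAMod, N.C ⊨ U → G N ((v 0 : ℕ) : PF N) ((v 1 : ℕ) : PF N) ((v 2 : ℕ) : PF N))) hA
  obtain ⟨b, hb⟩ := re_index (fun v : Fin 2 → ℕ =>
      ∀ N : PAMod, N.C ⊨ W → H N ((v 0 : ℕ) : PF N) ((v 1 : ℕ) : PF N)) (re_of_df W hW.1 hW.2.2 _ hH)
  exact ⟨a, b, fun e => ha ![a, b, e], hb ![a, b]⟩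

end Fix

section One
variable {T U : Thy} {k : ℕ}

theorem imp12 (hT : GoodThy T) (hU : GoodThy U) (h : Con (T ∪ ThIn (PiS (k + 1)) U)) :
    ∃ φ ∈ SigmaS (k + 1), HConsIn (PiS (k + 1)) T φ ∧ HConsIn (PiS (k + 1)) U φ ∧ φ ∉ Th T := by
  obtain ⟨a, b, hA, hB⟩ := fix_pt T U T hT hU hT
    (fun N x y e => Phi (N := PF N) k x y → ¬ Sat (N := PF N) k e 0) (fun N x y => Phi (N := PF N) k x y)
    (by
      have : Df (M := PF) (fun i (v : Fin 3 → PF i) => Phi k (v 0) (v 1)) := Sg.toDf (k := k + 1) _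
      have : Df (M := PF) (fun i (v : Fin 3 → PF i) => Sat k (v 2) 0) := Sg.toDf (k := k + 1) _
      infer_instance)
    (Sg.toDf (k := k + 1) _)
  obtain ⟨φ, hφ, hr⟩ := snt_sigma (k := k + 1) (fun N => Phi k (a : PF N) (b : PF N)) inferInstance
  have mk : ∀ (N : PAMod) (e w : ℕ), kap a (pr (pr (pr 0 a) b) e) w →
      (∀ x : ℕ, x ≤ e + w → ¬ kap b (pr (pr 0 a) b) x) → Sat k (e : PF N) 0 → Phi k (a : PF N) (b : PF N) := by
    intro N e w h1 h2 h3
    refine ⟨e, w, ⟨(kapc3 a b e w).2 h1, ?_⟩, h3⟩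
    intro x hx
    rw [← Nat.cast_add] at hx
    obtain ⟨y, hy, rfl⟩ := PAM.std _ x hx
    rw [kapc2]
    exact h2 y hy
  have nB : ¬ ∃ w, kap b (pr (pr 0 a) b) w := by
    intro hw
    have hph := hB.2 hw
    obtain ⟨w0, hw0⟩ := hw
    have hex : ExtPA (T ∪ ThIn (PiS (k + 1)) U) :=
      fun ψ hψ => prv_mono Set.subset_union_left (hT.2.2 ψ hψ)
    obtain ⟨N, hN⟩ := (con_mod hex).1 h
    have hNT : N.C ⊨ T := ⟨fun ψ hψ => hN.realize_of_mem ψ (Or.inl hψ)⟩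
    have hNU : ∀ ψ ∈ PiS (k + 1), Prv U ψ → N.C ⊨ ψ :=
      fun ψ h1 h2 => hN.realize_of_mem ψ (Or.inr ⟨h1, h2⟩)
    have hPN := hph N hNT
    obtain ⟨e, w, ⟨h1, h2⟩, h3⟩ := id hPN
    have hlt : e + w ≤ (w0 : PF N) := by
      by_contra hc
      exact h2 _ (not_le.1 hc).le ((kapc2 a b w0).2 hw0)
    obtain ⟨e, he, rfl⟩ := PAM.std w0 e (le_self_add.trans hlt)
    obtain ⟨w, hw, rfl⟩ := PAM.std w0 w (le_add_self.trans hlt)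
    rw [kapc3] at h1
    have h2' : ∀ x : ℕ, x ≤ e + w → ¬ kap b (pr (pr 0 a) b) x := by
      intro x hx hk
      refine h2 x ?_ ((kapc2 a b x).2 hk)
      rw [← Nat.cast_add]; exact Nat.cast_le.2 hx
    rcases (hA e).2 ⟨w, h1⟩ with hh | hh
    · exact hh N hNT hPN h3
    · obtain ⟨ψ, hψ, hψr⟩ := snt_pi (k := k + 1) (fun N => Sat k (e : PF N) 0) inferInstance
      refine (hψr N).1 (hNU ψ hψ ((prv_pam U hU.2.2 ψ).2 fun K hK => (hψr K).2 fun hs => ?_)) h3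
      exact hh K hK (mk K e w h1 h2' hs) hs
  have cons : ∀ S : Thy, (S = T ∨ S = U) → ExtPA S → HConsIn (PiS (k + 1)) S φ := by
    intro S hS hSe V hV γ hγ hp
    obtain ⟨e, he⟩ := pi_idx hγ
    rw [prv_add hV.1] at hp
    have hAe : ∃ w, kap a (pr (pr (pr 0 a) b) e) w := by
      refine (hA e).1 ?_
      have : ∀ N : PAMod, N.C ⊨ S → Phi k (a : PF N) (b : PF N) → ¬ Sat k (e : PF N) 0 :=
        fun N hN hq => (he N).1 (hp N (sub_mod hV hSe hN) ((hr N).2 hq))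
      rcases hS with rfl | rfl
      · exact Or.inl this
      · exact Or.inr this
    obtain ⟨w, hw⟩ := hAe
    refine (prv_pam V hV.1 γ).2 fun N hN => ?_
    by_cases hq : N.C ⊨ φ
    · exact hp N hN hq
    · refine (he N).2 fun hs => hq ((hr N).2 (mk N e w hw (fun x _ hx => nB ⟨x, hx⟩) hs))
  refine ⟨φ, hφ, cons T (Or.inl rfl) hT.2.2, cons U (Or.inr rfl) hU.2.2, fun hp => nB (hB.1 fun N hN => ?_)⟩
  exact (hr N).1 ((prv_pam T hT.2.2 φ).1 hp N hN)

theorem sg_fin (k : ℕ) (S : Finset ℕ) :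
    Sg (M := PF) (k + 1) (fun i (v : Fin 0 → PF i) => ∀ e ∈ S, Sat k (e : PF i) 0) := by
  classical
  induction S using Finset.induction_on with
  | empty =>
    have : Sg (M := PF) (k + 1) (fun i (v : Fin 0 → PF i) => (0 : PF i) = 0) := inferInstance
    exact this.congr fun i v => by simp
  | insert x S _ ih =>
    refine (Sg.and (fun i (v : Fin 0 → PF i) => Sat k (x : PF i) 0) _ (hB := ih)).congr fun i v => ?_
    simp

theorem imp14 (hT : GoodThy T) (hU : GoodThy U) (h : Con (T ∪ ThIn (PiS (k + 1)) U)) :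
    ∃ φ ∈ PiS (k + 1), HConsIn (SigmaS (k + 1)) T φ ∧ HConsIn (SigmaS (k + 1)) U φ ∧ φ ∉ Th U := by
  classical
  obtain ⟨a, b, hA, hB⟩ := fix_pt T U U hT hU hU
    (fun N x y e => ¬ Psi (N := PF N) k x y → Sat (N := PF N) k e 0) (fun N x y => ¬ Psi (N := PF N) k x y)
    (by
      have : Df (M := PF) (fun i (v : Fin 3 → PF i) => Psi k (v 0) (v 1)) := Sg.toDf (k := k + 1) _
      have : Df (M := PF) (fun i (v : Fin 3 → PF i) => Sat k (v 2) 0) := Sg.toDf (k := k + 1) _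
      infer_instance)
    (by
      have : Df (M := PF) (fun i (v : Fin 2 → PF i) => Psi k (v 0) (v 1)) := Sg.toDf (k := k + 1) _
      infer_instance)
  obtain ⟨φ, hφ, hr⟩ := snt_pi (k := k + 1) (fun N => Psi k (a : PF N) (b : PF N)) inferInstance
  have nB : ¬ ∃ w, kap b (pr (pr 0 a) b) w := by
    intro hw
    have hph := hB.2 hw
    have hmin : ∀ x, x < Nat.find hw → ¬ kap b (pr (pr 0 a) b) x := fun x hx => Nat.find_min hw hx
    have hw0 := Nat.find_spec hw
    generalize Nat.find hw = w0 at hw0 hmin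
    have hex : ExtPA (T ∪ ThIn (PiS (k + 1)) U) :=
      fun ψ hψ => prv_mono Set.subset_union_left (hT.2.2 ψ hψ)
    obtain ⟨N, hN⟩ := (con_mod hex).1 h
    have hNT : N.C ⊨ T := ⟨fun ψ hψ => hN.realize_of_mem ψ (Or.inl hψ)⟩
    have hNU : ∀ ψ ∈ PiS (k + 1), Prv U ψ → N.C ⊨ ψ :=
      fun ψ h1 h2 => hN.realize_of_mem ψ (Or.inr ⟨h1, h2⟩)
    have hdic : ∀ e, e ≤ w0 → ∀ w, w ≤ w0 → kap a (pr (pr (pr 0 a) b) e) w →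
        (∀ K : PAMod, K.C ⊨ T → Sat k (e : PF K) 0) ∨ (∀ K : PAMod, K.C ⊨ U → Sat k (e : PF K) 0) := by
      intro e he w hw hk
      rcases (hA e).2 ⟨w, hk⟩ with hh | hh
      · left
        intro K hK
        by_cases hps : Psi k (a : PF K) (b : PF K)
        · obtain ⟨x, hx1, hx2⟩ := hps
          have hle : (w0 : PF K) ≤ x := by
            by_contra hc
            obtain ⟨x, hx, rfl⟩ := PAM.std w0 x (not_le.1 hc).le
            exact hmin x (Nat.cast_lt.1 (not_le.1 hc)) ((kapc2 a b x).1 hx1)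
          exact hx2 e ((Nat.cast_le.2 he).trans hle) w ((Nat.cast_le.2 hw).trans hle) ((kapc3 a b e w).2 hk)
        · exact hh K hK hps
      · right
        intro K hK
        exact hh K hK (hph K hK)
    let S : Finset ℕ := (Finset.range (w0 + 1)).filter fun e => ∀ K : PAMod, K.C ⊨ T → Sat k (e : PF K) 0
    obtain ⟨ψ, hψ, hψr⟩ := snt_pi _ (sg_fin k S)
    refine (hψr N).1 (hNU ψ hψ ((prv_pam U hU.2.2 ψ).2 fun K hK => (hψr K).2 fun hs => ?_)) ?_
    · refine hph K hK ⟨w0, (kapc2 a b w0).2 hw0, ?_⟩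
      intro e he w hw hk
      obtain ⟨e, he', rfl⟩ := PAM.std w0 e he
      obtain ⟨w, hw', rfl⟩ := PAM.std w0 w hw
      rcases hdic e he' w hw' ((kapc3 a b e w).1 hk) with hh | hh
      · exact hs e (Finset.mem_filter.2 ⟨Finset.mem_range.2 (Nat.lt_succ_of_le he'), hh⟩)
      · exact hh K hK
    · intro e he
      exact (Finset.mem_filter.1 he).2 N hNT
  have cons : ∀ S : Thy, (S = T ∨ S = U) → ExtPA S → HConsIn (SigmaS (k + 1)) S φ := by
    intro S hS hSe V hV γ hγ hp
    obtain ⟨e, he⟩ := sigma_idx hγ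
    rw [prv_add hV.1] at hp
    have hAe : ∃ w, kap a (pr (pr (pr 0 a) b) e) w := by
      refine (hA e).1 ?_
      have : ∀ N : PAMod, N.C ⊨ S → ¬ Psi k (a : PF N) (b : PF N) → Sat k (e : PF N) 0 :=
        fun N hN hq => (he N).1 (hp N (sub_mod hV hSe hN) ((hr N).2 hq))
      rcases hS with rfl | rfl
      · exact Or.inl this
      · exact Or.inr this
    obtain ⟨w, hw⟩ := hAe
    refine (prv_pam V hV.1 γ).2 fun N hN => ?_
    by_cases hq : Psi k (a : PF N) (b : PF N)
    · obtain ⟨x, hx1, hx2⟩ := hq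
      have hst : ∀ n : ℕ, (n : PF N) ≤ x := by
        intro n
        by_contra hc
        obtain ⟨x, hx, rfl⟩ := PAM.std n x (not_le.1 hc).le
        exact nB ⟨x, (kapc2 a b x).1 hx1⟩
      exact (he N).2 (hx2 e (hst e) w (hst w) ((kapc3 a b e w).2 hw))
    · exact hp N hN ((hr N).2 hq)
  refine ⟨φ, hφ, cons T (Or.inl rfl) hT.2.2, cons U (Or.inr rfl) hU.2.2, fun hp => nB (hB.1 fun N hN => ?_)⟩
  exact (hr N).1 ((prv_pam U hU.2.2 φ).1 hp N hN)

end One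

section Easy
variable {T U : Thy} {k : ℕ}

theorem mod_imp {N : PAMod} {φ ψ : Snt} : N.C ⊨ (φ ⟹ ψ) ↔ (N.C ⊨ φ → N.C ⊨ ψ) := Iff.rfl

theorem hcons_or {Γ : Set Snt} {T : Thy} (hT : ExtPA T) {φ γ : Snt} (hφ : HConsIn Γ T φ) (hγ : γ ∈ Γ)
    (h : ∀ N : PAMod, N.C ⊨ T → N.C ⊨ φ → N.C ⊨ γ) (N : PAMod) (hN : N.C ⊨ PAAx) : N.C ⊨ φ ∨ N.C ⊨ γ := by
  have hV : SubThy (add PAAx (φ ⟹ γ)) T := by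
    refine ⟨ext_add ext_PA _, fun ψ hψ => ?_⟩
    rw [prv_add ext_PA] at hψ
    rw [prv_pam T hT]
    exact fun N hN => hψ N (mod_PA N hT hN) (mod_imp.2 (h N hN))
  have h1 := hφ _ hV γ hγ (by
    rw [prv_add hV.1]
    intro N hN h1
    exact mod_imp.1 (mod_add.1 hN).2 h1)
  rw [prv_add ext_PA] at h1
  by_cases hc : N.C ⊨ φ
  · exact Or.inl hc
  · exact Or.inr (h1 N hN (mod_imp.2 fun h => absurd h hc))

theorem imp31 (hT : ExtPA T) (hU : ExtPA U) {n : ℕ} {φ : Snt} (h : HConsIn (PiS n) U φ) (h' : φ ∉ Th T) :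
    Con (T ∪ ThIn (PiS n) U) := by
  have h1 : ¬ Prv T φ := h'
  rw [prv_pam T hT] at h1
  push Not at h1
  obtain ⟨N, hN, hn⟩ := h1
  have hex : ExtPA (T ∪ ThIn (PiS n) U) :=
    fun ψ hψ => prv_mono Set.subset_union_left (hT ψ hψ)
  refine (con_mod hex).2 ⟨N, ⟨?_⟩⟩
  rintro ψ (hψ | ⟨hψ, hp⟩)
  · exact hN.realize_of_mem ψ hψ
  · exact (hcons_or hU h hψ (fun K hK _ => (prv_pam U hU ψ).1 hp K hK) N (mod_PA N hT hN)).resolve_left hn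

theorem sg_fin_or (k : ℕ) (S : Finset ℕ) :
    Sg (M := PF) (k + 1) (fun i (v : Fin 0 → PF i) => ∃ e ∈ S, Sat k (e : PF i) 0) := by
  classical
  induction S using Finset.induction_on with
  | empty =>
    have : Sg (M := PF) (k + 1) (fun i (v : Fin 0 → PF i) => ¬ (0 : PF i) = 0) := inferInstance
    exact this.congr fun i v => by simp
  | insert x S _ ih =>
    refine (Sg.or (fun i (v : Fin 0 → PF i) => Sat k (x : PF i) 0) _ (hB := ih)).congr fun i v => ?_
    simp

theorem not_con (hT : ExtPA T) (hU : ExtPA U) (h : ¬ Con (T ∪ ThIn (PiS (k + 1)) U)) :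
    ∃ π ∈ PiS (k + 1), (∀ N : PAMod, N.C ⊨ U → N.C ⊨ π) ∧ (∀ N : PAMod, N.C ⊨ T → ¬ N.C ⊨ π) := by
  classical
  have h1 : Prv (T ∪ ThIn (PiS (k + 1)) U) ⊥ := by
    by_contra hc; exact h hc
  obtain ⟨T0, h0, h2⟩ := Theory.models_iff_finset_models.1 h1
  have hi : ∀ ψ : Snt, ∃ e : ℕ, ψ ∈ PiS (k + 1) → ∀ N : PAMod, N.C ⊨ ψ ↔ ¬ Sat k (e : PF N) 0 := by
    intro ψ
    by_cases hψ : ψ ∈ PiS (k + 1)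
    · obtain ⟨e, he⟩ := pi_idx hψ
      exact ⟨e, fun _ => he⟩
    · exact ⟨0, fun h => absurd h hψ⟩
  choose f hf using hi
  obtain ⟨π, hπ, hr⟩ := snt_pi _ (sg_fin_or k ((T0.filter fun ψ => ψ ∈ ThIn (PiS (k + 1)) U).image f))
  refine ⟨π, hπ, fun N hN => (hr N).2 ?_, fun N hN hp => ?_⟩
  · rintro ⟨e, he, hs⟩
    obtain ⟨ψ, hψ, rfl⟩ := Finset.mem_image.1 he
    obtain ⟨h3, h4⟩ := (Finset.mem_filter.1 hψ).2
    exact (hf ψ h3 N).1 ((prv_pam U hU ψ).1 h4 N hN) hs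
  · have h5 := (hr N).1 hp
    refine (prv_iff (T0 : Thy) ⊥).1 h2 N.C ⟨fun ψ hψ => ?_⟩
    rcases h0 hψ with h6 | h6
    · exact hN.realize_of_mem ψ h6
    · exact (hf ψ h6.1 N).2 fun hs => h5 ⟨f ψ, Finset.mem_image.2 ⟨ψ, Finset.mem_filter.2 ⟨hψ, h6⟩, rfl⟩, hs⟩

theorem imp51 (hT : ExtPA T) (hU : ExtPA U) {φ : Snt} (h : HConsIn (SigmaS (k + 1)) T φ) (h' : φ ∉ Th U) :
    Con (T ∪ ThIn (PiS (k + 1)) U) := by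
  by_contra hc
  obtain ⟨π, hπ, h1, h2⟩ := not_con hT hU hc
  obtain ⟨e, he⟩ := pi_idx hπ
  obtain ⟨σ, hσ, hr⟩ := snt_sigma (k := k + 1) (fun N => Sat k (e : PF N) 0) inferInstance
  refine h' ((prv_pam U hU φ).2 fun N hN => ?_)
  refine (hcons_or hT h hσ (fun K hK _ => ?_) N (mod_PA N hU hN)).resolve_right fun hs => ?_
  · exact (hr K).2 (by_contra fun hn => h2 K hK ((he K).2 hn))
  · exact (he N).1 (h1 N hN) ((hr N).1 hs)

theorem imp61 (hT : ExtPA T) (hU : ExtPA U) {φ π : Snt} (h : HDeltaCons (k + 1) T φ) (hπ : π ∈ PiS (k + 1))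
    (hp : Prv (add PAAx φ) π) (hn : ¬ Prv U π) :
    Con (T ∪ ThIn (PiS (k + 1)) U) := by
  by_contra hc
  obtain ⟨ρ, hρ, h1, h2⟩ := not_con hT hU hc
  obtain ⟨S1, hS1, e1⟩ := pi_SgP (M := PF) hπ
  obtain ⟨S2, hS2, e2⟩ := pi_SgP (M := PF) hρ
  let Q1 : ∀ N : PAMod, PF N → Prop := fun N x => S1 N (fun _ => x)
  let Q2 : ∀ N : PAMod, PF N → Prop := fun N x => S2 N (fun _ => x)
  have sn : ∀ (N : PAMod) (x : PF N), (Fin.snoc (default : Fin 0 → PF N) x : Fin 1 → PF N) = fun _ => x := by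
    intro N x; funext j; fin_cases j; rfl
  have c1 : ∀ N : PAMod, N.C ⊨ π ↔ ∀ x, Q1 N x := by
    intro N
    have := e1 N default
    simp only [sn] at this
    rw [mod_iff N π default, ← not_iff_not, this, not_forall]
  have c2 : ∀ N : PAMod, N.C ⊨ ρ ↔ ∀ x, Q2 N x := by
    intro N
    have := e2 N default
    simp only [sn] at this
    rw [mod_iff N ρ default, ← not_iff_not, this, not_forall]
  have i1 : ∀ {m : ℕ} (f : ∀ i : PAMod, (Fin m → PF i) → PF i) [Tm f], Sg (M := PF) k (fun i v => Q1 i (f i v)) :=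
    fun f hf => ⟨SgP.sub S1 hS1 (fun _ => f) (fun _ => hf)⟩
  have i2 : ∀ {m : ℕ} (f : ∀ i : PAMod, (Fin m → PF i) → PF i) [Tm f], Sg (M := PF) k (fun i v => Q2 i (f i v)) :=
    fun f hf => ⟨SgP.sub S2 hS2 (fun _ => f) (fun _ => hf)⟩
  have j1 : ∀ {m : ℕ} (f : ∀ i : PAMod, (Fin m → PF i) → PF i) [Tm f], Sg (M := PF) (k + 1) (fun i v => Q1 i (f i v)) :=
    fun f hf => ⟨(i1 f).p.up⟩
  have j2 : ∀ {m : ℕ} (f : ∀ i : PAMod, (Fin m → PF i) → PF i) [Tm f], Sg (M := PF) (k + 1) (fun i v => Q2 i (f i v)) :=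
    fun f hf => ⟨(i2 f).p.up⟩
  obtain ⟨δ, hδ, dr⟩ := snt_sigma (k := k + 1) (fun N => ∃ x, ¬ Q2 N x ∧ ∀ y, y < x → Q1 N y) inferInstance
  obtain ⟨ε, hε, er⟩ := snt_pi (k := k + 1) (fun N => ∃ x, ¬ Q1 N x ∧ ∀ y, y ≤ x → Q2 N y) inferInstance
  have hcomp : ∀ N : PAMod, ¬ (N.C ⊨ π ∧ N.C ⊨ ρ) → (N.C ⊨ δ ↔ N.C ⊨ ε) := by
    intro N hN
    rw [dr, er]
    rw [c1, c2, not_and_or, not_forall, not_forall] at hN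
    have dd : Df (M := PF) (fun i (w : Fin 1 → PF i) => ¬ Q1 i (w 0) ∨ ¬ Q2 i (w 0)) := by
      have k1 : Df (M := PF) (fun i (w : Fin 1 → PF i) => Q1 i (w 0)) := Sg.toDf (k := k) _
      have k2 : Df (M := PF) (fun i (w : Fin 1 → PF i) => Q2 i (w 0)) := Sg.toDf (k := k) _
      infer_instance
    have hl : ∃ x, (¬ Q1 N x ∨ ¬ Q2 N x) ∧ ∀ y, y < x → ¬ (¬ Q1 N y ∨ ¬ Q2 N y) := by
      refine dleast (M := PF) (m := 0) (fun i _ x => ¬ Q1 i x ∨ ¬ Q2 i x) (hR := dd) (i := N) default ?_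
      rcases hN with ⟨x, hx⟩ | ⟨x, hx⟩
      · exact ⟨x, Or.inl hx⟩
      · exact ⟨x, Or.inr hx⟩
    obtain ⟨x, hx, hmin⟩ := hl
    by_cases h2x : Q2 N x
    · have h1x : ¬ Q1 N x := hx.resolve_right (not_not.2 h2x)
      refine iff_of_false ?_ (not_not.2 ⟨x, h1x, ?_⟩)
      · rintro ⟨z, hz, hy⟩
        refine h1x (hy x ?_)
        by_contra hlt
        rcases (not_lt.1 hlt).lt_or_eq with hlt | rfl
        · exact hmin z hlt (Or.inr hz)
        · exact hz h2x
      · intro y hy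
        rcases hy.lt_or_eq with hlt | rfl
        · by_contra hq; exact hmin y hlt (Or.inr hq)
        · exact h2x
    · refine iff_of_true ⟨x, h2x, fun y hy => ?_⟩ ?_
      · by_contra hq; exact hmin y hy (Or.inl hq)
      · rintro ⟨z, hz, hy⟩
        refine h2x (hy x ?_)
        by_contra hlt
        exact hmin z (not_le.1 hlt) (Or.inl hz)
  have hV : SubThy (add PAAx (π ⟹ ∼ρ)) T := by
    refine ⟨ext_add ext_PA _, fun ψ hψ => ?_⟩
    rw [prv_add ext_PA] at hψ
    rw [prv_pam T hT]
    exact fun N hN => hψ N (mod_PA N hT hN) (mod_imp.2 fun _ => h2 N hN)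
  have hVm : ∀ N : PAMod, N.C ⊨ add PAAx (π ⟹ ∼ρ) → ¬ (N.C ⊨ π ∧ N.C ⊨ ρ) :=
    fun N hN hh => (mod_imp.1 (mod_add.1 hN).2 hh.1) hh.2
  have hδp : Prv (add PAAx (π ⟹ ∼ρ)) δ := by
    refine h _ hV δ ⟨⟨δ, hδ, prv_mem ?_⟩, ⟨ε, hε, prv_mem ?_⟩⟩ ?_
    · exact (prv_pam _ hV.1 _).2 fun N hN => BoundedFormula.realize_iff.2 Iff.rfl
    · exact (prv_pam _ hV.1 _).2 fun N hN => BoundedFormula.realize_iff.2 (hcomp N (hVm N hN))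
    · rw [prv_add hV.1]
      intro N hN hφ
      have hπN : N.C ⊨ π := (prv_add ext_PA φ π).1 hp N (mod_add.1 hN).1 hφ
      have hρN : ¬ N.C ⊨ ρ := fun hh => hVm N hN ⟨hπN, hh⟩
      rw [c2, not_forall] at hρN
      obtain ⟨x, hx⟩ := hρN
      exact (dr N).2 ⟨x, hx, fun y _ => (c1 N).1 hπN y⟩
  rw [prv_pam U hU] at hn
  push Not at hn
  obtain ⟨N, hN, hnp⟩ := hn
  have := (prv_pam _ hV.1 δ).1 hδp N (mod_add.2 ⟨mod_PA N hU hN, mod_imp.2 fun hh => absurd hh hnp⟩)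
  obtain ⟨x, hx, _⟩ := (dr N).1 this
  exact hx ((c2 N).1 (h1 N hN) x)

theorem imp46 (hU : ExtPA U) {φ : Snt} {n : ℕ} (h0 : φ ∈ PiS n) (h : HConsIn (SigmaS n) T φ) (h' : φ ∉ Th U) :
    ∃ φ, HDeltaCons n T φ ∧ ∃ π ∈ PiS n, Prv (add PAAx φ) π ∧ ¬ Prv U π := by
  refine ⟨φ, ?_, φ, h0, prv_mem (Set.mem_insert _ _), h'⟩
  intro V hV δ hδ hp
  obtain ⟨⟨σ, hσ, hs⟩, _⟩ := hδ
  have hs' : ∀ N : PAMod, N.C ⊨ V → (N.C ⊨ δ ↔ N.C ⊨ σ) := by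
    intro N hN
    refine BoundedFormula.realize_iff.1 ((prv_iff (Th V) _).1 hs N.C ⟨fun ψ hψ => ?_⟩)
    exact (prv_pam V hV.1 ψ).1 hψ N hN
  rw [prv_add hV.1] at hp
  have := h V hV σ hσ ((prv_add hV.1 φ σ).2 fun N hN hq => (hs' N hN).1 (hp N hN hq))
  rw [prv_pam V hV.1] at this ⊢
  exact fun N hN => (hs' N hN).2 (this N hN)

end Easy

end Work

/-- Theorem 4.2 (refinement of Bennet's characterization): for computable consistent
extensions `T`, `U` of `PA` and `n ≥ 1`, six conditions are equivalent. -/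
theorem stmt_0 (T U : Thy) (hT : GoodThy T) (hU : GoodThy U) (n : ℕ) (hn : 1 ≤ n) :
    List.TFAE
      [Con (T ∪ ThIn (PiS n) U),
       ∃ φ ∈ SigmaS n, HConsIn (PiS n) T φ ∧ HConsIn (PiS n) U φ ∧ φ ∉ Th T,
       ∃ φ : Snt, HConsIn (PiS n) U φ ∧ φ ∉ Th T,
       ∃ φ ∈ PiS n, HConsIn (SigmaS n) T φ ∧ HConsIn (SigmaS n) U φ ∧ φ ∉ Th U,
       ∃ φ : Snt, HConsIn (SigmaS n) T φ ∧ φ ∉ Th U,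
       ∃ φ : Snt, HDeltaCons n T φ ∧ ∃ π ∈ PiS n, Prv (add PAAx φ) π ∧ ¬ Prv U π] := by
  obtain ⟨k, rfl⟩ : ∃ k, n = k + 1 := ⟨n - 1, by omega⟩
  have eT := hT.2.2
  have eU := hU.2.2
  tfae_have 1 → 2 := imp12 hT hU
  tfae_have 2 → 3 := fun ⟨φ, _, _, h1, h2⟩ => ⟨φ, h1, h2⟩
  tfae_have 3 → 1 := fun ⟨φ, h1, h2⟩ => imp31 eT eU h1 h2
  tfae_have 1 → 4 := imp14 hT hU
  tfae_have 4 → 5 := fun ⟨φ, _, h1, _, h2⟩ => ⟨φ, h1, h2⟩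
  tfae_have 5 → 1 := fun ⟨φ, h1, h2⟩ => imp51 eT eU h1 h2
  tfae_have 4 → 6 := fun ⟨φ, h0, h1, _, h2⟩ => imp46 eU h0 h1 h2
  tfae_have 6 → 1 := fun ⟨φ, h1, π, h2, h3, h4⟩ => imp61 eT eU h1 h2 h3 h4
  tfae_finish

end Guaspari
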